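/- If u_a is a minimizer for e(a) with 0 ≤ a < a* and ε := (a*-a)^{1/(2+p)}, then ∫_{ℝ²}|∇u_a|² dx ≤ C ε^{-2} and ∫_{ℝ²} V(x) u_a(x)² dx ≤ C ε^p for a constant C independent of a. -/

import Mathlib

open MeasureTheory Real Filter

noncomputable section

abbrev E2 : Type := EuclideanSpace ℝ (Fin 2)

/-- squared norm of the gradient -/
def gradSq (u : E2 → ℝ) (x : E2) : ℝ := ‖fderiv ℝ u x‖ ^ 2

/-- the Laplacian as the sum of second partial derivatives -/
def lap (u : E2 → ℝ) (x : E2) : ℝ :=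
  ∑ i : Fin 2, fderiv ℝ (fun y => fderiv ℝ u y (EuclideanSpace.single i 1)) x
      (EuclideanSpace.single i 1)

/-- membership in H¹(ℝ²) together with L⁴ (which follows by Sobolev embedding) -/
def IsH1 (u : E2 → ℝ) : Prop :=
  Differentiable ℝ u ∧ Integrable (fun x => u x ^ 2) ∧
    Integrable (gradSq u) ∧ Integrable (fun x => u x ^ 4)

/-- `Q` is the (unique) positive radial H¹ solution of `-ΔQ + Q - Q³ = 0` in ℝ² -/
def IsGroundState (Q : E2 → ℝ) : Prop :=
  ContDiff ℝ 2 Q ∧ (∀ x, 0 < Q x) ∧ (∀ x y : E2, ‖x‖ = ‖y‖ → Q x = Q y) ∧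
    IsH1 Q ∧ ∀ x, -lap Q x + Q x - Q x ^ 3 = 0

/-- the space 𝓗 : H¹ functions with finite potential energy -/
def InH (V : E2 → ℝ) (u : E2 → ℝ) : Prop :=
  IsH1 u ∧ Integrable (fun x => V x * u x ^ 2)

/-- the Gross–Pitaevskii functional -/
def Ea (V : E2 → ℝ) (a : ℝ) (u : E2 → ℝ) : ℝ :=
  (∫ x, gradSq u x) + (∫ x, V x * u x ^ 2) - a / 2 * (∫ x, u x ^ 4)

/-- a minimizer of the GP functional on the unit L² sphere of 𝓗 -/
def IsMinimizer (V : E2 → ℝ) (a : ℝ) (u : E2 → ℝ) : Prop :=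
  InH V u ∧ (∫ x, u x ^ 2) = 1 ∧
    ∀ v, InH V v → (∫ x, v x ^ 2) = 1 → Ea V a u ≤ Ea V a v

/-- the GP ground-state energy, with values in ℝ ∪ {±∞} -/
def gpE (V : E2 → ℝ) (a : ℝ) : EReal :=
  sInf {y : EReal | ∃ u, InH V u ∧ (∫ x, u x ^ 2) = 1 ∧ y = (Ea V a u : EReal)}


open Set Topology in
structure RadSol (u du : ℝ → ℝ) (α : ℝ) : Prop where
  pos : ∀ r, 0 < r → 0 < u r
  hd1 : ∀ r, 0 < r → HasDerivAt u (du r) r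
  hd2 : ∀ r, 0 < r → HasDerivAt du (-du r / r + u r - u r ^ 3) r
  lim0 : Tendsto u (𝓝[>] 0) (𝓝 α)
  dlim0 : Tendsto du (𝓝[>] 0) (𝓝 0)
  int : IntegrableOn (fun r => u r ^ 2 * r) (Ioi 0)

namespace RadSol
open Set Topology
variable {u du : ℝ → ℝ} {α : ℝ}

lemma energy_hasDeriv (H : RadSol u du α) {r : ℝ} (hr : 0 < r) :
    HasDerivAt (fun r => du r ^ 2 / 2 - u r ^ 2 / 2 + u r ^ 4 / 4) (-(du r ^ 2 / r)) r := by
  have h1 := H.hd1 r hr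
  have h2 := H.hd2 r hr
  have := (((h2.pow 2).div_const 2).sub ((h1.pow 2).div_const 2)).add ((h1.pow 4).div_const 4)
  refine this.congr_deriv ?_
  have hr' := hr.ne'
  field_simp
  ring

lemma energy_le (H : RadSol u du α) {r : ℝ} (hr : 0 < r) :
    du r ^ 2 / 2 - u r ^ 2 / 2 + u r ^ 4 / 4 ≤ 0 ^ 2 / 2 - α ^ 2 / 2 + α ^ 4 / 4 := by
  have hlim : Tendsto (fun r => du r ^ 2 / 2 - u r ^ 2 / 2 + u r ^ 4 / 4) (𝓝[>] 0)
      (𝓝 (0 ^ 2 / 2 - α ^ 2 / 2 + α ^ 4 / 4)) :=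
    (((H.dlim0.pow 2).div_const 2).sub ((H.lim0.pow 2).div_const 2)).add
      ((H.lim0.pow 4).div_const 4)
  have hanti : AntitoneOn (fun r => du r ^ 2 / 2 - u r ^ 2 / 2 + u r ^ 4 / 4) (Ioi 0) := by
    apply antitoneOn_of_deriv_nonpos (convex_Ioi 0)
    · intro x hx
      exact (H.energy_hasDeriv hx).continuousAt.continuousWithinAt
    · intro x hx
      rw [interior_Ioi] at hx
      exact (H.energy_hasDeriv hx).differentiableAt.differentiableWithinAt
    · intro x hx
      rw [interior_Ioi] at hx
      rw [(H.energy_hasDeriv hx).deriv]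
      have : 0 ≤ du x ^ 2 / x := div_nonneg (sq_nonneg _) (le_of_lt hx)
      linarith
  refine ge_of_tendsto hlim ?_
  filter_upwards [Ioo_mem_nhdsGT hr] with x hx
  exact hanti hx.1 hr hx.2.le

lemma bdd (H : RadSol u du α) : ∃ C, 0 < C ∧ ∀ r, 0 < r → u r ≤ C ∧ |du r| ≤ C := by
  set E0 := 0 ^ 2 / 2 - α ^ 2 / 2 + α ^ 4 / 4 with hE0
  refine ⟨|3 * E0| + 9/4 + 1, by positivity, fun r hr => ?_⟩
  have h := H.energy_le hr
  have hE : |3 * E0| = 3 * |E0| := by rw [abs_mul]; norm_num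
  have h1 : E0 ≤ |E0| := le_abs_self _
  have h1' : 0 ≤ |E0| := abs_nonneg _
  rw [hE]
  have h2 : u r ^ 2 ≤ E0 + 9/4 := by nlinarith [sq_nonneg (u r ^ 2 / 2 - 3/2), sq_nonneg (du r)]
  have h3 : du r ^ 2 ≤ 2 * E0 + u r ^ 2 := by nlinarith [sq_nonneg (u r ^ 2)]
  constructor
  · nlinarith [sq_nonneg (u r - 1), sq_nonneg (u r)]
  · apply abs_le_of_sq_le_sq' _ (by positivity) |> abs_le.mpr
    nlinarith [sq_nonneg (|E0|)]

lemma cont (H : RadSol u du α) : ContinuousOn u (Ioi 0) :=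
  fun x hx => (H.hd1 x hx).continuousAt.continuousWithinAt

lemma dcont (H : RadSol u du α) : ContinuousOn du (Ioi 0) :=
  fun x hx => (H.hd2 x hx).continuousAt.continuousWithinAt

lemma lim_top (H : RadSol u du α) : Tendsto u atTop (𝓝 0) := by
  obtain ⟨C, hC, hb⟩ := H.bdd
  have hs : Ioi (1:ℝ) ⊆ Ioi 0 := Ioi_subset_Ioi zero_le_one
  have hintg : IntegrableOn (fun r => u r ^ 2 * r) (Ioi 1) := H.int.mono_set hs
  have hi1 : IntegrableOn (fun r => u r ^ 3) (Ioi 1) := by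
    refine Integrable.mono' (hintg.const_mul C) ?_ ?_
    · exact ((H.cont.mono hs).pow 3).aestronglyMeasurable measurableSet_Ioi
    · refine (ae_restrict_iff' measurableSet_Ioi).2 (Eventually.of_forall fun r hr => ?_)
      have hr0 : (0:ℝ) < r := hs hr
      have hr1 : (1:ℝ) < r := hr
      have hp := H.pos r hr0
      rw [Real.norm_of_nonneg (by positivity)]
      have := (hb r hr0).1
      calc u r ^ 3 = u r ^ 2 * u r := by ring
        _ ≤ u r ^ 2 * C := by gcongr
        _ ≤ C * (u r ^ 2 * r) := by nlinarith [mul_pos hC (pow_pos hp 2)]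
  have hi2 : IntegrableOn (fun r => 3 * u r ^ 2 * du r) (Ioi 1) := by
    refine Integrable.mono' (hintg.const_mul (3 * C)) ?_ ?_
    · exact ((continuousOn_const.mul ((H.cont.mono hs).pow 2)).mul
        (H.dcont.mono hs)).aestronglyMeasurable measurableSet_Ioi
    · refine (ae_restrict_iff' measurableSet_Ioi).2 (Eventually.of_forall fun r hr => ?_)
      have hr0 : (0:ℝ) < r := hs hr
      have hr1 : (1:ℝ) < r := hr
      have hp := H.pos r hr0
      rw [Real.norm_eq_abs, abs_mul, abs_of_nonneg (by positivity : 0 ≤ 3 * u r ^ 2)]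
      have := (hb r hr0).2
      calc 3 * u r ^ 2 * |du r| ≤ 3 * u r ^ 2 * C := by gcongr
        _ ≤ 3 * C * (u r ^ 2 * r) := by nlinarith [mul_pos hC (pow_pos hp 2)]
  have h3 : Tendsto (fun r => u r ^ 3) atTop (𝓝 0) := by
    refine tendsto_zero_of_hasDerivAt_of_integrableOn_Ioi (a := 1) (f' := fun r => 3 * u r ^ 2 * du r)
      ?_ hi2 hi1
    intro x hx
    exact ((H.hd1 x (hs hx)).pow 3).congr_deriv (by norm_num)
  have h4 : Tendsto (fun r => (u r ^ 3) ^ ((1:ℝ)/3)) atTop (𝓝 (0 ^ ((1:ℝ)/3))) :=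
    h3.rpow_const (Or.inr (by norm_num))
  rw [Real.zero_rpow (by norm_num)] at h4
  refine h4.congr' ?_
  filter_upwards [eventually_gt_atTop 0] with r hr
  rw [← Real.rpow_natCast, ← Real.rpow_mul (H.pos r hr).le]
  norm_num

lemma decay (H : RadSol u du α) : ∃ R C : ℝ, 1 ≤ R ∧ 0 < C ∧ ∀ r, R ≤ r →
    u r ≤ C * exp (-(r/2)) ∧ |du r| ≤ C * exp (-(r/2)) ∧ du r ≤ 0 := by
  obtain ⟨R0, hR0⟩ := eventually_atTop.1 ((H.lim_top.eventually (gt_mem_nhds (show (0:ℝ) < 1/2 by norm_num))).and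
    (eventually_ge_atTop (1:ℝ)))
  have hR01 : 1 ≤ R0 := (hR0 R0 le_rfl).2
  have hpos : ∀ r, R0 ≤ r → 0 < r := fun r hr => by linarith
  have hhalf : ∀ r, R0 ≤ r → u r < 1/2 := fun r hr => (hR0 r hr).1
  have hdm : ∀ r, 0 < r → HasDerivAt (fun r => r * du r) (r * (u r - u r ^ 3)) r := by
    intro r hr
    refine ((hasDerivAt_id r).mul (H.hd2 r hr)).congr_deriv ?_
    have := hr.ne'
    simp only [id]; field_simp; ring
  have hmono : MonotoneOn (fun r => r * du r) (Ici R0) := by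
    apply monotoneOn_of_deriv_nonneg (convex_Ici R0)
    · intro x hx; exact (hdm x (hpos x hx)).continuousAt.continuousWithinAt
    · intro x hx; rw [interior_Ici] at hx
      exact (hdm x (hpos x hx.le)).differentiableAt.differentiableWithinAt
    · intro x hx; rw [interior_Ici] at hx
      have hx0 := hpos x hx.le
      rw [(hdm x hx0).deriv]
      have h1 := H.pos x hx0
      have h2 := hhalf x hx.le
      have : u x ^ 3 ≤ u x := by nlinarith [mul_pos h1 h1]
      exact mul_nonneg hx0.le (by linarith)
  have hneg : ∀ r, R0 ≤ r → du r < 0 := by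
    intro r1 hr1
    by_contra hcon
    push Not at hcon
    have hge : ∀ r, r1 ≤ r → 0 ≤ du r := by
      intro r hr
      have h1 := hmono (show r1 ∈ Ici R0 from hr1) (show r ∈ Ici R0 from hr1.trans hr) hr
      have h2 : 0 ≤ r * du r := le_trans (mul_nonneg (hpos r1 hr1).le hcon) h1
      exact nonneg_of_mul_nonneg_right h2 (hpos r (hr1.trans hr))
    have hm : MonotoneOn u (Ici r1) := by
      apply monotoneOn_of_deriv_nonneg (convex_Ici r1)
      · intro x hx; exact (H.hd1 x (hpos x (hr1.trans hx))).continuousAt.continuousWithinAt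
      · intro x hx; rw [interior_Ici] at hx
        exact (H.hd1 x (hpos x (hr1.trans hx.le))).differentiableAt.differentiableWithinAt
      · intro x hx; rw [interior_Ici] at hx
        rw [(H.hd1 x (hpos x (hr1.trans hx.le))).deriv]
        exact hge x hx.le
    have : u r1 ≤ 0 := by
      refine ge_of_tendsto H.lim_top ?_
      filter_upwards [eventually_ge_atTop r1] with x hx
      exact hm (Set.mem_Ici.2 le_rfl) hx hx
    linarith [H.pos r1 (hpos r1 hr1)]
  have hdd : ∀ r, R0 ≤ r → 3/4 * u r ≤ -du r / r + u r - u r ^ 3 := by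
    intro r hr
    have h0 := hpos r hr
    have h1 := H.pos r h0
    have h2 := hhalf r hr
    have h3 : 0 ≤ -du r / r := div_nonneg (by linarith [hneg r hr]) h0.le
    have : u r ^ 3 ≤ 1/4 * u r := by
      have : u r ^ 2 ≤ 1/4 := by nlinarith
      nlinarith
    linarith
  have hdE : ∀ r, 0 < r → HasDerivAt (fun r => du r ^ 2 - 3/4 * u r ^ 2)
      (2 * du r * (-du r / r + u r - u r ^ 3 - 3/4 * u r)) r := by
    intro r hr
    refine (((H.hd2 r hr).pow 2).sub (((H.hd1 r hr).pow 2).const_mul (3/4))).congr_deriv ?_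
    norm_num
    ring
  have hantiE : AntitoneOn (fun r => du r ^ 2 - 3/4 * u r ^ 2) (Ici R0) := by
    apply antitoneOn_of_deriv_nonpos (convex_Ici R0)
    · intro x hx; exact (hdE x (hpos x hx)).continuousAt.continuousWithinAt
    · intro x hx; rw [interior_Ici] at hx
      exact (hdE x (hpos x hx.le)).differentiableAt.differentiableWithinAt
    · intro x hx; rw [interior_Ici] at hx
      rw [(hdE x (hpos x hx.le)).deriv]
      have h1 := hneg x hx.le
      have h2 := hdd x hx.le
      exact mul_nonpos_of_nonpos_of_nonneg (by linarith) (by linarith)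
  have hge : ∀ r, R0 ≤ r → 0 ≤ du r ^ 2 - 3/4 * u r ^ 2 := by
    intro r hr
    have hl : Tendsto (fun x => - (3/4 * u x ^ 2)) atTop (𝓝 (-(3/4 * 0 ^ 2))) :=
      ((H.lim_top.pow 2).const_mul _).neg
    have : -(3/4 * (0:ℝ) ^ 2) ≤ du r ^ 2 - 3/4 * u r ^ 2 := by
      refine le_of_tendsto hl ?_
      filter_upwards [eventually_ge_atTop r] with x hx
      have := hantiE (show r ∈ Ici R0 from hr) (show x ∈ Ici R0 from hr.trans hx) hx
      simp only at this
      nlinarith [sq_nonneg (du x)]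
    simpa using this
  have hdu : ∀ r, R0 ≤ r → du r + u r / 2 ≤ 0 := by
    intro r hr
    have h1 := hge r hr
    have h2 := hneg r hr
    have h3 := H.pos r (hpos r hr)
    nlinarith
  have hdexp : ∀ r, 0 < r → HasDerivAt (fun r => u r * exp (r/2)) ((du r + u r / 2) * exp (r/2)) r := by
    intro r hr
    have he : HasDerivAt (fun r : ℝ => exp (r/2)) (exp (r/2) * (1/2)) r :=
      ((hasDerivAt_id r).div_const 2).exp
    refine ((H.hd1 r hr).mul he).congr_deriv ?_
    ring
  have hantiU : AntitoneOn (fun r => u r * exp (r/2)) (Ici R0) := by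
    apply antitoneOn_of_deriv_nonpos (convex_Ici R0)
    · intro x hx; exact (hdexp x (hpos x hx)).continuousAt.continuousWithinAt
    · intro x hx; rw [interior_Ici] at hx
      exact (hdexp x (hpos x hx.le)).differentiableAt.differentiableWithinAt
    · intro x hx; rw [interior_Ici] at hx
      rw [(hdexp x (hpos x hx.le)).deriv]
      exact mul_nonpos_of_nonpos_of_nonneg (hdu x hx.le) (exp_pos _).le
  set K := u R0 * exp (R0/2) with hK
  have hKpos : 0 < K := mul_pos (H.pos _ (hpos _ le_rfl)) (exp_pos _)
  have hu : ∀ r, R0 ≤ r → u r ≤ K * exp (-(r/2)) := by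
    intro r hr
    have := hantiU (Set.mem_Ici.2 le_rfl) (show r ∈ Ici R0 from hr) hr
    simp only at this
    rw [exp_neg, ← div_eq_mul_inv, le_div_iff₀ (exp_pos _)]
    exact this
  have hmonod : MonotoneOn du (Ici R0) := by
    apply monotoneOn_of_deriv_nonneg (convex_Ici R0)
    · intro x hx; exact (H.hd2 x (hpos x hx)).continuousAt.continuousWithinAt
    · intro x hx; rw [interior_Ici] at hx
      exact (H.hd2 x (hpos x hx.le)).differentiableAt.differentiableWithinAt
    · intro x hx; rw [interior_Ici] at hx
      rw [(H.hd2 x (hpos x hx.le)).deriv]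
      have := hdd x hx.le
      have := H.pos x (hpos x hx.le)
      linarith
  refine ⟨R0 + 1, K * exp (1/2), by linarith, by positivity, fun r hr => ⟨?_, ?_, ?_⟩⟩
  · refine (hu r (by linarith)).trans ?_
    have : (1:ℝ) ≤ exp (1/2) := Real.one_le_exp (by norm_num)
    have h2 := exp_pos (-(r/2))
    calc K * exp (-(r/2)) = K * 1 * exp (-(r/2)) := by ring
      _ ≤ _ := by gcongr
  · obtain ⟨c, hc, hc2⟩ := exists_hasDerivAt_eq_slope u du (show r - 1 < r by linarith)
      (fun x hx => (H.hd1 x (hpos x (by linarith [hx.1]))).continuousAt.continuousWithinAt)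
      (fun x hx => H.hd1 x (hpos x (by linarith [hx.1])))
    have h1 : du c ≤ du r := hmonod (show R0 ≤ c by linarith [hc.1]) (show R0 ≤ r by linarith) hc.2.le
    have h2 : r - (r - 1) = 1 := by ring
    rw [h2, div_one] at hc2
    have h3 := hneg r (by linarith)
    rw [abs_of_neg h3]
    have h4 := hu (r-1) (by linarith)
    have h5 := H.pos r (hpos r (by linarith))
    have h6 : K * exp (1/2) * exp (-(r/2)) = K * exp (-((r-1)/2)) := by
      rw [mul_assoc, ← exp_add]; congr 2; ring
    rw [h6]; linarith
  · exact (hneg r (by linarith)).le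

end RadSol


section OdeUniq
open Set Topology

lemma ode_eqOn {u du v dv : ℝ → ℝ}
    (hu1 : ∀ r, 0 < r → HasDerivAt u (du r) r)
    (hu2 : ∀ r, 0 < r → HasDerivAt du (-du r / r + u r - u r ^ 3) r)
    (hv1 : ∀ r, 0 < r → HasDerivAt v (dv r) r)
    (hv2 : ∀ r, 0 < r → HasDerivAt dv (-dv r / r + v r - v r ^ 3) r)
    {t : ℝ} (ht : 0 < t) (h1 : u t = v t) (h2 : du t = dv t) : ∀ r, 0 < r → u r = v r := by
  intro r hr
  set a := min r t / 2 with ha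
  set b := max r t + 1 with hb
  have hmin : 0 < min r t := lt_min hr ht
  have ha0 : 0 < a := by positivity
  have hat : a < t := by have := min_le_right r t; linarith
  have har : a < r := by have := min_le_left r t; linarith
  have htb : t < b := by have := le_max_right r t; linarith
  have hrb : r < b := by have := le_max_left r t; linarith
  have hcu : ContinuousOn u (Icc a b) := fun x hx =>
    (hu1 x (by linarith [hx.1])).continuousAt.continuousWithinAt
  have hcv : ContinuousOn v (Icc a b) := fun x hx =>
    (hv1 x (by linarith [hx.1])).continuousAt.continuousWithinAt
  have hcdu : ContinuousOn du (Icc a b) := fun x hx =>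
    (hu2 x (by linarith [hx.1])).continuousAt.continuousWithinAt
  have hcdv : ContinuousOn dv (Icc a b) := fun x hx =>
    (hv2 x (by linarith [hx.1])).continuousAt.continuousWithinAt
  obtain ⟨M1, hM1⟩ := isCompact_Icc.exists_bound_of_continuousOn hcu
  obtain ⟨M2, hM2⟩ := isCompact_Icc.exists_bound_of_continuousOn hcv
  set M := max M1 M2 with hM
  have hM0 : 0 ≤ M := le_trans (norm_nonneg _) ((hM1 t ⟨hat.le, htb.le⟩).trans (le_max_left _ _))
  set K : NNReal := Real.toNNReal (1/a + 1 + 3 * M^2) with hK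
  have hKv : (K:ℝ) = 1/a + 1 + 3 * M^2 := Real.coe_toNNReal _ (by positivity)
  have key := ODE_solution_unique_of_mem_Icc (v := fun (t:ℝ) (y : ℝ × ℝ) => (y.2, -y.2/t + y.1 - y.1^3))
    (K := K) (s := fun _ => {y : ℝ × ℝ | |y.1| ≤ M}) (a := a) (b := b) (t₀ := t)
    (f := fun t => (u t, du t)) (g := fun t => (v t, dv t)) ?_ ⟨hat, htb⟩
    (hcu.prodMk hcdu) ?_ ?_ (hcv.prodMk hcdv) ?_ ?_ ?_
  · exact congrArg Prod.fst (key ⟨har.le, hrb.le⟩)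
  · intro s hs
    have hs0 : 0 < s := by linarith [hs.1]
    apply LipschitzOnWith.of_dist_le_mul
    intro y hy z hz
    simp only [mem_setOf_eq] at hy hz
    rw [hKv, Prod.dist_eq, Prod.dist_eq]
    simp only [Real.dist_eq]
    set d := max |y.1 - z.1| |y.2 - z.2| with hd
    have hd1 : |y.1 - z.1| ≤ d := le_max_left _ _
    have hd2 : |y.2 - z.2| ≤ d := le_max_right _ _
    have hd0 : 0 ≤ d := (abs_nonneg _).trans hd1
    have hia : 0 ≤ 1/a := by positivity
    apply max_le
    · nlinarith [mul_nonneg hia hd0, mul_nonneg (sq_nonneg M) hd0]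
    · have e : -y.2/s + y.1 - y.1^3 - (-z.2/s + z.1 - z.1^3) =
        -((y.2 - z.2)/s) + (y.1 - z.1) - (y.1 - z.1) * (y.1^2 + y.1*z.1 + z.1^2) := by
        field_simp; ring
      rw [e]
      have b1 : |(y.2 - z.2)/s| ≤ 1/a * d := by
        rw [abs_div, abs_of_pos hs0, div_eq_mul_one_div, mul_comm]
        have : 1/s ≤ 1/a := one_div_le_one_div_of_le ha0 hs.1.le
        exact mul_le_mul this hd2 (abs_nonneg _) hia
      have b2 : |y.1^2 + y.1*z.1 + z.1^2| ≤ 3*M^2 := by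
        have := abs_le.1 hy; have := abs_le.1 hz
        rw [abs_le]; constructor <;> nlinarith
      have b3 : |(y.1 - z.1) * (y.1^2 + y.1*z.1 + z.1^2)| ≤ d * (3*M^2) := by
        rw [abs_mul]; exact mul_le_mul hd1 b2 (abs_nonneg _) hd0
      calc _ ≤ |(y.2 - z.2)/s| + |y.1 - z.1| + |(y.1 - z.1) * (y.1^2 + y.1*z.1 + z.1^2)| := by
            refine (abs_sub _ _).trans ?_
            gcongr
            refine (abs_add_le _ _).trans ?_
            rw [abs_neg]
        _ ≤ _ := by linarith
  · intro s hs
    exact (hu1 s (by linarith [hs.1])).prodMk (hu2 s (by linarith [hs.1]))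
  · intro s hs
    exact (hM1 s ⟨hs.1.le, hs.2.le⟩).trans (le_max_left _ _)
  · intro s hs
    exact (hv1 s (by linarith [hs.1])).prodMk (hv2 s (by linarith [hs.1]))
  · intro s hs
    exact (hM2 s ⟨hs.1.le, hs.2.le⟩).trans (le_max_right _ _)
  · simp [h1, h2]

lemma upper_of_deriv {F F' : ℝ → ℝ} {δ c : ℝ} (hF : ∀ r ∈ Ioo 0 δ, HasDerivAt F (F' r) r)
    (h0 : Tendsto F (𝓝[>] 0) (𝓝 0)) (hb : ∀ r ∈ Ioo 0 δ, F' r ≤ c * r) :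
    ∀ r ∈ Ioo 0 δ, F r ≤ c * r ^ 2 / 2 := by
  have hd : ∀ r ∈ Ioo 0 δ, HasDerivAt (fun r => F r - c * r^2/2) (F' r - c * r) r := by
    intro r hr
    refine ((hF r hr).sub ((((hasDerivAt_id r).pow 2).const_mul c).div_const 2)).congr_deriv ?_
    simp only [id]; norm_num; ring
  have hanti : AntitoneOn (fun r => F r - c * r^2/2) (Ioo 0 δ) := by
    apply antitoneOn_of_deriv_nonpos (convex_Ioo 0 δ)
    · intro x hx; exact (hd x hx).continuousAt.continuousWithinAt
    · intro x hx; rw [interior_Ioo] at hx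
      exact (hd x hx).differentiableAt.differentiableWithinAt
    · intro x hx; rw [interior_Ioo] at hx
      rw [(hd x hx).deriv]; linarith [hb x hx]
  have hlim : Tendsto (fun r => F r - c * r^2/2) (𝓝[>] 0) (𝓝 (0 - c * 0^2/2)) := by
    refine h0.sub ?_
    have : Continuous (fun r : ℝ => c * r^2/2) := by fun_prop
    exact (this.tendsto 0).mono_left nhdsWithin_le_nhds
  intro r hr
  have : F r - c * r^2/2 ≤ 0 - c * 0^2/2 := by
    refine ge_of_tendsto hlim ?_
    filter_upwards [Ioo_mem_nhdsGT hr.1] with x hx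
    exact hanti ⟨hx.1, hx.2.trans hr.2⟩ hr hx.2.le
  simp at this
  linarith

lemma abs_of_deriv {F F' : ℝ → ℝ} {δ c : ℝ} (hF : ∀ r ∈ Ioo 0 δ, HasDerivAt F (F' r) r)
    (h0 : Tendsto F (𝓝[>] 0) (𝓝 0)) (hb : ∀ r ∈ Ioo 0 δ, |F' r| ≤ c * r) :
    ∀ r ∈ Ioo 0 δ, |F r| ≤ c * r ^ 2 / 2 := by
  intro r hr
  rw [abs_le']
  refine ⟨upper_of_deriv hF h0 (fun r hr => (le_abs_self _).trans (hb r hr)) r hr, ?_⟩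
  have := upper_of_deriv (F := fun r => - F r) (F' := fun r => - F' r) (δ := δ) (c := c)
    (fun r hr => (hF r hr).neg) (by simpa using h0.neg)
    (fun r hr => (neg_le_abs _).trans (hb r hr)) r hr
  exact this

lemma local_unique {u du v dv : ℝ → ℝ} {α : ℝ}
    (hu1 : ∀ r, 0 < r → HasDerivAt u (du r) r)
    (hu2 : ∀ r, 0 < r → HasDerivAt du (-du r / r + u r - u r ^ 3) r)
    (hv1 : ∀ r, 0 < r → HasDerivAt v (dv r) r)
    (hv2 : ∀ r, 0 < r → HasDerivAt dv (-dv r / r + v r - v r ^ 3) r)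
    (lu : Tendsto u (𝓝[>] 0) (𝓝 α)) (ldu : Tendsto du (𝓝[>] 0) (𝓝 0))
    (lv : Tendsto v (𝓝[>] 0) (𝓝 α)) (ldv : Tendsto dv (𝓝[>] 0) (𝓝 0)) :
    ∀ r, 0 < r → u r = v r := by
  set M := |α| + 1 with hM
  have hM1 : 1 ≤ M := by have := abs_nonneg α; linarith
  have eu : ∀ᶠ r in 𝓝[>] (0:ℝ), |u r| < M := lu.abs.eventually (gt_mem_nhds (by linarith))
  have ev : ∀ᶠ r in 𝓝[>] (0:ℝ), |v r| < M := lv.abs.eventually (gt_mem_nhds (by linarith))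
  obtain ⟨δ0, hδ0, hδ⟩ := (mem_nhdsGT_iff_exists_Ioo_subset).1 (eu.and ev)
  set L := 1 + 3 * M^2 with hL
  have hL1 : 1 ≤ L := by nlinarith
  set δ := min δ0 (1/L) with hδd
  have hδ0' : 0 < δ := lt_min hδ0 (by positivity)
  have hδL : L * δ ≤ 1 := by
    have : δ ≤ 1/L := min_le_right _ _
    calc L * δ ≤ L * (1/L) := by gcongr
      _ = 1 := by field_simp
  have hδ1 : δ ≤ 1 := by nlinarith
  have hbd : ∀ r ∈ Ioo 0 δ, |u r| ≤ M ∧ |v r| ≤ M := fun r hr => by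
    have := hδ (⟨hr.1, hr.2.trans_le (min_le_left _ _)⟩ : r ∈ Ioo 0 δ0)
    exact ⟨this.1.le, this.2.le⟩
  have lw : Tendsto (fun r => u r - v r) (𝓝[>] 0) (𝓝 0) := by simpa using lu.sub lv
  have ldw : Tendsto (fun r => r * (du r - dv r)) (𝓝[>] 0) (𝓝 0) := by
    have h1 : Tendsto (fun r : ℝ => r) (𝓝[>] 0) (𝓝 0) := tendsto_id.mono_left nhdsWithin_le_nhds
    simpa using h1.mul (ldu.sub ldv)
  have step : ∀ B, 0 ≤ B → (∀ r ∈ Ioo 0 δ, |u r - v r| ≤ B) → ∀ r ∈ Ioo 0 δ, |u r - v r| ≤ B/2 := by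
    intro B hB hBr
    have s1 := abs_of_deriv (F := fun r => r * (du r - dv r))
      (F' := fun r => r * ((u r - v r) * (1 - (u r^2 + u r * v r + v r^2)))) (δ := δ) (c := L * B)
      (by
        intro r hr
        refine ((hasDerivAt_id r).mul ((hu2 r hr.1).sub (hv2 r hr.1))).congr_deriv ?_
        have := hr.1.ne'
        simp only [id, Pi.sub_apply]; field_simp; ring) ldw
      (by
        intro r hr
        have h1 := hbd r hr
        have h2 := hBr r hr
        have b2 : |1 - (u r^2 + u r * v r + v r^2)| ≤ L := by
          have := abs_le.1 h1.1; have := abs_le.1 h1.2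
          rw [abs_le]; constructor <;> nlinarith
        rw [abs_mul, abs_of_pos hr.1, abs_mul]
        have := mul_le_mul h2 b2 (abs_nonneg _) hB
        calc r * (|u r - v r| * _) ≤ r * (B * L) := mul_le_mul_of_nonneg_left this hr.1.le
          _ = _ := by ring)
    have s2 := abs_of_deriv (F := fun r => u r - v r)
      (F' := fun r => du r - dv r) (δ := δ) (c := L * B / 2)
      (fun r hr => (hu1 r hr.1).sub (hv1 r hr.1)) lw
      (by
        intro r hr
        have := s1 r hr
        rw [abs_mul, abs_of_pos hr.1] at this
        have h3 : r * |du r - dv r| ≤ r * (L * B / 2 * r) := by linarith [this, show L*B*r^2/2 = r * (L*B/2*r) by ring]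
        exact le_of_mul_le_mul_left h3 hr.1)
    intro r hr
    refine (s2 r hr).trans ?_
    have h5 : r^2 ≤ δ := by nlinarith [hr.1, hr.2]
    have : L * B / 2 * r^2 ≤ L * B / 2 * δ := by gcongr
    nlinarith
  have iter : ∀ n : ℕ, ∀ r ∈ Ioo 0 δ, |u r - v r| ≤ 2 * M / 2 ^ n := by
    intro n
    induction n with
    | zero =>
      intro r hr
      have := hbd r hr
      refine (abs_sub _ _).trans ?_
      simp; linarith
    | succ k ih =>
      intro r hr
      have := step _ (by positivity) ih r hr
      rw [pow_succ]
      calc _ ≤ _ := this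
        _ = _ := by field_simp
  have eq0 : ∀ r ∈ Ioo 0 δ, u r = v r := by
    intro r hr
    have hl : Tendsto (fun n : ℕ => 2 * M * (1/2 : ℝ) ^ n) atTop (𝓝 (2 * M * 0)) :=
      (tendsto_pow_atTop_nhds_zero_of_lt_one (by norm_num) (by norm_num)).const_mul _
    have : |u r - v r| ≤ 2 * M * 0 := ge_of_tendsto' hl (fun n => by
      have := iter n r hr
      rw [one_div_pow, mul_one_div]; exact this)
    rw [mul_zero] at this
    have := abs_nonpos_iff.1 this
    linarith
  have hmid : δ/2 ∈ Ioo 0 δ := ⟨by positivity, by linarith⟩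
  refine ode_eqOn hu1 hu2 hv1 hv2 hmid.1 (eq0 _ hmid) ?_
  have hev : u =ᶠ[𝓝 (δ/2)] v := by
    filter_upwards [isOpen_Ioo.mem_nhds hmid] with r hr using eq0 r hr
  have e1 := (hu1 _ hmid.1).deriv
  have e2 := (hv1 _ hmid.1).deriv
  rw [← e1, ← e2, hev.deriv_eq]

end OdeUniq


section OdeUniq2
open Set Topology

lemma strict_of_deriv {F F' : ℝ → ℝ} {R L : ℝ} (hF : ∀ r ∈ Ioc 0 R, HasDerivAt F (F' r) r)
    (hneg : ∀ r ∈ Ioo 0 R, F' r < 0) (hL : Tendsto F (𝓝[>] 0) (𝓝 L)) :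
    StrictAntiOn F (Ioc 0 R) ∧ ∀ r ∈ Ioc 0 R, F r < L := by
  have hanti : StrictAntiOn F (Ioc 0 R) := by
    apply strictAntiOn_of_deriv_neg (convex_Ioc 0 R)
    · intro x hx
      exact (hF x hx).continuousAt.continuousWithinAt
    · intro x hx
      rw [interior_Ioc] at hx
      rw [(hF x ⟨hx.1, hx.2.le⟩).deriv]
      exact hneg x hx
  refine ⟨hanti, ?_⟩
  intro r hr
  have hr0 : 0 < r := hr.1
  have h2 : F (r/2) ≤ L := by
    apply ge_of_tendsto hL
    have : Ioo 0 (r/2) ∈ 𝓝[>] (0:ℝ) := Ioo_mem_nhdsGT (by linarith)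
    filter_upwards [this] with s hs
    exact (hanti ⟨hs.1, by linarith [hs.2, hr.2]⟩ ⟨by linarith, by linarith [hr.2]⟩ hs.2).le
  exact lt_of_lt_of_le (hanti ⟨by linarith, by linarith [hr.2]⟩ hr (by linarith)) h2

namespace RadSol
variable {u du v dv : ℝ → ℝ} {α β : ℝ}

lemma alpha_pos (H : RadSol u du α) : 0 < α := by
  have h0 : 0 ≤ α := by
    apply ge_of_tendsto H.lim0
    filter_upwards [self_mem_nhdsWithin] with r hr using (H.pos r hr).le
  rcases h0.lt_or_eq with h | h
  · exact h
  · exfalso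
    have := local_unique (u := u) (du := du) (v := fun _ => 0) (dv := fun _ => 0) (α := α) H.hd1 H.hd2
      (fun r _ => hasDerivAt_const _ _) (fun r _ => by simpa using hasDerivAt_const r (0:ℝ))
      H.lim0 H.dlim0 (by rw [← h]; exact tendsto_const_nhds) tendsto_const_nhds 1 one_pos
    have h1 := H.pos 1 one_pos
    rw [this] at h1
    exact lt_irrefl _ h1

/-- Pohozaev-type functional. -/
def J (u du : ℝ → ℝ) (r : ℝ) : ℝ :=
  r ^ (1/3:ℝ) * (r * du r ^ 2 / 2 + u r * du r / 3 + u r ^ 2 / (9 * r) - r * u r ^ 2 / 2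
    + r * u r ^ 4 / 4)

def Jc (r : ℝ) : ℝ := r ^ (1/3:ℝ) * (1/3 + 2 / (27 * r ^ 2))

lemma J_deriv (H : RadSol u du α) {r : ℝ} (hr : 0 < r) :
    HasDerivAt (J u du) (- (Jc r * u r ^ 2)) r := by
  have h1 := H.hd1 r hr
  have h2 := H.hd2 r hr
  have ht : HasDerivAt (fun r : ℝ => r ^ (1/3:ℝ)) (r ^ (1/3:ℝ) / (3 * r)) r := by
    refine (Real.hasDerivAt_rpow_const (p := 1/3) (Or.inl hr.ne')).congr_deriv ?_
    rw [Real.rpow_sub_one hr.ne']; field_simp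
  have hid := hasDerivAt_id r
  have h9 : HasDerivAt (fun r : ℝ => 9 * r) 9 r := by simpa using (hasDerivAt_id r).const_mul 9
  have := ht.mul ((((((hid.mul (h2.pow 2)).div_const 2).add ((h1.mul h2).div_const 3)).add
    ((h1.pow 2).div h9 (by positivity))).sub ((hid.mul (h1.pow 2)).div_const 2)).add
    ((hid.mul (h1.pow 4)).div_const 4))
  refine this.congr_deriv ?_
  simp only [Jc, id, Pi.add_apply, Pi.sub_apply, Pi.mul_apply, Pi.div_apply, Pi.pow_apply]
  field_simp
  ring

lemma J_lim (H : RadSol u du α) : Tendsto (J u du) atTop (𝓝 0) := by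
  obtain ⟨R, C, hR, hC, hd⟩ := H.decay
  have hlim : Tendsto (fun r : ℝ => (3 * C ^ 2 + C ^ 4) * (r ^ 2 * exp (-r))) atTop (𝓝 0) := by
    simpa using (Real.tendsto_pow_mul_exp_neg_atTop_nhds_zero 2).const_mul (3 * C ^ 2 + C ^ 4)
  apply squeeze_zero_norm' _ hlim
  filter_upwards [eventually_ge_atTop R] with r hr
  obtain ⟨h1, h2, -⟩ := hd r hr
  have hr1 : 1 ≤ r := hR.trans hr
  have hr0 : 0 < r := by linarith
  have hu := H.pos r hr0
  have ht0 : 0 < r ^ (1/3:ℝ) := Real.rpow_pos_of_pos hr0 _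
  have ht : r ^ (1/3:ℝ) ≤ r := by
    nth_rw 2 [← Real.rpow_one r]
    exact Real.rpow_le_rpow_of_exponent_le hr1 (by norm_num)
  set e := exp (-(r/2)) with he
  have hee : exp (-r) = e ^ 2 := by rw [he, ← Real.exp_nat_mul]; congr 1; push_cast; ring
  have he1 : e ≤ 1 := by rw [he]; exact Real.exp_le_one_iff.2 (by linarith)
  have he0 : 0 < e := Real.exp_pos _
  rw [hee, Real.norm_eq_abs, J, abs_mul, abs_of_pos ht0]
  have hA : du r ^ 2 ≤ (C * e) ^ 2 := sq_le_sq' (by linarith [neg_abs_le (du r)]) ((le_abs_self _).trans h2)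
  have hB : u r ^ 2 ≤ (C * e) ^ 2 := by gcongr
  have hD : u r ^ 4 ≤ (C * e) ^ 4 := by gcongr
  have he4 : (C * e) ^ 4 ≤ C ^ 4 * e ^ 2 := by
    have : e ^ 4 ≤ e ^ 2 := pow_le_pow_of_le_one he0.le he1 (by norm_num)
    rw [mul_pow]; gcongr
  have hCe : (C * e)^2 = C^2 * e^2 := by ring
  rw [hCe] at hA hB
  have hE : |u r * du r| ≤ C ^ 2 * e ^ 2 := by
    rw [abs_le]; constructor <;> nlinarith [sq_nonneg (u r + du r), sq_nonneg (u r - du r)]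
  have hF : |u r ^ 2 / (9 * r)| ≤ C ^ 2 * e ^ 2 := by
    rw [abs_of_nonneg (by positivity), div_le_iff₀ (by positivity)]
    nlinarith [mul_nonneg (mul_nonneg (sq_nonneg C) (sq_nonneg e)) (by linarith : (0:ℝ) ≤ 9 * r - 1)]
  have hF0 : 0 ≤ u r ^ 2 / (9 * r) := by positivity
  rw [abs_of_nonneg hF0] at hF
  have hE' := abs_le.1 hE
  set P := C^2*e^2
  have hP : 0 ≤ P := by positivity
  have key : |r * du r ^ 2 / 2 + u r * du r / 3 + u r ^ 2 / (9 * r) - r * u r ^ 2 / 2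
    + r * u r ^ 4 / 4| ≤ r * (3 * P + C^4 * e^2) := by
    have a1 : r * du r ^ 2 ≤ r * P := by gcongr
    have a2 : r * u r ^ 2 ≤ r * P := by gcongr
    have a3 : r * u r ^ 4 ≤ r * (C^4 * e^2) := by gcongr; exact hD.trans he4
    have a4 : P ≤ r * P := by nlinarith
    have a5 : 0 ≤ r * du r ^ 2 := by positivity
    have a6 : 0 ≤ r * u r ^ 2 := by positivity
    have a7 : 0 ≤ r * u r ^ 4 := by positivity
    rw [abs_le]
    constructor <;> nlinarith
  calc _ ≤ r * (r * (3 * P + C^4 * e^2)) := by gcongr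
    _ = _ := by ring

lemma Jc_pos {r : ℝ} (hr : 0 < r) : 0 < Jc r := by
  have := Real.rpow_pos_of_pos hr (1/3)
  unfold Jc; positivity

lemma J_pos (H : RadSol u du α) {r : ℝ} (hr : 0 < r) : 0 < J u du r := by
  have hanti : StrictAntiOn (J u du) (Ioi 0) := by
    apply strictAntiOn_of_deriv_neg (convex_Ioi 0)
    · intro x hx
      exact (H.J_deriv hx).continuousAt.continuousWithinAt
    · intro x hx
      rw [interior_Ioi] at hx
      rw [(H.J_deriv hx).deriv]
      have := H.pos x hx
      have := Jc_pos hx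
      have : 0 < Jc x * u x ^ 2 := by positivity
      linarith
  have h1 : 0 ≤ J u du (r+1) := by
    apply le_of_tendsto H.J_lim
    filter_upwards [eventually_gt_atTop (r+1)] with s hs
    exact (hanti (by simp; linarith) (by simp; linarith) hs).le
  exact lt_of_le_of_lt h1 (hanti hr (by simp; linarith) (by linarith))

lemma no_lt (H : RadSol u du α) (K : RadSol v dv β) (hlt : α < β) : False := by
  have hα := H.alpha_pos
  have hβ := K.alpha_pos
  set G : ℝ → ℝ := fun r => r * (dv r * u r - v r * du r) with hG
  have hGd : ∀ r, 0 < r → HasDerivAt G (r * u r * v r * (u r ^ 2 - v r ^ 2)) r := by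
    intro r hr
    have := (hasDerivAt_id r).mul (((K.hd2 r hr).mul (H.hd1 r hr)).sub ((K.hd1 r hr).mul (H.hd2 r hr)))
    refine this.congr_deriv ?_
    simp only [id, Pi.sub_apply, Pi.mul_apply]
    field_simp
    ring
  have hid0 : Tendsto (fun r : ℝ => r) (𝓝[>] 0) (𝓝 0) := tendsto_nhdsWithin_of_tendsto_nhds tendsto_id
  have hG0 : Tendsto G (𝓝[>] 0) (𝓝 0) := by
    have := hid0.mul ((K.dlim0.mul H.lim0).sub (K.lim0.mul H.dlim0))
    simpa using this
  set ρ : ℝ → ℝ := fun r => v r / u r with hρ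
  have hρd : ∀ r, 0 < r → HasDerivAt ρ (G r / (r * u r ^ 2)) r := by
    intro r hr
    have hu := (H.pos r hr).ne'
    refine ((K.hd1 r hr).div (H.hd1 r hr) hu).congr_deriv ?_
    simp only [hG]; field_simp
  have hρ0 : Tendsto ρ (𝓝[>] 0) (𝓝 (β/α)) := K.lim0.div H.lim0 hα.ne'
  have hρpos : ∀ r, 0 < r → 0 < ρ r := fun r hr => div_pos (K.pos r hr) (H.pos r hr)
  have h1 : 1 < β / α := by rw [lt_div_iff₀ hα]; linarith
  set X : ℝ → ℝ := fun r => ρ r ^ 2 * J u du r - J v dv r with hX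
  have hXd : ∀ r, 0 < r → HasDerivAt X (2 * ρ r * (G r / (r * u r ^ 2)) * J u du r) r := by
    intro r hr
    have hu := (H.pos r hr).ne'
    refine ((((hρd r hr).pow 2).mul (H.J_deriv hr)).sub (K.J_deriv hr)).congr_deriv ?_
    have hv : v r = ρ r * u r := by simp only [hρ]; field_simp
    rw [hv]
    simp only [Pi.pow_apply]
    push_cast
    ring
  have hXeq : ∀ r, 0 < r → X r = r ^ (1/3:ℝ) * (r * (ρ r ^ 2 * du r ^ 2 - dv r ^ 2) / 2 +
      (ρ r ^ 2 * (u r * du r) - v r * dv r) / 3 + r * (ρ r ^ 2 * u r ^ 4 - v r ^ 4) / 4) := by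
    intro r hr
    have hu := (H.pos r hr).ne'
    simp only [hX, hρ, J]
    field_simp
    ring
  have hX0 : Tendsto X (𝓝[>] 0) (𝓝 0) := by
    have ht : Tendsto (fun r : ℝ => r ^ (1/3:ℝ)) (𝓝[>] 0) (𝓝 0) := by
      have := (Real.continuous_rpow_const (q := (1/3:ℝ)) (by norm_num)).tendsto 0
      rw [Real.zero_rpow (by norm_num)] at this
      exact tendsto_nhdsWithin_of_tendsto_nhds this
    have := ht.mul (((((hid0.mul (((hρ0.pow 2).mul (H.dlim0.pow 2)).sub (K.dlim0.pow 2))).div_const 2).add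
      ((((hρ0.pow 2).mul (H.lim0.mul H.dlim0)).sub (K.lim0.mul K.dlim0)).div_const 3)).add
      ((hid0.mul (((hρ0.pow 2).mul (H.lim0.pow 4)).sub (K.lim0.pow 4))).div_const 4)))
    rw [zero_mul] at this
    refine this.congr' ?_
    filter_upwards [self_mem_nhdsWithin] with r hr
    rw [hXeq r hr]
  have key : ∀ R, 0 < R → (∀ r ∈ Ioo 0 R, G r < 0) →
      StrictAntiOn ρ (Ioc 0 R) ∧ (∀ r ∈ Ioc 0 R, ρ r < β/α) ∧ StrictAntiOn X (Ioc 0 R) ∧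
        ∀ r ∈ Ioc 0 R, X r < 0 := by
    intro R hR hneg
    have A := strict_of_deriv (F := ρ) (R := R) (fun r hr => hρd r hr.1) (fun r hr => by
      have hu := H.pos r hr.1
      have hr0 := hr.1
      exact div_neg_of_neg_of_pos (hneg r hr) (by positivity)) hρ0
    have B := strict_of_deriv (F := X) (R := R) (fun r hr => hXd r hr.1) (fun r hr => by
      have hu := H.pos r hr.1
      have hr0 := hr.1
      have hJ := H.J_pos hr0
      have := hρpos r hr0
      have := div_neg_of_neg_of_pos (hneg r hr) (by positivity : 0 < r * u r ^ 2)
      have : 2 * ρ r * (G r / (r * u r ^ 2)) < 0 := mul_neg_of_pos_of_neg (by positivity) this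
      exact mul_neg_of_neg_of_pos this hJ) hX0
    exact ⟨A.1, A.2, B.1, B.2⟩
  have key2 : ∀ R, 0 < R → (∀ r ∈ Ioo 0 R, 1 < ρ r) → ∀ r ∈ Ioc 0 R, G r < 0 := by
    intro R hR hr1
    refine (strict_of_deriv (F := G) (R := R) (fun r hr => hGd r hr.1) (fun r hr => ?_) hG0).2
    have hu := H.pos r hr.1
    have hv := K.pos r hr.1
    have hr0 := hr.1
    have h := hr1 r hr
    simp only [hρ] at h
    rw [lt_div_iff₀ hu] at h
    apply mul_neg_of_pos_of_neg (by positivity)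
    nlinarith
  obtain ⟨δ, hδ, hδ1⟩ : ∃ δ > 0, ∀ r ∈ Ioo 0 δ, 1 < ρ r := by
    have := hρ0.eventually (lt_mem_nhds h1)
    obtain ⟨δ, hδ, h⟩ := (mem_nhdsGT_iff_exists_Ioo_subset).1 this
    exact ⟨δ, hδ, fun r hr => h hr⟩
  have hGc : ContinuousOn G (Ioi 0) := fun r hr => (hGd r hr).continuousAt.continuousWithinAt
  have hGneg : ∀ r, 0 < r → G r < 0 := by
    by_contra hcon
    push Not at hcon
    obtain ⟨b, hb, hGb⟩ := hcon
    have hδneg := key2 δ hδ hδ1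
    have hbδ : δ < b := by
      by_contra hle
      push Not at hle
      exact absurd (hδneg b ⟨hb, hle⟩) (not_lt.2 hGb)
    set S := {r | r ∈ Icc δ b ∧ 0 ≤ G r} with hS
    have hSc : IsClosed S := by
      have : S = Icc δ b ∩ G ⁻¹' (Ici 0) := rfl
      rw [this]
      exact (hGc.mono (fun r hr => lt_of_lt_of_le hδ hr.1)).preimage_isClosed_of_isClosed isClosed_Icc isClosed_Ici
    have hSb : BddBelow S := ⟨δ, fun r hr => hr.1.1⟩
    have hSn : S.Nonempty := ⟨b, ⟨hbδ.le, le_rfl⟩, hGb⟩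
    have hm := hSc.csInf_mem hSn hSb
    set r1 := sInf S with hr1
    have hr10 : 0 < r1 := lt_of_lt_of_le hδ hm.1.1
    have hlt1 : ∀ r ∈ Ioo 0 r1, G r < 0 := by
      intro r hr
      by_cases hrd : r ≤ δ
      · exact hδneg r ⟨hr.1, hrd⟩
      · by_contra hh
        push Not at hh hrd
        have : r ∈ S := ⟨⟨hrd.le, by linarith [hr.2, hm.1.2]⟩, hh⟩
        exact absurd (csInf_le hSb this) (not_le.2 hr.2)
    have hG1 : G r1 = 0 := by
      apply le_antisymm _ hm.2
      have hc : Tendsto G (𝓝[<] r1) (𝓝 (G r1)) :=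
        tendsto_nhdsWithin_of_tendsto_nhds (hGd r1 hr10).continuousAt
      apply le_of_tendsto hc
      filter_upwards [Ioo_mem_nhdsLT hr10] with r hr using (hlt1 r hr).le
    obtain ⟨kρ, -, -, kX⟩ := key r1 hr10 hlt1
    have hX1 := kX r1 ⟨hr10, le_rfl⟩
    have hu := H.pos r1 hr10
    have hv := K.pos r1 hr10
    have hW : dv r1 * u r1 - v r1 * du r1 = 0 := by
      simp only [hG] at hG1
      exact (mul_eq_zero.1 hG1).resolve_left hr10.ne'
    have hdv : dv r1 = ρ r1 * du r1 := by
      simp only [hρ]; field_simp; linarith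
    have hve : v r1 = ρ r1 * u r1 := by
      simp only [hρ]; field_simp
    rw [hXeq r1 hr10, hdv, hve] at hX1
    have ht := Real.rpow_pos_of_pos hr10 (1/3)
    have hX2 : r1 ^ (1/3:ℝ) * (r1 * u r1 ^ 4 * ρ r1 ^ 2 / 4) * (1 - ρ r1 ^ 2) < 0 := by
      refine lt_of_eq_of_lt ?_ hX1
      ring
    have hρ1 := hρpos r1 hr10
    have : 1 - ρ r1 ^ 2 < 0 := by
      by_contra hh
      push Not at hh
      have : 0 ≤ r1 ^ (1/3:ℝ) * (r1 * u r1 ^ 4 * ρ r1 ^ 2 / 4) * (1 - ρ r1 ^ 2) := by positivity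
      linarith
    have hgt : 1 < ρ r1 := by nlinarith
    have := key2 r1 hr10 (fun r hr => hgt.trans (kρ ⟨hr.1, hr.2.le⟩ ⟨hr10, le_rfl⟩ hr.2)) r1 ⟨hr10, le_rfl⟩
    linarith
  have hall : ∀ r, 0 < r → ρ r < β/α := fun r hr =>
    (key r hr (fun s hs => hGneg s hs.1)).2.1 r ⟨hr, le_rfl⟩
  have hX1 : X 1 < 0 := (key 1 one_pos (fun s hs => hGneg s hs.1)).2.2.2 1 ⟨one_pos, le_rfl⟩
  have hXle : ∀ r, 1 < r → X r < X 1 := fun r hr =>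
    (key r (by linarith) (fun s hs => hGneg s hs.1)).2.2.1 ⟨one_pos, hr.le⟩ ⟨by linarith, le_rfl⟩ hr
  have hXlim : Tendsto X atTop (𝓝 0) := by
    have h1 : Tendsto (fun r => ρ r ^ 2 * J u du r) atTop (𝓝 0) := by
      have hl : Tendsto (fun r => (β/α)^2 * J u du r) atTop (𝓝 0) := by simpa using H.J_lim.const_mul ((β/α)^2)
      apply squeeze_zero' _ _ hl
      · filter_upwards [eventually_gt_atTop 0] with r hr
        have := H.J_pos hr
        positivity
      · filter_upwards [eventually_gt_atTop 0] with r hr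
        have := H.J_pos hr
        have := hall r hr
        have := hρpos r hr
        gcongr
    simpa using h1.sub K.J_lim
  have : 0 ≤ X 1 := by
    apply le_of_tendsto hXlim
    filter_upwards [eventually_gt_atTop 1] with r hr using (hXle r hr).le
  linarith

theorem unique (H : RadSol u du α) (K : RadSol v dv β) : ∀ r, 0 < r → u r = v r := by
  have hab : α = β := by
    rcases lt_trichotomy α β with h | h | h
    · exact (no_lt H K h).elim
    · exact h
    · exact (no_lt K H h).elim
  subst hab
  exact local_unique H.hd1 H.hd2 K.hd1 K.hd2 H.lim0 H.dlim0 K.lim0 K.dlim0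

end RadSol
end OdeUniq2


namespace RadSol
open Set Topology
variable {u du : ℝ → ℝ} {α : ℝ}

lemma exp_bound (H : RadSol u du α) : ∃ C : ℝ, 0 < C ∧ ∀ r, 0 < r →
    u r ≤ C * exp (-(r/2)) ∧ |du r| ≤ C * exp (-(r/2)) := by
  obtain ⟨R, C, hR, hC, hd⟩ := H.decay
  obtain ⟨B, hB, hb⟩ := H.bdd
  refine ⟨C + B * exp (R/2), by positivity, ?_⟩
  intro r hr
  have he := Real.exp_pos (-(r/2))
  by_cases h : R ≤ r
  · obtain ⟨h1, h2, -⟩ := hd r h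
    have : C * exp (-(r/2)) ≤ (C + B * exp (R/2)) * exp (-(r/2)) := by
      have := Real.exp_pos (R/2)
      gcongr
      have : 0 < B * exp (R/2) := by positivity
      linarith
    exact ⟨h1.trans this, h2.trans this⟩
  · push Not at h
    obtain ⟨h1, h2⟩ := hb r hr
    have : B ≤ (C + B * exp (R/2)) * exp (-(r/2)) := by
      have e : 1 ≤ exp (R/2) * exp (-(r/2)) := by
        rw [← Real.exp_add]
        exact Real.one_le_exp (by linarith)
      have : B * 1 ≤ B * (exp (R/2) * exp (-(r/2))) := by gcongr
      have : 0 < C * exp (-(r/2)) := by positivity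
      nlinarith
    exact ⟨h1.trans this, h2.trans this⟩

lemma integrableOn_of_bound {f : ℝ → ℝ} {C k : ℝ} (hf : ContinuousOn f (Ioi 0)) (hk : 0 ≤ k)
    (hb : ∀ r, 0 < r → |f r| ≤ C * (r ^ k * exp (-r))) : IntegrableOn f (Ioi 0) := by
  have h := (integrableOn_rpow_mul_exp_neg_mul_rpow (p := 1) (s := k) (b := 1) (by linarith)
    one_pos one_pos).const_mul C
  refine Integrable.mono' h (hf.aestronglyMeasurable measurableSet_Ioi) ?_
  filter_upwards [ae_restrict_mem measurableSet_Ioi] with r hr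
  have := hb r hr
  rw [Real.norm_eq_abs]
  simpa using this

lemma sq_int (H : RadSol u du α) {k : ℝ} (hk : 0 ≤ k) :
    IntegrableOn (fun r => u r ^ 2 * r ^ k) (Ioi 0) := by
  obtain ⟨C, hC, hb⟩ := H.exp_bound
  refine integrableOn_of_bound (C := C^2) (k := k)
    ((H.cont.pow 2).mul (fun r hr => (Real.continuousAt_rpow_const r k (Or.inl (ne_of_gt hr))).continuousWithinAt)) hk ?_
  intro r hr
  have hu := H.pos r hr
  have hrk := Real.rpow_pos_of_pos hr k
  rw [abs_of_pos (by positivity)]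
  have : u r ^ 2 ≤ (C * exp (-(r/2))) ^ 2 := by gcongr; exact (hb r hr).1
  have e : exp (-r) = exp (-(r/2)) ^ 2 := by rw [← Real.exp_nat_mul]; congr 1; push_cast; ring
  rw [e]
  calc u r ^ 2 * r ^ k ≤ (C * exp (-(r/2))) ^ 2 * r ^ k := by gcongr
    _ = _ := by ring

lemma four_int (H : RadSol u du α) : IntegrableOn (fun r => u r ^ 4 * r) (Ioi 0) := by
  obtain ⟨B, hB, hb⟩ := H.bdd
  refine Integrable.mono' (H.int.const_mul (B^2))
    (((H.cont.pow 4).mul continuousOn_id).aestronglyMeasurable measurableSet_Ioi) ?_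
  filter_upwards [ae_restrict_mem measurableSet_Ioi] with r hr
  have hr : 0 < r := hr
  have hu := H.pos r hr
  rw [Real.norm_eq_abs, abs_of_pos (by positivity)]
  have := (hb r hr).1
  have : u r ^ 2 ≤ B ^ 2 := by gcongr
  nlinarith [mul_le_mul_of_nonneg_right this (by positivity : 0 ≤ u r ^ 2 * r)]

lemma dsq_int (H : RadSol u du α) : IntegrableOn (fun r => du r ^ 2 * r) (Ioi 0) := by
  obtain ⟨C, hC, hb⟩ := H.exp_bound
  refine integrableOn_of_bound (C := C^2) (k := 1)
    ((H.dcont.pow 2).mul continuousOn_id) zero_le_one ?_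
  intro r hr
  have hr : 0 < r := hr
  rw [Real.rpow_one]
  have e : exp (-r) = exp (-(r/2)) ^ 2 := by rw [← Real.exp_nat_mul]; congr 1; push_cast; ring
  rw [e, abs_of_nonneg (by positivity)]
  have h1 := (hb r hr).2
  have : du r ^ 2 ≤ (C * exp (-(r/2))) ^ 2 := by
    rw [← sq_abs (du r)]; gcongr
  calc du r ^ 2 * r ≤ (C * exp (-(r/2))) ^ 2 * r := by gcongr
    _ = _ := by ring

lemma int_zero {F F' : ℝ → ℝ} (h0 : F 0 = 0) (hF : ∀ r, 0 < r → HasDerivAt F (F' r) r)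
    (hl : Tendsto F (𝓝[>] 0) (𝓝 0)) (hi : IntegrableOn F' (Ioi 0)) (ht : Tendsto F atTop (𝓝 0)) :
    ∫ r in Ioi 0, F' r = 0 := by
  have := integral_Ioi_of_hasDerivAt_of_tendsto (a := 0) (f := F) (f' := F') (m := 0) ?_ hF hi ht
  · rw [this, h0, sub_zero]
  · rw [← continuousWithinAt_Ioi_iff_Ici, ContinuousWithinAt, h0]; exact hl

lemma lim_r2 (_H : RadSol u du α) : Tendsto (fun r => r ^ 2 * exp (-r)) atTop (𝓝 0) :=
  Real.tendsto_pow_mul_exp_neg_atTop_nhds_zero 2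

lemma four_eq (H : RadSol u du α) :
    ∫ r in Ioi 0, u r ^ 4 * r = 2 * ∫ r in Ioi 0, u r ^ 2 * r := by
  have key : ∫ r in Ioi 0, (1/2 * (u r ^ 4 * r) - u r ^ 2 * r) = 0 := by
    refine int_zero (F := fun r => r ^ 2 * (du r ^ 2 / 2 - u r ^ 2 / 2 + u r ^ 4 / 4)) (by simp) ?_ ?_ ?_ ?_
    · intro r hr
      have := ((hasDerivAt_id r).pow 2).mul (H.energy_hasDeriv hr)
      refine this.congr_deriv ?_
      simp only [id, Pi.pow_apply]
      field_simp
      push_cast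
      ring
    · have hid0 : Tendsto (fun r : ℝ => r) (𝓝[>] 0) (𝓝 0) := tendsto_nhdsWithin_of_tendsto_nhds tendsto_id
      have := (hid0.pow 2).mul ((((H.dlim0.pow 2).div_const 2).sub ((H.lim0.pow 2).div_const 2)).add
        ((H.lim0.pow 4).div_const 4))
      simpa using this
    · exact (H.four_int.const_mul _).sub H.int
    · obtain ⟨C, hC, hb⟩ := H.exp_bound
      obtain ⟨B, hB, hb2⟩ := H.bdd
      have hl := H.lim_r2.const_mul (C^2 + B^2 * C^2)
      rw [mul_zero] at hl
      apply squeeze_zero_norm' _ hl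
      filter_upwards [eventually_gt_atTop 0] with r hr
      obtain ⟨h1, h2⟩ := hb r hr
      have h3 := (hb2 r hr).1
      have hu := H.pos r hr
      have e : exp (-r) = exp (-(r/2)) ^ 2 := by rw [← Real.exp_nat_mul]; congr 1; push_cast; ring
      have a1 : du r ^ 2 ≤ (C * exp (-(r/2))) ^ 2 := by rw [← sq_abs (du r)]; gcongr
      have a2 : u r ^ 2 ≤ (C * exp (-(r/2))) ^ 2 := by gcongr
      have a3 : u r ^ 2 ≤ B ^ 2 := by gcongr
      have a4 : u r ^ 4 ≤ B ^ 2 * (C * exp (-(r/2))) ^ 2 := by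
        calc u r ^ 4 = u r ^ 2 * u r ^ 2 := by ring
          _ ≤ _ := by gcongr
      rw [Real.norm_eq_abs, abs_mul, abs_of_pos (by positivity : 0 < r ^ 2), e]
      have : |du r ^ 2 / 2 - u r ^ 2 / 2 + u r ^ 4 / 4| ≤ (C^2 + B^2 * C^2) * exp (-(r/2)) ^ 2 := by
        have b1 : 0 ≤ du r ^ 2 := by positivity
        have b2 : 0 ≤ u r ^ 4 := by positivity
        have b3 : 0 ≤ u r ^ 2 := by positivity
        rw [abs_le]; constructor <;> nlinarith
      calc _ ≤ r ^ 2 * ((C^2 + B^2 * C^2) * exp (-(r/2)) ^ 2) := by gcongr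
        _ = _ := by ring
  rw [integral_sub (H.four_int.const_mul _) H.int, integral_const_mul] at key
  linarith

lemma dsq_eq (H : RadSol u du α) :
    ∫ r in Ioi 0, du r ^ 2 * r = ∫ r in Ioi 0, u r ^ 2 * r := by
  have key : ∫ r in Ioi 0, (du r ^ 2 * r + (u r ^ 2 * r - u r ^ 4 * r)) = 0 := by
    refine int_zero (F := fun r => r * (u r * du r)) (by simp) ?_ ?_ ?_ ?_
    · intro r hr
      have := (hasDerivAt_id r).mul ((H.hd1 r hr).mul (H.hd2 r hr))
      refine this.congr_deriv ?_
      simp only [id, Pi.mul_apply]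
      field_simp
      ring
    · have hid0 : Tendsto (fun r : ℝ => r) (𝓝[>] 0) (𝓝 0) := tendsto_nhdsWithin_of_tendsto_nhds tendsto_id
      have := hid0.mul (H.lim0.mul H.dlim0)
      simpa using this
    · exact H.dsq_int.add (H.int.sub H.four_int)
    · obtain ⟨C, hC, hb⟩ := H.exp_bound
      have hl := H.lim_r2.const_mul (C^2)
      rw [mul_zero] at hl
      apply squeeze_zero_norm' _ hl
      filter_upwards [eventually_ge_atTop 1] with r hr1
      have hr : 0 < r := by linarith
      obtain ⟨h1, h2⟩ := hb r hr
      have hu := H.pos r hr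
      have e : exp (-r) = exp (-(r/2)) ^ 2 := by rw [← Real.exp_nat_mul]; congr 1; push_cast; ring
      rw [Real.norm_eq_abs, abs_mul, abs_mul, abs_of_pos hr, abs_of_pos hu, e]
      calc r * (u r * |du r|) ≤ r * ((C * exp (-(r/2))) * (C * exp (-(r/2)))) := by gcongr
        _ = (C^2 * exp (-(r/2))^2) * r := by ring
        _ ≤ (C^2 * exp (-(r/2))^2) * r^2 := by gcongr; nlinarith
        _ = _ := by ring
  have hs : IntegrableOn (fun r => u r ^ 2 * r - u r ^ 4 * r) (Ioi 0) := H.int.sub H.four_int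
  rw [integral_add H.dsq_int hs, integral_sub H.int H.four_int, H.four_eq] at key
  linarith

lemma m_pos (H : RadSol u du α) : 0 < ∫ r in Ioi 0, u r ^ 2 * r := by
  rw [setIntegral_pos_iff_support_of_nonneg_ae]
  · have : Function.support (fun r => u r ^ 2 * r) ∩ Ioi 0 = Ioi 0 := by
      apply inter_eq_right.2
      intro r hr
      have hr : 0 < r := hr
      have := H.pos r hr
      exact (by positivity : u r ^ 2 * r ≠ 0)
    rw [this]; simp
  · filter_upwards [ae_restrict_mem measurableSet_Ioi] with r hr
    have hr : 0 < r := hr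
    simp only [Pi.zero_apply]; positivity
  · exact H.int

end RadSol


open Set Topology in
/-- radial Sobolev class -/
structure RC (f g : ℝ → ℝ) : Prop where
  cont : ContinuousOn f (Ioi 0)
  der : ∃ s : Set ℝ, s.Countable ∧ ∀ r ∈ Ioi 0 \ s, HasDerivAt f (g r) r
  meas : AEStronglyMeasurable g (volume.restrict (Ioi 0))
  iA : IntegrableOn (fun r => g r ^ 2 * r) (Ioi 0)
  iB : IntegrableOn (fun r => f r ^ 2 * r) (Ioi 0)
  iD : IntegrableOn (fun r => f r ^ 4 * r) (Ioi 0)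

namespace RC
open Set Topology
variable {f g φ ψ : ℝ → ℝ}

/-- the radial H1 norm squared -/
def N (f g : ℝ → ℝ) : ℝ := (∫ r in Ioi 0, g r ^ 2 * r) + ∫ r in Ioi 0, f r ^ 2 * r
def D (f : ℝ → ℝ) : ℝ := ∫ r in Ioi 0, f r ^ 4 * r

lemma fmeas (H : RC f g) : AEStronglyMeasurable f (volume.restrict (Ioi 0)) :=
  H.cont.aestronglyMeasurable measurableSet_Ioi

lemma id_meas : AEStronglyMeasurable (fun r : ℝ => r) (volume.restrict (Ioi 0)) :=
  continuous_id.aestronglyMeasurable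

lemma A_nonneg (g : ℝ → ℝ) : 0 ≤ ∫ r in Ioi 0, g r ^ 2 * r :=
  setIntegral_nonneg measurableSet_Ioi (fun _ hr => mul_nonneg (sq_nonneg _) (le_of_lt hr))

lemma N_nonneg (f g : ℝ → ℝ) : 0 ≤ N f g := add_nonneg (A_nonneg _) (A_nonneg _)

lemma D_nonneg (f : ℝ → ℝ) : 0 ≤ D f :=
  setIntegral_nonneg measurableSet_Ioi (fun r hr => by
    have hr : 0 < r := hr
    positivity)

lemma intOn_of_le {F G : ℝ → ℝ} (hG : IntegrableOn G (Ioi 0))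
    (hF : AEStronglyMeasurable F (volume.restrict (Ioi 0))) (h : ∀ r, 0 < r → |F r| ≤ G r) :
    IntegrableOn F (Ioi 0) := by
  refine Integrable.mono' hG hF ?_
  filter_upwards [ae_restrict_mem measurableSet_Ioi] with r hr
  exact h r hr

lemma int_mul (hf : AEStronglyMeasurable f (volume.restrict (Ioi 0)))
    (hg : AEStronglyMeasurable g (volume.restrict (Ioi 0)))
    (hf2 : IntegrableOn (fun r => f r ^ 2 * r) (Ioi 0))
    (hg2 : IntegrableOn (fun r => g r ^ 2 * r) (Ioi 0)) :
    IntegrableOn (fun r => f r * g r * r) (Ioi 0) := by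
  refine intOn_of_le (hf2.add hg2) ((hf.mul hg).mul id_meas) ?_
  intro r hr
  simp only [Pi.add_apply]
  rw [abs_mul, abs_of_pos hr, ← add_mul]
  gcongr
  rw [abs_le]; constructor <;> nlinarith [sq_nonneg (f r + g r), sq_nonneg (f r - g r)]

lemma add_smul (H : RC f g) (K : RC φ ψ) (c : ℝ) :
    RC (fun r => f r + c * φ r) (fun r => g r + c * ψ r) where
  cont := H.cont.add (continuousOn_const.mul K.cont)
  der := by
    obtain ⟨s, hs, h1⟩ := H.der
    obtain ⟨t, ht, h2⟩ := K.der
    refine ⟨s ∪ t, hs.union ht, fun r hr => ?_⟩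
    exact (h1 r ⟨hr.1, fun h => hr.2 (Or.inl h)⟩).add ((h2 r ⟨hr.1, fun h => hr.2 (Or.inr h)⟩).const_mul c)
  meas := H.meas.add (K.meas.const_mul c)
  iA := by
    have := (H.iA.add ((int_mul H.meas K.meas H.iA K.iA).const_mul (2*c))).add (K.iA.const_mul (c^2))
    refine this.congr (ae_of_all _ fun r => ?_)
    simp only [Pi.add_apply]; ring
  iB := by
    have := (H.iB.add ((int_mul H.fmeas K.fmeas H.iB K.iB).const_mul (2*c))).add (K.iB.const_mul (c^2))
    refine this.congr (ae_of_all _ fun r => ?_)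
    simp only [Pi.add_apply]; ring
  iD := by
    refine intOn_of_le ((H.iD.const_mul 8).add (K.iD.const_mul (8*c^4)))
      (((H.fmeas.add (K.fmeas.const_mul c)).pow 4).mul id_meas) ?_
    intro r hr
    simp only [Pi.add_apply, Pi.pow_apply]
    rw [abs_of_nonneg (by positivity)]
    have : (f r + c * φ r)^4 ≤ 8 * (f r ^4 + (c * φ r)^4) := by
      nlinarith [sq_nonneg (f r - c * φ r), sq_nonneg (f r + c * φ r), sq_nonneg (f r^2 - (c*φ r)^2),
        sq_nonneg ((f r - c * φ r)^2), mul_nonneg (sq_nonneg (f r - c * φ r)) (sq_nonneg (f r + c * φ r)),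
        mul_nonneg (sq_nonneg (f r - c * φ r)) (sq_nonneg (f r)), mul_nonneg (sq_nonneg (f r - c * φ r)) (sq_nonneg (c * φ r))]
    nlinarith

lemma N_add (H : RC f g) (K : RC φ ψ) (c : ℝ) :
    N (fun r => f r + c * φ r) (fun r => g r + c * ψ r) =
      N f g + 2 * c * ((∫ r in Ioi 0, g r * ψ r * r) + ∫ r in Ioi 0, f r * φ r * r) + c^2 * N φ ψ := by
  have h1 := int_mul H.meas K.meas H.iA K.iA
  have h2 := int_mul H.fmeas K.fmeas H.iB K.iB
  have hsh1 : IntegrableOn (fun r => g r ^ 2 * r + 2 * c * (g r * ψ r * r)) (Ioi 0) :=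
    H.iA.add (h1.const_mul _)
  have hsh2 : IntegrableOn (fun r => f r ^ 2 * r + 2 * c * (f r * φ r * r)) (Ioi 0) :=
    H.iB.add (h2.const_mul _)
  have e1 : ∫ r in Ioi 0, (g r + c * ψ r)^2 * r = (∫ r in Ioi 0, g r ^ 2 * r) +
      (2*c) * (∫ r in Ioi 0, g r * ψ r * r) + c^2 * ∫ r in Ioi 0, ψ r ^ 2 * r := by
    rw [← integral_const_mul, ← integral_const_mul, ← integral_add H.iA (h1.const_mul _),
      ← integral_add hsh1 (K.iA.const_mul _)]
    congr 1; ext r; ring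
  have e2 : ∫ r in Ioi 0, (f r + c * φ r)^2 * r = (∫ r in Ioi 0, f r ^ 2 * r) +
      (2*c) * (∫ r in Ioi 0, f r * φ r * r) + c^2 * ∫ r in Ioi 0, φ r ^ 2 * r := by
    rw [← integral_const_mul, ← integral_const_mul, ← integral_add H.iB (h2.const_mul _),
      ← integral_add hsh2 (K.iB.const_mul _)]
    congr 1; ext r; ring
  simp only [N]
  rw [e1, e2]; ring

lemma smul (H : RC f g) (c : ℝ) : RC (fun r => c * f r) (fun r => c * g r) where
  cont := continuousOn_const.mul H.cont
  der := by
    obtain ⟨s, hs, h1⟩ := H.der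
    exact ⟨s, hs, fun r hr => (h1 r hr).const_mul c⟩
  meas := H.meas.const_mul c
  iA := (H.iA.const_mul (c^2)).congr (ae_of_all _ fun r => by simp only; ring)
  iB := (H.iB.const_mul (c^2)).congr (ae_of_all _ fun r => by simp only; ring)
  iD := (H.iD.const_mul (c^4)).congr (ae_of_all _ fun r => by simp only; ring)

lemma N_smul (f g : ℝ → ℝ) (c : ℝ) : N (fun r => c * f r) (fun r => c * g r) = c^2 * N f g := by
  simp only [N]
  rw [mul_add, ← integral_const_mul, ← integral_const_mul]
  congr 1 <;> (congr 1; ext r; ring)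

lemma D_smul (f : ℝ → ℝ) (c : ℝ) : D (fun r => c * f r) = c^4 * D f := by
  simp only [D]
  rw [← integral_const_mul]
  congr 1; ext r; ring

lemma g_int (H : RC f g) {x y : ℝ} (hx : 0 < x) : IntegrableOn g (Ioc x y) := by
  have hsub : Ioc x y ⊆ Ioi 0 := fun r hr => lt_trans hx hr.1
  have h1 : IntegrableOn (fun r => g r ^ 2 * r + 1 / x) (Ioc x y) :=
    (H.iA.mono_set hsub).add (by simp [integrableOn_const])
  refine Integrable.mono' h1 (H.meas.mono_measure (Measure.restrict_mono hsub le_rfl)) ?_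
  filter_upwards [ae_restrict_mem measurableSet_Ioc] with r hr
  have hr0 : 0 < r := hsub hr
  rw [Real.norm_eq_abs]
  have h2 : 1 / r ≤ 1 / x := by gcongr; exact hr.1.le
  have h3 : |g r| ≤ g r ^ 2 * r + 1 / r := by
    have : |g r| * r ≤ (g r * r)^2 + 1 := by
      rw [← abs_of_pos hr0, ← abs_mul, abs_of_pos hr0, abs_le]
      constructor <;> nlinarith [sq_nonneg (g r * r - 1), sq_nonneg (g r * r + 1)]
    rw [← mul_le_mul_iff_left₀ hr0]
    have e : (g r ^ 2 * r + 1 / r) * r = (g r * r)^2 + 1 := by field_simp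
    rw [e]; exact this
  linarith

lemma ftc (H : RC f g) {x y : ℝ} (hx : 0 < x) (hxy : x ≤ y) :
    ∫ r in Ioc x y, g r = f y - f x := by
  obtain ⟨s, hs, h1⟩ := H.der
  rw [← intervalIntegral.integral_of_le hxy]
  refine integral_eq_of_hasDerivAt_off_countable_of_le f g hxy hs
    (H.cont.mono fun r hr => lt_of_lt_of_le hx hr.1) (fun r hr => h1 r ⟨lt_trans hx hr.1.1, hr.2⟩) ?_
  rw [intervalIntegrable_iff_integrableOn_Ioc_of_le hxy]
  exact H.g_int hx

lemma holder (H : RC f g) (hN : N f g ≤ 1) {x y : ℝ} (hx : 0 < x) (hxy : x ≤ y) :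
    |f y - f x| ≤ √(Real.log y - Real.log x) := by
  rcases hxy.eq_or_lt with rfl | hlt
  · simp
  have hy : 0 < y := hx.trans hlt
  set L := Real.log y - Real.log x with hL
  have hL0 : 0 < L := by rw [hL, sub_pos]; exact Real.log_lt_log hx hlt
  have hs : 0 < √L := Real.sqrt_pos.2 hL0
  have hsub : Ioc x y ⊆ Ioi 0 := fun r hr => lt_trans hx hr.1
  have iinv : IntegrableOn (fun r : ℝ => r⁻¹) (Ioc x y) := by
    rw [← intervalIntegrable_iff_integrableOn_Ioc_of_le hxy]
    exact intervalIntegral.intervalIntegrable_inv (fun r hr => by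
      rw [uIcc_of_le hxy] at hr; exact (lt_of_lt_of_le hx hr.1).ne') continuousOn_id
  have einv : ∫ r in Ioc x y, r⁻¹ = L := by
    rw [← intervalIntegral.integral_of_le hxy, integral_inv_of_pos hx hy, Real.log_div hy.ne' hx.ne']
  have iA := H.iA.mono_set hsub
  rw [← H.ftc hx hxy]
  have hA : ∫ r in Ioc x y, g r ^ 2 * r ≤ 1 := by
    have h1 : ∫ r in Ioc x y, g r ^ 2 * r ≤ ∫ r in Ioi 0, g r ^ 2 * r :=
      setIntegral_mono_set H.iA (by
        filter_upwards [ae_restrict_mem measurableSet_Ioi] with r hr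
        exact mul_nonneg (sq_nonneg _) (le_of_lt hr)) (ae_of_all _ hsub)
    have := A_nonneg f
    simp only [N] at hN
    linarith
  calc |∫ r in Ioc x y, g r| ≤ ∫ r in Ioc x y, |g r| := abs_integral_le_integral_abs
    _ ≤ ∫ r in Ioc x y, (√L / 2 * (g r ^ 2 * r) + 1 / (2 * √L) * r⁻¹) := by
        apply setIntegral_mono_on (H.g_int hx).abs ((iA.const_mul _).add (iinv.const_mul _)) measurableSet_Ioc
        intro r hr
        simp only [Pi.add_apply]
        have hr0 : 0 < r := hsub hr
        have : 0 ≤ (√L * |g r| * r - 1)^2 / (2 * √L * r) := by positivity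
        have e : √L / 2 * (g r ^ 2 * r) + 1 / (2 * √L) * r⁻¹ - |g r| = (√L * |g r| * r - 1)^2 / (2 * √L * r) := by
          rw [← sq_abs (g r)]; field_simp; ring
        linarith
    _ = √L / 2 * (∫ r in Ioc x y, g r ^ 2 * r) + 1 / (2 * √L) * L := by
        rw [integral_add (iA.const_mul _) (iinv.const_mul _), integral_const_mul, integral_const_mul, einv]
    _ ≤ √L / 2 * 1 + 1 / (2 * √L) * (√L * √L) := by
        rw [Real.mul_self_sqrt hL0.le]; gcongr
    _ = √L := by field_simp; ring

lemma decay (H : RC f g) (hN : N f g ≤ 1) {x : ℝ} (hx : 0 < x) : f x ^ 2 ≤ 1 / x := by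
  have hsmall : ∀ ε > 0, ∃ y, x ≤ y ∧ f y ^ 2 ≤ ε := by
    intro ε hε
    by_contra hcon
    push Not at hcon
    have hc : IntegrableOn (fun _ : ℝ => ε * x) (Ioi x) := by
      refine Integrable.mono' (H.iB.mono_set (Ioi_subset_Ioi hx.le)) aestronglyMeasurable_const ?_
      filter_upwards [ae_restrict_mem measurableSet_Ioi] with r hr
      have hr : x < r := hr
      rw [Real.norm_eq_abs, abs_of_pos (by positivity)]
      have := hcon r hr.le
      gcongr
    rw [integrableOn_const_iff] at hc
    rcases hc with h | h
    · have : 0 < ε * x := by positivity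
      exact this.ne' (by simpa using h)
    · simp at h
  apply le_of_forall_pos_le_add
  intro ε hε
  obtain ⟨y, hxy, hy⟩ := hsmall ε hε
  have hsub : Ioc x y ⊆ Ioi 0 := fun r hr => lt_trans hx hr.1
  obtain ⟨s, hs, h1⟩ := H.der
  have ifg : IntegrableOn (fun r => 2 * (f r * g r)) (Ioc x y) := by
    have hc : ContinuousOn (fun r => 2 * f r) (Icc x y) :=
      continuousOn_const.mul (H.cont.mono fun r hr => lt_of_lt_of_le hx hr.1)
    have := (((H.g_int (y := y) hx).congr_set_ae Ioc_ae_eq_Icc.symm)).continuousOn_mul hc isCompact_Icc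
    refine (this.mono_set Ioc_subset_Icc_self).congr (ae_of_all _ fun r => by simp only; ring)
  have e : ∫ r in Ioc x y, 2 * (f r * g r) = f y ^ 2 - f x ^ 2 := by
    rw [← intervalIntegral.integral_of_le hxy]
    refine integral_eq_of_hasDerivAt_off_countable_of_le (fun r => f r ^ 2) (fun r => 2 * (f r * g r)) hxy hs
      ((H.cont.pow 2).mono fun r hr => lt_of_lt_of_le hx hr.1) (fun r hr => ?_) ?_
    · refine ((h1 r ⟨lt_trans hx hr.1.1, hr.2⟩).pow 2).congr_deriv ?_
      simp; ring
    · rw [intervalIntegrable_iff_integrableOn_Ioc_of_le hxy]; exact ifg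
  have iAB : IntegrableOn (fun r => g r ^ 2 * r + f r ^ 2 * r) (Ioi 0) := H.iA.add H.iB
  have hle : -(∫ r in Ioc x y, 2 * (f r * g r)) ≤ 1 / x * N f g := by
    rw [← integral_neg]
    calc ∫ r in Ioc x y, -(2 * (f r * g r)) ≤ ∫ r in Ioc x y, 1 / x * (g r ^ 2 * r + f r ^ 2 * r) := by
          apply setIntegral_mono_on ifg.neg ((iAB.mono_set hsub).const_mul _) measurableSet_Ioc
          intro r hr
          simp only [Pi.neg_apply]
          have : -(2 * (f r * g r)) ≤ g r ^ 2 + f r ^ 2 := by nlinarith [sq_nonneg (f r + g r)]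
          have h2 : 1 ≤ 1 / x * r := by
            rw [one_div, inv_mul_eq_div, le_div_iff₀ hx]; linarith [hr.1]
          calc _ ≤ (g r ^ 2 + f r ^ 2) * 1 := by linarith
            _ ≤ (g r ^ 2 + f r ^ 2) * (1 / x * r) := by gcongr
            _ = _ := by ring
      _ = 1 / x * ∫ r in Ioc x y, (g r ^ 2 * r + f r ^ 2 * r) := integral_const_mul _ _
      _ ≤ 1 / x * ∫ r in Ioi 0, (g r ^ 2 * r + f r ^ 2 * r) := by
          refine mul_le_mul_of_nonneg_left ?_ (by positivity)
          refine setIntegral_mono_set iAB (by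
            filter_upwards [ae_restrict_mem measurableSet_Ioi] with r hr
            have hr : 0 < r := hr
            simp only [Pi.zero_apply]
            positivity) (ae_of_all _ hsub)
      _ = _ := by rw [integral_add H.iA H.iB]; rfl
  have : 1 / x * N f g ≤ 1 / x * 1 := by gcongr
  linarith

lemma sharp_bound (H : RC f g) (hN : N f g ≤ 1) {x : ℝ} (hx : 0 < x) : f x ^ 4 * x ≤ 72 := by
  by_cases h1 : 1 ≤ x
  · have := H.decay hN hx
    have h2 : f x ^ 2 * x ≤ 1 := by rw [le_div_iff₀ hx] at this; exact this
    have h3 : f x ^ 2 ≤ 1 := by nlinarith [sq_nonneg (f x)]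
    nlinarith [mul_nonneg (sq_nonneg (f x)) hx.le]
  · push Not at h1
    have hh := H.holder hN hx h1.le
    have hd := H.decay hN one_pos
    have hL : Real.log 1 - Real.log x = Real.log (1/x) := by rw [Real.log_div one_ne_zero hx.ne']
    set L := Real.log 1 - Real.log x with hLd
    have hL0 : 0 ≤ L := by rw [hL]; exact Real.log_nonneg (by rw [le_div_iff₀ hx]; linarith)
    have hsx : 0 < √x := Real.sqrt_pos.2 hx
    have hLx : L * √x ≤ 2 := by
      have h2 : Real.log (1 / √x) ≤ 1 / √x - 1 := Real.log_le_sub_one_of_pos (by positivity)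
      have h3 : L = 2 * Real.log (1 / √x) := by
        rw [hL, Real.log_div one_ne_zero hx.ne', Real.log_div one_ne_zero hsx.ne', Real.log_sqrt hx.le]; simp; ring
      have h4 : L ≤ 2 * (1 / √x) := by linarith
      calc L * √x ≤ 2 * (1 / √x) * √x := by gcongr
        _ = 2 := by field_simp
    have hsq : (f 1 - f x)^2 ≤ L := by
      rw [← sq_abs]
      calc |f 1 - f x|^2 ≤ (√L)^2 := by gcongr
        _ = L := Real.sq_sqrt hL0
    have hf2 : f x ^ 2 ≤ 2 * L + 2 := by
      rw [div_one] at hd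
      nlinarith [sq_nonneg (f x - f 1 - f 1), sq_nonneg (f x - f 1 + f 1)]
    have hs1 : √x ≤ 1 := Real.sqrt_le_one.2 h1.le
    have h5 : f x ^ 2 * √x ≤ 6 := by
      calc f x ^ 2 * √x ≤ (2 * L + 2) * √x := by gcongr
        _ ≤ 6 := by nlinarith
    calc f x ^ 4 * x = (f x ^ 2 * √x)^2 := by rw [mul_pow, Real.sq_sqrt hx.le]; ring
      _ ≤ 6^2 := by gcongr
      _ ≤ 72 := by norm_num

lemma tail (H : RC f g) (hN : N f g ≤ 1) {x : ℝ} (hx : 0 < x) :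
    ∫ r in Ioi x, f r ^ 4 * r ≤ 1 / x := by
  have hsub : Ioi x ⊆ Ioi (0:ℝ) := Ioi_subset_Ioi hx.le
  calc ∫ r in Ioi x, f r ^ 4 * r ≤ ∫ r in Ioi x, 1 / x * (f r ^ 2 * r) := by
        apply setIntegral_mono_on (H.iD.mono_set hsub) ((H.iB.mono_set hsub).const_mul _) measurableSet_Ioi
        intro r hr
        have hr : x < r := hr
        have hr0 : 0 < r := hx.trans hr
        have := H.decay hN hr0
        have h2 : 1 / r ≤ 1 / x := by gcongr
        calc f r ^ 4 * r = f r ^ 2 * (f r ^ 2 * r) := by ring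
          _ ≤ 1 / x * (f r ^ 2 * r) := by gcongr; linarith
    _ = 1 / x * ∫ r in Ioi x, f r ^ 2 * r := integral_const_mul _ _
    _ ≤ 1 / x * ∫ r in Ioi 0, f r ^ 2 * r := by
        refine mul_le_mul_of_nonneg_left ?_ (by positivity)
        exact setIntegral_mono_set H.iB (by
            filter_upwards [ae_restrict_mem measurableSet_Ioi] with r hr
            have hr : 0 < r := hr
            simp only [Pi.zero_apply]
            positivity) (ae_of_all _ hsub)
    _ ≤ 1 / x * 1 := by
        gcongr
        have := A_nonneg g
        simp only [N] at hN
        linarith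
    _ = 1 / x := mul_one _

lemma D_split (H : RC f g) {x : ℝ} (hx : 0 < x) :
    D f = (∫ r in Ioc 0 x, f r ^ 4 * r) + ∫ r in Ioi x, f r ^ 4 * r := by
  rw [D, ← Ioc_union_Ioi_eq_Ioi hx.le, setIntegral_union (Ioc_disjoint_Ioi le_rfl) measurableSet_Ioi
    (H.iD.mono_set Ioc_subset_Ioi_self) (H.iD.mono_set (Ioi_subset_Ioi hx.le))]

lemma D_le (H : RC f g) (hN : N f g ≤ 1) : D f ≤ 73 := by
  rw [H.D_split one_pos]
  have h1 := H.tail hN one_pos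
  have h2 : ∫ r in Ioc 0 1, f r ^ 4 * r ≤ ∫ r in Ioc (0:ℝ) 1, (72:ℝ) := by
    apply setIntegral_mono_on (H.iD.mono_set Ioc_subset_Ioi_self) (by simp [integrableOn_const]) measurableSet_Ioc
    intro r hr
    exact H.sharp_bound hN hr.1
  simp at h2
  norm_num at h1
  linarith

end RC


section LogClamp
open Set Topology

/-- logarithmic cutoff, `1` for `r ≤ x`, `0` for `r ≥ y` -/
def lc (x y r : ℝ) : ℝ := max 0 (min 1 ((Real.log y - Real.log r) / (Real.log y - Real.log x)))
def lcd (x y r : ℝ) : ℝ := (Ioo x y).indicator (fun r => -(r * (Real.log y - Real.log x))⁻¹) r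

variable {x y : ℝ}

lemma lc_nonneg (x y r : ℝ) : 0 ≤ lc x y r := le_max_left _ _
lemma lc_le_one (x y r : ℝ) : lc x y r ≤ 1 := max_le zero_le_one (min_le_left _ _)

lemma lc_L (hx : 0 < x) (hxy : x < y) : 0 < Real.log y - Real.log x :=
  sub_pos.2 (Real.log_lt_log hx hxy)

lemma lc_of_le (hx : 0 < x) (hxy : x < y) {r : ℝ} (hr : 0 < r) (h : r ≤ x) : lc x y r = 1 := by
  have := lc_L hx hxy
  have h1 : 1 ≤ (Real.log y - Real.log r) / (Real.log y - Real.log x) := by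
    rw [le_div_iff₀ this]; linarith [Real.log_le_log hr h]
  simp [lc, min_eq_left h1]

lemma lc_of_ge (hx : 0 < x) (hxy : x < y) {r : ℝ} (h : y ≤ r) : lc x y r = 0 := by
  have := lc_L hx hxy
  have h1 : (Real.log y - Real.log r) / (Real.log y - Real.log x) ≤ 0 := by
    apply div_nonpos_of_nonpos_of_nonneg _ this.le
    linarith [Real.log_le_log (hx.trans hxy) h]
  rw [lc, max_eq_left ((min_le_right _ _).trans h1)]

lemma lc_of_mem (hx : 0 < x) (hxy : x < y) {r : ℝ} (h1 : x ≤ r) (h2 : r ≤ y) :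
    lc x y r = (Real.log y - Real.log r) / (Real.log y - Real.log x) := by
  have := lc_L hx hxy
  have h3 := Real.log_le_log hx h1
  have h4 := Real.log_le_log (hx.trans_le h1) h2
  rw [lc, min_eq_right, max_eq_right]
  · apply div_nonneg _ this.le; linarith
  · rw [div_le_one this]; linarith

lemma lc_cont (x y : ℝ) : ContinuousOn (lc x y) (Ioi 0) := by
  have : ContinuousOn Real.log (Ioi 0) := Real.continuousOn_log.mono (fun r hr => ne_of_gt hr)
  unfold lc
  exact ContinuousOn.sup continuousOn_const (ContinuousOn.inf continuousOn_const ((continuousOn_const.sub this).div_const _))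

lemma lcd_meas (x y : ℝ) : Measurable (lcd x y) := by
  unfold lcd
  exact Measurable.indicator (by fun_prop) measurableSet_Ioo

lemma lc_deriv (hx : 0 < x) (hxy : x < y) {r : ℝ} (hr : 0 < r) (h1 : r ≠ x) (h2 : r ≠ y) :
    HasDerivAt (lc x y) (lcd x y r) r := by
  rcases lt_or_gt_of_ne h1 with h | h
  · have e : lcd x y r = 0 := by simp [lcd, h.le.not_gt, not_lt.2 h.le]
    rw [e]
    refine (hasDerivAt_const r (1:ℝ)).congr_of_eventuallyEq ?_
    filter_upwards [Ioo_mem_nhds hr h] with s hs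
    exact lc_of_le hx hxy hs.1 hs.2.le
  rcases lt_or_gt_of_ne h2 with h' | h'
  · have e : lcd x y r = -(r * (Real.log y - Real.log x))⁻¹ := by
      simp [lcd, h, h']
    rw [e]
    have : HasDerivAt (fun r => (Real.log y - Real.log r) / (Real.log y - Real.log x))
        (-(r * (Real.log y - Real.log x))⁻¹) r := by
      refine (((Real.hasDerivAt_log hr.ne').const_sub _).div_const _).congr_deriv ?_
      have := lc_L hx hxy
      field_simp
    refine this.congr_of_eventuallyEq ?_
    filter_upwards [Ioo_mem_nhds h h'] with s hs
    exact lc_of_mem hx hxy hs.1.le hs.2.le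
  · have e : lcd x y r = 0 := by simp [lcd, not_lt.2 h'.le]
    rw [e]
    refine (hasDerivAt_const r (0:ℝ)).congr_of_eventuallyEq ?_
    filter_upwards [Ioi_mem_nhds h'] with s hs
    exact lc_of_ge hx hxy (le_of_lt hs)

lemma lcd_sq (x y r : ℝ) : lcd x y r ^ 2 * r =
    (Ioo x y).indicator (fun r => ((Real.log y - Real.log x)⁻¹)^2 * r⁻¹) r := by
  by_cases h : r ∈ Ioo x y
  · simp only [lcd, indicator_of_mem h]
    by_cases hr : r = 0
    · simp [hr]
    · field_simp
  · simp [lcd, indicator_of_notMem h]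

lemma inv_intOn (hx : 0 < x) (hxy : x < y) : IntegrableOn (fun r : ℝ => r⁻¹) (Ioo x y) := by
  refine IntegrableOn.mono_set (t := Ioc x y) ?_ Ioo_subset_Ioc_self
  rw [← intervalIntegrable_iff_integrableOn_Ioc_of_le hxy.le]
  exact intervalIntegral.intervalIntegrable_inv (fun r hr => by
      rw [uIcc_of_le hxy.le] at hr; exact (lt_of_lt_of_le hx hr.1).ne') continuousOn_id

lemma inv_int (hx : 0 < x) (hxy : x < y) : ∫ r in Ioo x y, r⁻¹ = Real.log y - Real.log x := by
  rw [← integral_Ioc_eq_integral_Ioo, ← intervalIntegral.integral_of_le hxy.le,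
    integral_inv_of_pos hx (hx.trans hxy), Real.log_div (hx.trans hxy).ne' hx.ne']

lemma lcd_iA (hx : 0 < x) (hxy : x < y) : IntegrableOn (fun r => lcd x y r ^ 2 * r) (Ioi 0) := by
  simp_rw [lcd_sq]
  refine (Integrable.integrableOn ?_)
  rw [integrable_indicator_iff measurableSet_Ioo]
  exact (inv_intOn hx hxy).const_mul _

lemma lcd_A (hx : 0 < x) (hxy : x < y) :
    ∫ r in Ioi 0, lcd x y r ^ 2 * r = (Real.log y - Real.log x)⁻¹ := by
  simp_rw [lcd_sq]
  rw [setIntegral_indicator measurableSet_Ioo, inter_eq_right.2 (show Ioo x y ⊆ Ioi 0 from fun r hr => hx.trans hr.1),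
    integral_const_mul, inv_int hx hxy]
  have := lc_L hx hxy
  field_simp

lemma lc_int (hx : 0 < x) (hxy : x < y) {k : ℕ} (hk : k ≠ 0) :
    IntegrableOn (fun r => lc x y r ^ k * r) (Ioi 0) := by
  have hy : 0 < y := hx.trans hxy
  have hc : IntegrableOn ((Ioc 0 y).indicator (fun _ : ℝ => y)) (Ioi 0) := by
    refine (Integrable.integrableOn ?_)
    rw [integrable_indicator_iff measurableSet_Ioc]
    simp
  refine RC.intOn_of_le hc ((((lc_cont x y).pow k).mul continuousOn_id).aestronglyMeasurable measurableSet_Ioi) ?_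
  intro r hr
  by_cases h : r ≤ y
  · rw [indicator_of_mem (show r ∈ Ioc 0 y from ⟨hr, h⟩), abs_of_nonneg (mul_nonneg (pow_nonneg (lc_nonneg _ _ _) _) hr.le)]
    calc lc x y r ^ k * r ≤ 1 * y := by
          gcongr
          exact pow_le_one₀ (lc_nonneg _ _ _) (lc_le_one _ _ _)
      _ = y := one_mul _
  · push Not at h
    rw [lc_of_ge hx hxy h.le, indicator_of_notMem (by simp [h])]
    simp [hk]

lemma lc_RC (hx : 0 < x) (hxy : x < y) : RC (lc x y) (lcd x y) where
  cont := lc_cont x y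
  der := ⟨{x, y}, by simp, fun r hr => lc_deriv hx hxy hr.1 (fun h => hr.2 (by simp [h]))
    (fun h => hr.2 (by simp [h]))⟩
  meas := (lcd_meas x y).aestronglyMeasurable
  iA := lcd_iA hx hxy
  iB := lc_int hx hxy two_ne_zero
  iD := lc_int hx hxy four_ne_zero

lemma RC.inner_lcd {f g : ℝ → ℝ} (H : RC f g) (hx : 0 < x) (hxy : x < y) :
    ∫ r in Ioi 0, g r * lcd x y r * r = -((f y - f x) / (Real.log y - Real.log x)) := by
  have e : ∀ r, g r * lcd x y r * r = (Ioo x y).indicator (fun r => -(Real.log y - Real.log x)⁻¹ * g r) r := by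
    intro r
    by_cases h : r ∈ Ioo x y
    · have : 0 < r := hx.trans h.1
      have hL := lc_L hx hxy
      simp only [lcd, indicator_of_mem h]
      field_simp
    · simp [lcd, indicator_of_notMem h]
  simp_rw [e]
  rw [setIntegral_indicator measurableSet_Ioo, inter_eq_right.2 (show Ioo x y ⊆ Ioi 0 from fun r hr => hx.trans hr.1),
    integral_const_mul, ← integral_Ioc_eq_integral_Ioo, H.ftc hx hxy.le]
  ring

end LogClamp


namespace RC
open Set Topology
variable {f g : ℝ → ℝ}

/-- set of quartic values on the nonnegative unit ball -/
def KS : Set ℝ := {d | ∃ f g : ℝ → ℝ, RC f g ∧ (∀ r, 0 < r → 0 ≤ f r) ∧ N f g ≤ 1 ∧ d = D f}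
def KK : ℝ := sSup KS

lemma KS_bdd : BddAbove KS := ⟨73, by
  rintro d ⟨f, g, H, -, hN, rfl⟩
  exact H.D_le hN⟩

lemma KK_ge (H : RC f g) (h0 : ∀ r, 0 < r → 0 ≤ f r) (hN : N f g ≤ 1) : D f ≤ KK :=
  le_csSup KS_bdd ⟨f, g, H, h0, hN, rfl⟩

lemma KK_nonneg : 0 ≤ KK := by
  have H := (lc_RC one_pos one_lt_two).smul 0
  have := KK_ge H (fun r _ => by simp) (by rw [N_smul]; simp)
  exact (D_nonneg _).trans this

lemma D_le_nonneg (H : RC f g) (h0 : ∀ r, 0 < r → 0 ≤ f r) : D f ≤ KK * N f g ^ 2 := by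
  have hK := KK_nonneg
  rcases (N_nonneg f g).eq_or_lt with h | h
  · have key : ∀ c : ℝ, 0 ≤ c → c^4 * D f ≤ KK := by
      intro c hc
      rw [← D_smul]
      exact KK_ge (H.smul c) (fun r hr => mul_nonneg hc (h0 r hr)) (by rw [N_smul, ← h]; simp)
    rw [← h]
    by_contra hcon
    push Not at hcon
    simp at hcon
    have h1 := key (KK / D f + 1) (by positivity)
    have h2 : KK / D f + 1 ≤ (KK / D f + 1)^4 := le_self_pow₀ (by linarith [div_nonneg hK hcon.le]) (by norm_num)
    have h3 : (KK / D f + 1) * D f ≤ KK := (mul_le_mul_of_nonneg_right h2 hcon.le).trans h1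
    have h4 : (KK / D f + 1) * D f = KK + D f := by field_simp
    linarith
  · set c := (√(N f g))⁻¹ with hc
    have hs : 0 < √(N f g) := Real.sqrt_pos.2 h
    have hc2 : c^2 = (N f g)⁻¹ := by rw [hc, inv_pow, Real.sq_sqrt h.le]
    have := KK_ge (H.smul c) (fun r hr => mul_nonneg (by positivity) (h0 r hr)) (by
      rw [N_smul, hc2, inv_mul_cancel₀ h.ne'])
    rw [D_smul] at this
    have e : c^4 = (N f g ^ 2)⁻¹ := by
      rw [show c^4 = (c^2)^2 by ring, hc2, inv_pow]
    rw [e, inv_mul_eq_div, div_le_iff₀ (by positivity)] at this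
    exact this

/-- smooth absolute value -/
def sa (δ t : ℝ) : ℝ := √(t^2 + δ^2) - δ

lemma sa_nonneg {δ : ℝ} (_hδ : 0 < δ) (t : ℝ) : 0 ≤ sa δ t := by
  rw [sa, sub_nonneg]
  exact Real.le_sqrt_of_sq_le (by nlinarith [sq_nonneg t])

lemma sa_le {δ : ℝ} (hδ : 0 < δ) (t : ℝ) : sa δ t ≤ |t| := by
  rw [sa, sub_le_iff_le_add, Real.sqrt_le_left (by positivity)]
  rw [← sq_abs t]
  nlinarith [abs_nonneg t]

lemma sa_ge {δ : ℝ} (t : ℝ) : |t| - δ ≤ sa δ t := by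
  rw [sa]
  have : |t| ≤ √(t^2+δ^2) := Real.abs_le_sqrt (by nlinarith [sq_nonneg δ])
  linarith

lemma sa_deriv {δ : ℝ} (hδ : 0 < δ) (t : ℝ) : HasDerivAt (sa δ) (t / √(t^2 + δ^2)) t := by
  have h1 : HasDerivAt (fun t : ℝ => t^2 + δ^2) (2*t) t := by
    simpa using ((hasDerivAt_id t).pow 2).add_const (δ^2)
  refine ((h1.sqrt (by positivity)).sub_const δ).congr_deriv ?_
  have : 0 < √(t^2 + δ^2) := Real.sqrt_pos.2 (by positivity)
  field_simp

lemma sa_deriv_le {δ : ℝ} (hδ : 0 < δ) (t : ℝ) : (t / √(t^2 + δ^2))^2 ≤ 1 := by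
  rw [div_pow, Real.sq_sqrt (by positivity), div_le_one (by positivity)]
  nlinarith [sq_nonneg δ]

lemma sa_cont {δ : ℝ} (hδ : 0 < δ) : Continuous (sa δ) :=
  continuous_iff_continuousAt.2 fun t => (sa_deriv hδ t).continuousAt

lemma sa_tendsto (t : ℝ) : Tendsto (fun n : ℕ => sa (1/((n:ℝ)+1)) t) atTop (𝓝 |t|) := by
  have h := tendsto_one_div_add_atTop_nhds_zero_nat (𝕜 := ℝ)
  refine tendsto_of_tendsto_of_tendsto_of_le_of_le (g := fun n : ℕ => |t| - 1/((n:ℝ)+1)) (h := fun _ => |t|) ?_ tendsto_const_nhds ?_ ?_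
  · simpa using tendsto_const_nhds.sub h
  · intro n; exact sa_ge t
  · intro n; exact sa_le (by positivity) t

lemma sa_RC {δ : ℝ} (hδ : 0 < δ) (H : RC f g) :
    RC (fun r => sa δ (f r)) (fun r => f r / √(f r ^2 + δ^2) * g r) where
  cont := (sa_cont hδ).comp_continuousOn H.cont
  der := by
    obtain ⟨s, hs, h1⟩ := H.der
    exact ⟨s, hs, fun r hr => (sa_deriv hδ (f r)).comp r (h1 r hr)⟩
  meas := by
    have : Continuous fun t : ℝ => t / √(t^2 + δ^2) := by
      refine continuous_id.div (by fun_prop) fun t => ?_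
      exact (Real.sqrt_pos.2 (by positivity)).ne'
    exact (this.comp_aestronglyMeasurable H.fmeas).mul H.meas
  iA := by
    have hc : Continuous fun t : ℝ => t / √(t^2 + δ^2) := by
      refine continuous_id.div (by fun_prop) fun t => ?_
      exact (Real.sqrt_pos.2 (by positivity)).ne'
    refine intOn_of_le H.iA ((((hc.comp_aestronglyMeasurable H.fmeas).mul H.meas).pow 2).mul id_meas) ?_
    intro r hr
    rw [abs_of_nonneg (by positivity), mul_pow]
    have := sa_deriv_le hδ (f r)
    have h2 : 0 ≤ g r ^ 2 * r := by positivity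
    nlinarith [mul_le_mul_of_nonneg_right this h2]
  iB := by
    refine intOn_of_le H.iB ((((sa_cont hδ).comp_aestronglyMeasurable H.fmeas).pow 2).mul id_meas) ?_
    intro r hr
    rw [abs_of_nonneg (by positivity), ← sq_abs (f r)]
    gcongr
    · exact sa_nonneg hδ _
    · exact sa_le hδ _
  iD := by
    refine intOn_of_le H.iD ((((sa_cont hδ).comp_aestronglyMeasurable H.fmeas).pow 4).mul id_meas) ?_
    intro r hr
    have h4 : f r ^ 4 = |f r| ^ 4 := (Even.pow_abs (by decide) _).symm
    rw [abs_of_nonneg (by positivity), h4]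
    gcongr
    · exact sa_nonneg hδ _
    · exact sa_le hδ _

lemma sa_N {δ : ℝ} (hδ : 0 < δ) (H : RC f g) :
    N (fun r => sa δ (f r)) (fun r => f r / √(f r ^2 + δ^2) * g r) ≤ N f g := by
  have H' := sa_RC hδ H
  simp only [N]
  apply add_le_add
  · apply setIntegral_mono_on H'.iA H.iA measurableSet_Ioi
    intro r hr
    have hr : 0 < r := hr
    rw [mul_pow]
    have := sa_deriv_le hδ (f r)
    have h2 : 0 ≤ g r ^ 2 * r := by positivity
    nlinarith [mul_le_mul_of_nonneg_right this h2]
  · apply setIntegral_mono_on H'.iB H.iB measurableSet_Ioi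
    intro r hr
    have hr : 0 < r := hr
    rw [← sq_abs (f r)]
    gcongr
    · exact sa_nonneg hδ _
    · exact sa_le hδ _

theorem D_le_KK (H : RC f g) : D f ≤ KK * N f g ^ 2 := by
  have hlim : Tendsto (fun n : ℕ => D (fun r => sa (1/((n:ℝ)+1)) (f r))) atTop (𝓝 (D f)) := by
    refine tendsto_integral_of_dominated_convergence (fun r => f r ^ 4 * r)
      (fun n => (sa_RC (by positivity) H).iD.aestronglyMeasurable) H.iD ?_ ?_
    · intro n
      filter_upwards [ae_restrict_mem measurableSet_Ioi] with r hr
      have hr : 0 < r := hr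
      have hδ : (0:ℝ) < 1/((n:ℝ)+1) := by positivity
      have h4 : f r ^ 4 = |f r| ^ 4 := (Even.pow_abs (by decide) _).symm
      rw [Real.norm_eq_abs, abs_of_nonneg (by positivity), h4]
      gcongr
      · exact sa_nonneg hδ _
      · exact sa_le hδ _
    · refine ae_of_all _ fun r => ?_
      have h4 : f r ^ 4 = |f r| ^ 4 := (Even.pow_abs (by decide) _).symm
      rw [h4]
      exact ((sa_tendsto (f r)).pow 4).mul_const r
  apply le_of_tendsto' hlim
  intro n
  have hδ : (0:ℝ) < 1/((n:ℝ)+1) := by positivity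
  refine (D_le_nonneg (sa_RC hδ H) (fun r _ => sa_nonneg hδ _)).trans ?_
  have := KK_nonneg
  have h1 := sa_N hδ H
  have h2 := N_nonneg (fun r => sa (1/((n:ℝ)+1)) (f r)) (fun r => f r / √(f r ^2 + (1/((n:ℝ)+1))^2) * g r)
  gcongr

lemma KK_pos : 0 < KK := by
  have H := lc_RC one_pos one_lt_two
  have h := H.D_le_KK
  have hD : 0 < D (lc 1 2) := by
    have h1 : ∫ r in Ioc (0:ℝ) 1, r ≤ D (lc 1 2) := by
      calc ∫ r in Ioc (0:ℝ) 1, r = ∫ r in Ioc (0:ℝ) 1, lc 1 2 r ^ 4 * r := by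
            apply setIntegral_congr_fun measurableSet_Ioc
            intro r hr
            simp [lc_of_le one_pos one_lt_two hr.1 hr.2]
        _ ≤ _ := by
            refine setIntegral_mono_set H.iD ?_ (ae_of_all _ fun r hr => hr.1)
            filter_upwards [ae_restrict_mem measurableSet_Ioi] with r hr
            have hr : 0 < r := hr
            simp only [Pi.zero_apply]; positivity
    rw [← intervalIntegral.integral_of_le zero_le_one, integral_id] at h1
    norm_num at h1
    linarith
  by_contra hc
  have : KK = 0 := le_antisymm (not_lt.1 hc) KK_nonneg
  rw [this] at h
  linarith

end RC


section Fatou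
open Set Topology

lemma fatou_helper {X : Type*} [MeasurableSpace X] {μ : Measure X} {F : ℕ → X → ℝ} {h : X → ℝ} {C : ℕ → ℝ} {c : ℝ}
    (hi : ∀ n, Integrable (F n) μ) (h0 : ∀ n, ∀ᵐ x ∂μ, 0 ≤ F n x) (hC : ∀ n, ∫ x, F n x ∂μ ≤ C n)
    (hc : Tendsto C atTop (𝓝 c))
    (hl : ∀ᵐ x ∂μ, Tendsto (fun n => F n x) atTop (𝓝 (h x))) :
    Integrable h μ ∧ ∫ x, h x ∂μ ≤ c := by
  have hm : AEStronglyMeasurable h μ := aestronglyMeasurable_of_tendsto_ae atTop (fun n => (hi n).aestronglyMeasurable) hl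
  have hn : 0 ≤ᵐ[μ] h := by
    have := ae_all_iff.2 h0
    filter_upwards [this, hl] with x hx hx2
    exact ge_of_tendsto' hx2 hx
  have hc0 : 0 ≤ c := ge_of_tendsto' hc fun n => (integral_nonneg_of_ae (h0 n)).trans (hC n)
  have key : ∫⁻ x, ENNReal.ofReal (h x) ∂μ ≤ ENNReal.ofReal c := by
    calc ∫⁻ x, ENNReal.ofReal (h x) ∂μ = ∫⁻ x, liminf (fun n => ENNReal.ofReal (F n x)) atTop ∂μ := by
          apply lintegral_congr_ae
          filter_upwards [hl] with x hx
          exact ((ENNReal.continuous_ofReal.tendsto _).comp hx).liminf_eq.symm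
      _ ≤ liminf (fun n => ∫⁻ x, ENNReal.ofReal (F n x) ∂μ) atTop :=
          lintegral_liminf_le' fun n => (hi n).aestronglyMeasurable.aemeasurable.ennreal_ofReal
      _ ≤ liminf (fun n => ENNReal.ofReal (C n)) atTop := by
          refine liminf_le_liminf (Eventually.of_forall fun n => ?_)
          show ∫⁻ x, ENNReal.ofReal (F n x) ∂μ ≤ ENNReal.ofReal (C n)
          rw [← ofReal_integral_eq_lintegral_ofReal (hi n) (h0 n)]
          exact ENNReal.ofReal_le_ofReal (hC n)
      _ = ENNReal.ofReal c := ((ENNReal.continuous_ofReal.tendsto _).comp hc).liminf_eq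
  have hintg : Integrable h μ := by
    rw [← lintegral_ofReal_ne_top_iff_integrable hm hn]
    exact (key.trans_lt ENNReal.ofReal_lt_top).ne
  refine ⟨hintg, ?_⟩
  rw [← ofReal_integral_eq_lintegral_ofReal hintg hn] at key
  exact (ENNReal.ofReal_le_ofReal_iff hc0).1 key

end Fatou

namespace RC
open Set Topology

lemma seq_limit (F : ℕ → ℝ → ℝ) (G : ℕ → ℝ → ℝ) (H : ∀ n, RC (F n) (G n))
    (h0 : ∀ n r, 0 < r → 0 ≤ F n r) (hN : ∀ n, N (F n) (G n) ≤ 1) :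
    ∃ (k : ℕ → ℕ) (f : ℝ → ℝ), StrictMono k ∧ ∀ r, 0 < r → Tendsto (fun n => F (k n) r) atTop (𝓝 (f r)) := by
  have hcpt : IsCompact (Set.pi univ (fun q : ℚ => Icc (0:ℝ) (1 + 1 / Real.exp q))) :=
    isCompact_univ_pi fun q => isCompact_Icc
  have hmem : ∀ n, (fun q : ℚ => F n (Real.exp q)) ∈ Set.pi univ (fun q : ℚ => Icc (0:ℝ) (1 + 1 / Real.exp q)) := by
    intro n q _
    refine ⟨h0 n _ (Real.exp_pos _), ?_⟩
    have := (H n).decay (hN n) (Real.exp_pos q)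
    nlinarith [sq_nonneg (F n (Real.exp q) - 1)]
  obtain ⟨a, -, k, hk, hlim⟩ := hcpt.tendsto_subseq hmem
  have hlimq : ∀ q : ℚ, Tendsto (fun n => F (k n) (Real.exp q)) atTop (𝓝 (a q)) := fun q =>
    (tendsto_pi_nhds.1 hlim q)
  have hex : ∀ r, 0 < r → ∃ l, Tendsto (fun n => F (k n) r) atTop (𝓝 l) := by
    intro r hr
    apply cauchySeq_tendsto_of_complete
    rw [Metric.cauchySeq_iff']
    intro ε hε
    obtain ⟨q, hq1, hq2⟩ := exists_rat_btwn (show Real.log r < Real.log r + (ε/4)^2 by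
      have : 0 < (ε/4)^2 := by positivity
      linarith)
    have hrq : r ≤ Real.exp q := by
      rw [← Real.log_le_iff_le_exp hr]; exact hq1.le
    have hb : ∀ n, |F n (Real.exp q) - F n r| ≤ ε/4 := by
      intro n
      refine ((H n).holder (hN n) hr hrq).trans ?_
      rw [Real.log_exp, Real.sqrt_le_left (by positivity)]
      linarith
    have hc := (hlimq q).cauchySeq
    rw [Metric.cauchySeq_iff'] at hc
    obtain ⟨M, hM⟩ := hc (ε/4) (by positivity)
    refine ⟨M, fun n hn => ?_⟩
    have h1 := hM n hn
    rw [Real.dist_eq] at h1 ⊢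
    have h2 := abs_le.1 (hb (k n))
    have h3 := abs_le.1 (hb (k M))
    have h4 := abs_lt.1 h1
    rw [abs_lt]
    constructor <;> linarith
  choose! f hf using hex
  exact ⟨k, f, hk, hf⟩

/-- existence of an extremal profile together with its Euler-Lagrange equation -/
theorem extremal : ∃ f : ℝ → ℝ, (∀ r, 0 < r → 0 ≤ f r) ∧
    (∀ x y, 0 < x → x ≤ y → |f y - f x| ≤ √(Real.log y - Real.log x)) ∧
    (∀ r, 0 < r → f r ^ 4 * r ≤ 72) ∧
    IntegrableOn (fun r => f r ^ 2 * r) (Ioi 0) ∧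
    (∃ r, 0 < r ∧ f r ≠ 0) ∧ D f ≤ KK ∧
    ∀ x y, 0 < x → x < y → ∫ r in Ioc 0 y, f r ^ 3 * lc x y r * r =
      KK * (-((f y - f x) / (Real.log y - Real.log x)) + ∫ r in Ioc 0 y, f r * lc x y r * r) := by
  have hne : KS.Nonempty := by
    have H := (lc_RC one_pos one_lt_two).smul 0
    exact ⟨_, _, _, H, (fun r _ => by simp), (by rw [N_smul]; simp), rfl⟩
  obtain ⟨d, -, hdlim, hdm⟩ := exists_seq_tendsto_sSup hne KS_bdd
  choose F0 G0 H0 h00 hN0 hD0 using hdm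
  obtain ⟨k, f, hk, hf⟩ := seq_limit F0 G0 H0 h00 hN0
  set F := fun n => F0 (k n) with hF
  set G := fun n => G0 (k n) with hG
  have H : ∀ n, RC (F n) (G n) := fun n => H0 (k n)
  have h0 : ∀ n r, 0 < r → 0 ≤ F n r := fun n => h00 (k n)
  have hN : ∀ n, N (F n) (G n) ≤ 1 := fun n => hN0 (k n)
  have hD : Tendsto (fun n => D (F n)) atTop (𝓝 KK) := by
    have := hdlim.comp hk.tendsto_atTop
    refine this.congr fun n => ?_
    simp [hD0, hF]
  have hf : ∀ r, 0 < r → Tendsto (fun n => F n r) atTop (𝓝 (f r)) := hf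
  clear_value F G
  have hfae : ∀ᵐ r ∂(volume.restrict (Ioi (0:ℝ))), Tendsto (fun n => F n r) atTop (𝓝 (f r)) := by
    filter_upwards [ae_restrict_mem measurableSet_Ioi] with r hr using hf r hr
  have hfm : AEStronglyMeasurable f (volume.restrict (Ioi 0)) :=
    aestronglyMeasurable_of_tendsto_ae atTop (fun n => (H n).fmeas) hfae
  have hf0 : ∀ r, 0 < r → 0 ≤ f r := fun r hr => ge_of_tendsto' (hf r hr) (fun n => h0 n r hr)
  have hfb : ∀ r, 0 < r → f r ^ 4 * r ≤ 72 := fun r hr =>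
    le_of_tendsto' (((hf r hr).pow 4).mul_const r) (fun n => (H n).sharp_bound (hN n) hr)
  have hhol : ∀ x y, 0 < x → x ≤ y → |f y - f x| ≤ √(Real.log y - Real.log x) := fun x y hx hxy =>
    le_of_tendsto' ((hf y (hx.trans_le hxy)).sub (hf x hx)).abs (fun n => (H n).holder (hN n) hx hxy)
  have hdom : ∀ (j : ℕ) (w : ℝ → ℝ) (y : ℝ), j ≤ 4 → ContinuousOn w (Ioi 0) → (∀ r, |w r| ≤ 1) →
      Tendsto (fun n => ∫ r in Ioc 0 y, F n r ^ j * w r * r) atTop (𝓝 (∫ r in Ioc 0 y, f r ^ j * w r * r)) := by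
    intro j w y hj hw hw1
    have hwm := hw.aestronglyMeasurable (μ := volume) measurableSet_Ioi
    refine tendsto_integral_of_dominated_convergence (fun _ => |y| + 72) ?_ (by simp) ?_ ?_
    · intro n
      exact ((((H n).fmeas.pow j).mul hwm).mul id_meas).mono_measure (Measure.restrict_mono Ioc_subset_Ioi_self le_rfl)
    · intro n
      filter_upwards [ae_restrict_mem measurableSet_Ioc] with r hr
      have hr0 : 0 < r := hr.1
      have hFn := h0 n r hr0
      have h4 := (H n).sharp_bound (hN n) hr0
      rw [Real.norm_eq_abs, abs_mul, abs_mul, abs_of_pos hr0, abs_of_nonneg (pow_nonneg hFn j)]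
      have hpow : F n r ^ j ≤ 1 + F n r ^ 4 := by
        rcases le_total (F n r) 1 with h | h
        · have := pow_le_one₀ hFn h (n := j)
          have : 0 ≤ F n r ^ 4 := by positivity
          linarith
        · have := pow_le_pow_right₀ h hj
          linarith
      calc F n r ^ j * |w r| * r ≤ (1 + F n r ^ 4) * 1 * r := by
            gcongr
            exact hw1 r
        _ = r + F n r ^ 4 * r := by ring
        _ ≤ |y| + 72 := by
            have := hr.2.trans (le_abs_self y)
            linarith
    · filter_upwards [ae_restrict_mem measurableSet_Ioc] with r hr
      exact (((hf r hr.1).pow j).mul_const _).mul_const _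
  have hB := fatou_helper (μ := volume.restrict (Ioi 0)) (F := fun n r => F n r ^ 2 * r) (h := fun r => f r ^ 2 * r)
    (C := fun _ => 1) (c := 1) (fun n => (H n).iB) (fun n => by
      filter_upwards [ae_restrict_mem measurableSet_Ioi] with r hr
      have hr : 0 < r := hr
      positivity) (fun n => by
      have h1 := hN n
      have h2 := A_nonneg (G n)
      simp only [N] at h1
      linarith) tendsto_const_nhds (by
      filter_upwards [hfae] with r hr using (hr.pow 2).mul_const r)
  have hDf := fatou_helper (μ := volume.restrict (Ioi 0)) (F := fun n r => F n r ^ 4 * r) (h := fun r => f r ^ 4 * r)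
    (C := fun n => D (F n)) (c := KK) (fun n => (H n).iD) (fun n => by
      filter_upwards [ae_restrict_mem measurableSet_Ioi] with r hr
      have hr : 0 < r := hr
      positivity) (fun n => le_rfl) hD (by
      filter_upwards [hfae] with r hr using (hr.pow 4).mul_const r)
  have hKpos := KK_pos
  refine ⟨f, hf0, hhol, hfb, hB.1, ?_, hDf.2, ?_⟩
  · by_contra hcon
    push Not at hcon
    have hx : 0 < 2 / KK := by positivity
    have hl := hdom 4 (fun _ => 1) (2/KK) le_rfl continuousOn_const (by simp)
    have hz : ∫ r in Ioc 0 (2/KK), f r ^ 4 * 1 * r = 0 := by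
      rw [setIntegral_congr_fun (g := fun _ => (0:ℝ)) measurableSet_Ioc (fun r hr => by simp [hcon r hr.1])]
      simp
    simp only [mul_one] at hl hz
    rw [hz] at hl
    have h1 : KK ≤ 0 + 1 / (2/KK) := by
      refine le_of_tendsto_of_tendsto' hD (hl.add_const (1/(2/KK))) ?_
      intro n
      rw [(H n).D_split hx]
      have := (H n).tail (hN n) hx
      linarith
    have : 1 / (2/KK) = KK / 2 := by field_simp
    linarith
  · intro x y hx hxy
    have K := lc_RC hx hxy
    set L := Real.log y - Real.log x with hL
    have hlc : ∀ r, |lc x y r| ≤ 1 := fun r => by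
      rw [abs_of_nonneg (lc_nonneg _ _ _)]; exact lc_le_one _ _ _
    have cut : ∀ (j : ℕ) (n : ℕ), ∫ r in Ioi 0, F n r ^ j * lc x y r * r = ∫ r in Ioc 0 y, F n r ^ j * lc x y r * r := by
      intro j n
      apply setIntegral_eq_of_subset_of_forall_sdiff_eq_zero measurableSet_Ioi Ioc_subset_Ioi_self
      intro r hr
      have : y < r := by
        have h1 : 0 < r := hr.1
        by_contra hh
        exact hr.2 ⟨h1, not_lt.1 hh⟩
      rw [lc_of_ge hx hxy this.le]; simp
    have hI := hdom 3 (lc x y) y (by norm_num) (lc_cont x y) hlc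
    have hl1 := hdom 1 (lc x y) y (by norm_num) (lc_cont x y) hlc
    simp only [pow_one] at hl1
    set I := ∫ r in Ioc 0 y, f r ^ 3 * lc x y r * r with hIdef
    set ℓ := -((f y - f x) / L) + ∫ r in Ioc 0 y, f r * lc x y r * r with hℓ
    have hℓn : Tendsto (fun n => -((F n y - F n x) / L) + ∫ r in Ioc 0 y, F n r * lc x y r * r) atTop (𝓝 ℓ) :=
      ((((hf y (hx.trans hxy)).sub (hf x hx)).div_const L).neg).add hl1
    have main : ∀ ε : ℝ, KK + 4 * ε * I ≤ KK * (1 + 2 * ε * ℓ + ε^2 * N (lc x y) (lcd x y))^2 := by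
      intro ε
      refine le_of_tendsto_of_tendsto' (hD.add (hI.const_mul (4*ε)))
        ((((tendsto_const_nhds (x := (1:ℝ))).add (hℓn.const_mul (2*ε))).add_const (ε^2 * N (lc x y) (lcd x y))).pow 2 |>.const_mul KK) ?_
      intro n
      have R := (H n).add_smul K ε
      have h1 := R.D_le_KK
      have h2 := N_nonneg (fun r => F n r + ε * lc x y r) (fun r => G n r + ε * lcd x y r)
      have i3 : IntegrableOn (fun r => F n r ^ 3 * lc x y r * r) (Ioi 0) := by
        refine intOn_of_le ((H n).iD.add K.iD) ((((H n).fmeas.pow 3).mul K.fmeas).mul id_meas) ?_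
        intro r hr
        have a := h0 n r hr
        have b := lc_nonneg x y r
        simp only [Pi.add_apply]
        rw [abs_of_nonneg (by positivity), ← add_mul]
        gcongr
        rcases le_total (F n r) (lc x y r) with h | h
        · have : F n r ^ 3 * lc x y r ≤ lc x y r ^ 3 * lc x y r := by gcongr
          have : 0 ≤ F n r ^ 4 := by positivity
          nlinarith
        · have : F n r ^ 3 * lc x y r ≤ F n r ^ 3 * F n r := by gcongr
          have : 0 ≤ lc x y r ^ 4 := by positivity
          nlinarith
      have h3 : D (F n) + 4 * ε * (∫ r in Ioi 0, F n r ^ 3 * lc x y r * r) ≤ D (fun r => F n r + ε * lc x y r) := by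
        simp only [D]
        rw [← integral_const_mul, ← integral_add (H n).iD (i3.const_mul _)]
        apply setIntegral_mono_on ((H n).iD.add (i3.const_mul _)) R.iD measurableSet_Ioi
        intro r hr
        have hr : 0 < r := hr
        simp only [Pi.add_apply]
        have : F n r ^ 4 + 4 * ε * (F n r ^ 3 * lc x y r) ≤ (F n r + ε * lc x y r)^4 := by
          set a := F n r
          set b := ε * lc x y r with hb
          have e : (a + b)^4 - (a^4 + 4 * (a^3 * b)) = b^2 * (2 * a^2 + (2*a+b)^2) := by ring
          have : 0 ≤ b^2 * (2 * a^2 + (2*a+b)^2) := by positivity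
          have e2 : 4 * ε * (a^3 * lc x y r) = 4 * (a^3 * b) := by rw [hb]; ring
          rw [e2]; linarith
        nlinarith
      rw [N_add (H n) K, (H n).inner_lcd hx hxy, ] at h1 h2
      have e1 := cut 1 n
      simp only [pow_one] at e1
      rw [cut 3 n] at h3
      rw [e1] at h1 h2
      refine h3.trans (h1.trans ?_)
      apply mul_le_mul_of_nonneg_left _ hKpos.le
      apply pow_le_pow_left₀ h2
      have := hN n
      linarith
    have hmin : IsLocalMin (fun ε : ℝ => KK * (1 + 2 * ε * ℓ + ε^2 * N (lc x y) (lcd x y))^2 - 4 * ε * I) 0 := by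
      refine Eventually.of_forall fun ε => ?_
      have := main ε
      simp only
      norm_num
      linarith
    have hder : HasDerivAt (fun ε : ℝ => KK * (1 + 2 * ε * ℓ + ε^2 * N (lc x y) (lcd x y))^2 - 4 * ε * I)
        (4 * KK * ℓ - 4 * I) 0 := by
      have hid := hasDerivAt_id (0:ℝ)
      have := ((((((hid.const_mul 2).mul_const ℓ).const_add 1).add ((hid.pow 2).mul_const (N (lc x y) (lcd x y)))).pow 2).const_mul KK).sub
        ((hid.const_mul 4).mul_const I)
      refine this.congr_deriv ?_
      simp
      ring
    have := hmin.hasDerivAt_eq_zero hder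
    linarith

end RC


namespace RC
open Set Topology

theorem extremal_radSol : ∃ f du α, RadSol (fun r => √(1/KK) * f r) du α ∧ D f ≤ KK := by
  obtain ⟨f, hf0, hhol, hfb, hB, ⟨r0, hr0, hr0'⟩, hD, hEL⟩ := extremal
  have hK := KK_pos
  set k := 1 / KK with hk
  have hkpos : 0 < k := by positivity
  have hlogc : ∀ r : ℝ, 0 < r → ContinuousAt Real.log r := fun r hr => Real.continuousAt_log hr.ne'
  have hfc : ContinuousOn f (Ioi 0) := by
    intro x hx
    have hx : 0 < x := hx
    apply ContinuousAt.continuousWithinAt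
    have hb : ∀ᶠ y in 𝓝 x, |f y - f x| ≤ √|Real.log y - Real.log x| := by
      filter_upwards [Ioi_mem_nhds hx] with y hy
      have hy : 0 < y := hy
      rcases le_total x y with h | h
      · exact (hhol x y hx h).trans (Real.sqrt_le_sqrt (le_abs_self _))
      · rw [abs_sub_comm, abs_sub_comm (Real.log y)]
        exact (hhol y x hy h).trans (Real.sqrt_le_sqrt (le_abs_self _))
    have hl : Tendsto (fun y => √|Real.log y - Real.log x|) (𝓝 x) (𝓝 0) := by
      have : Tendsto (fun y => √|Real.log y - Real.log x|) (𝓝 x) (𝓝 √|Real.log x - Real.log x|) :=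
        (((hlogc x hx).tendsto.sub_const _).abs).sqrt
      simpa using this
    have := squeeze_zero_norm' (f := fun y => f y - f x) hb hl
    have h2 := this.add_const (f x)
    simp only [sub_add_cancel, zero_add] at h2
    exact h2
  set w := fun r => (f r - k * f r ^ 3) * r with hw
  have hwc : ContinuousOn w (Ioi 0) := (hfc.sub ((hfc.pow 3).const_mul k)).mul continuousOn_id
  have hwb : ∀ y r, 0 < r → r ≤ y → |w r| ≤ (1 + k) * (y + 72) := by
    intro y r hr hry
    have h4 := hfb r hr
    have a := hf0 r hr
    have h1 : f r ≤ 1 + f r ^ 4 := by nlinarith [sq_nonneg (f r ^ 2 - 1), sq_nonneg (f r - 1), sq_nonneg (f r ^ 2), sq_nonneg (f r)]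
    have h3 : f r ^ 3 ≤ 1 + f r ^ 4 := by
      rcases le_total (f r) 1 with h | h
      · have := pow_le_one₀ a h (n := 3)
        have : 0 ≤ f r ^ 4 := by positivity
        linarith
      · have := pow_le_pow_right₀ h (show 3 ≤ 4 by norm_num)
        linarith
    have h5 : |f r - k * f r ^ 3| ≤ (1 + k) * (1 + f r ^ 4) := by
      have h6 : 0 ≤ f r ^ 3 := by positivity
      have h7 : k * f r ^ 3 ≤ k * (1 + f r ^ 4) := by gcongr
      have h8 : 0 ≤ k * f r ^ 3 := by positivity
      have h9 : 0 ≤ k * (1 + f r ^ 4) := by positivity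
      rw [abs_le]; constructor <;> nlinarith
    simp only [hw]
    rw [abs_mul, abs_of_pos hr]
    calc _ ≤ (1 + k) * (1 + f r ^ 4) * r := by gcongr
      _ = (1 + k) * (r + f r ^ 4 * r) := by ring
      _ ≤ _ := by gcongr
  have hwm : AEStronglyMeasurable w (volume.restrict (Ioi 0)) := hwc.aestronglyMeasurable measurableSet_Ioi
  have hwi : ∀ y, IntegrableOn w (Ioc 0 y) := by
    intro y
    refine Integrable.mono' (g := fun _ => (1 + k) * (y + 72)) (integrable_const _) (hwm.mono_measure (Measure.restrict_mono Ioc_subset_Ioi_self le_rfl)) ?_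
    filter_upwards [ae_restrict_mem measurableSet_Ioc] with r hr
    exact hwb y r hr.1 hr.2
  set Φ := fun r => ∫ s in Ioc 0 r, w s with hΦ
  have hsplit : ∀ x y, 0 < x → x < y → Φ y = Φ x + ∫ s in Ioc x y, w s := by
    intro x y hx hxy
    simp only [hΦ]
    rw [← setIntegral_union (Ioc_disjoint_Ioc_of_le le_rfl) measurableSet_Ioc ((hwi y).mono_set (Ioc_subset_Ioc_right hxy.le)) ((hwi y).mono_set (Ioc_subset_Ioc_left hx.le)),
      Ioc_union_Ioc_eq_Ioc hx.le hxy.le]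
  have hsm : ∀ (g : ℝ → ℝ) x y M, 0 < x → x < y → (∀ r ∈ Ioc x y, |g r| ≤ M) → |∫ s in Ioc x y, g s| ≤ M * (y - x) := by
    intro g x y M hx hxy hg
    have := norm_setIntegral_le_of_norm_le_const (μ := volume) (s := Ioc x y) (f := g) (C := M) (by simp) hg
    simpa [measureReal_def, hxy.le] using this
  have hlc : ∀ x y r, |lc x y r| ≤ 1 := fun x y r => by
      rw [abs_of_nonneg (lc_nonneg _ _ _)]; exact lc_le_one _ _ _
  have hS : ∀ x y, 0 < x → x < y → |(f y - f x) / (Real.log y - Real.log x) - Φ x| ≤ (1 + k) * (y + 72) * (y - x) ∧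
      |(f y - f x) / (Real.log y - Real.log x) - Φ y| ≤ 2 * ((1 + k) * (y + 72)) * (y - x) := by
    intro x y hx hxy
    have hy := hx.trans hxy
    have hE := hEL x y hx hxy
    have hlcm := (lc_cont x y).aestronglyMeasurable (μ := volume) measurableSet_Ioi
    have ib : ∀ j : ℕ, j ≤ 4 → IntegrableOn (fun r => f r ^ j * lc x y r * r) (Ioc 0 y) := by
      intro j hj
      refine Integrable.mono' (g := fun _ => y + 72) (by simp) (((((hfc.pow j).mul (lc_cont x y)).mul continuousOn_id).mono Ioc_subset_Ioi_self).aestronglyMeasurable measurableSet_Ioc) ?_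
      filter_upwards [ae_restrict_mem measurableSet_Ioc] with r hr
      have hr0 : 0 < r := hr.1
      have a := hf0 r hr0
      have h4 := hfb r hr0
      rw [Real.norm_eq_abs, abs_mul, abs_mul, abs_of_pos hr0, abs_of_nonneg (pow_nonneg a j)]
      have hpow : f r ^ j ≤ 1 + f r ^ 4 := by
        rcases le_total (f r) 1 with h | h
        · have := pow_le_one₀ a h (n := j)
          have : 0 ≤ f r ^ 4 := by positivity
          linarith
        · have := pow_le_pow_right₀ h hj
          linarith
      calc f r ^ j * |lc x y r| * r ≤ (1 + f r ^ 4) * 1 * r := by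
            gcongr
            exact hlc _ _ r
        _ = r + f r ^ 4 * r := by ring
        _ ≤ y + 72 := by
            have := hr.2
            linarith
    have i1 := ib 1 (by norm_num)
    have i3 := ib 3 (by norm_num)
    simp only [pow_one] at i1
    have e1 : (f y - f x) / (Real.log y - Real.log x) = ∫ r in Ioc 0 y, w r * lc x y r := by
      have : ∫ r in Ioc 0 y, w r * lc x y r = (∫ r in Ioc 0 y, f r * lc x y r * r) - k * ∫ r in Ioc 0 y, f r ^ 3 * lc x y r * r := by
        rw [← integral_const_mul, ← integral_sub i1 (i3.const_mul k)]
        apply integral_congr_ae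
        refine Eventually.of_forall fun r => ?_
        simp only [hw]; ring
      rw [this, hE, ← mul_assoc, hk, one_div_mul_cancel hK.ne']
      ring
    have iw : IntegrableOn (fun r => w r * lc x y r) (Ioc 0 y) := by
      refine Integrable.congr (i1.sub (i3.const_mul k)) (Eventually.of_forall fun r => ?_)
      simp only [hw, Pi.sub_apply]; ring
    have e2 : ∫ r in Ioc 0 y, w r * lc x y r = Φ x + ∫ r in Ioc x y, w r * lc x y r := by
      rw [← Ioc_union_Ioc_eq_Ioc hx.le hxy.le, setIntegral_union (Ioc_disjoint_Ioc_of_le le_rfl) measurableSet_Ioc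
        (iw.mono_set (Ioc_subset_Ioc_right hxy.le)) (iw.mono_set (Ioc_subset_Ioc_left hx.le))]
      congr 1
      apply setIntegral_congr_fun measurableSet_Ioc
      intro r hr
      simp only
      rw [lc_of_le hx hxy hr.1 hr.2, mul_one]
    have b1 := hsm (fun r => w r * lc x y r) x y ((1 + k) * (y + 72)) hx hxy (fun r hr => by
      rw [abs_mul]
      calc _ ≤ |w r| * 1 := by gcongr; exact hlc _ _ _
        _ ≤ _ := by rw [mul_one]; exact hwb y r (hx.trans hr.1) hr.2)
    have b2 := hsm w x y ((1 + k) * (y + 72)) hx hxy (fun r hr => hwb y r (hx.trans hr.1) hr.2)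
    have e3 := hsplit x y hx hxy
    rw [e1, e2]
    constructor
    · rw [add_sub_cancel_left]; exact b1
    · rw [e3, add_sub_add_left_eq_sub]
      refine (abs_sub _ _).trans ?_
      linarith
  have hd1 : ∀ r, 0 < r → HasDerivAt f (Φ r / r) r := by
    intro r hr
    rw [hasDerivAt_iff_tendsto_slope]
    have hl := hasDerivAt_iff_tendsto_slope.1 (Real.hasDerivAt_log hr.ne')
    have hq : Tendsto (fun s => (f s - f r) / (Real.log s - Real.log r)) (𝓝[≠] r) (𝓝 (Φ r)) := by
      have hb : ∀ᶠ s in 𝓝[≠] r, ‖(f s - f r) / (Real.log s - Real.log r) - Φ r‖ ≤ 2 * ((1 + k) * (r + 1 + 72)) * |s - r| := by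
        have : Ioo 0 (r+1) ∈ 𝓝 r := Ioo_mem_nhds hr (by linarith)
        filter_upwards [nhdsWithin_le_nhds this, self_mem_nhdsWithin] with s hs hsr
        rw [Real.norm_eq_abs]
        have hs1 := hs.1
        have hs2 := hs.2
        rcases lt_or_gt_of_ne (show s ≠ r from hsr) with h | h
        · have := (hS s r hs.1 h).2
          rw [abs_sub_comm s r, abs_of_pos (sub_pos.2 h)]
          rw [← neg_sub (f r), ← neg_sub (Real.log r), neg_div_neg_eq]
          refine this.trans ?_
          have : 0 < r - s := sub_pos.2 h
          gcongr
          linarith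
        · have := (hS r s hr h).1
          rw [abs_of_pos (sub_pos.2 h)]
          refine this.trans ?_
          have : 0 < s - r := sub_pos.2 h
          refine mul_le_mul_of_nonneg_right ?_ this.le
          have : 0 ≤ (1 + k) * (r + 1 + 72) := by positivity
          calc (1 + k) * (s + 72) ≤ (1 + k) * (r + 1 + 72) := by gcongr
            _ ≤ _ := by linarith
      have hl0 : Tendsto (fun s => 2 * ((1 + k) * (r + 1 + 72)) * |s - r|) (𝓝[≠] r) (𝓝 0) := by
        have : Tendsto (fun s => 2 * ((1 + k) * (r + 1 + 72)) * |s - r|) (𝓝 r) (𝓝 (2 * ((1 + k) * (r + 1 + 72)) * |r - r|)) :=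
          Continuous.tendsto (by fun_prop) r
        simp only [sub_self, abs_zero, mul_zero] at this
        exact this.mono_left nhdsWithin_le_nhds
      have := (squeeze_zero_norm' hb hl0).add_const (Φ r)
      simpa using this
    have := hq.mul hl
    rw [div_eq_mul_inv]
    refine this.congr' ?_
    have : Ioi 0 ∈ 𝓝 r := Ioi_mem_nhds hr
    filter_upwards [nhdsWithin_le_nhds this, self_mem_nhdsWithin] with s hs hsr
    have h1 : Real.log s - Real.log r ≠ 0 := by
      intro h
      exact hsr (Real.log_injOn_pos hs hr (sub_eq_zero.1 h))
    rw [slope_def_field, slope_def_field]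
    field_simp
  have hΦd : ∀ r, 0 < r → HasDerivAt Φ (w r) r := by
    intro r hr
    have h1 : HasDerivAt (fun y => ∫ s in (0:ℝ)..y, w s) (w r) r := by
      apply intervalIntegral.integral_hasDerivAt_right
      · rw [intervalIntegrable_iff_integrableOn_Ioc_of_le hr.le]; exact hwi r
      · exact hwc.stronglyMeasurableAtFilter isOpen_Ioi r hr
      · exact hwc.continuousAt (Ioi_mem_nhds hr)
    refine h1.congr_of_eventuallyEq ?_
    filter_upwards [Ioi_mem_nhds hr] with y hy
    simp only [hΦ]
    rw [intervalIntegral.integral_of_le (le_of_lt hy)]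
  have hd2 : ∀ r, 0 < r → HasDerivAt (fun r => Φ r / r) (-(Φ r / r) / r + f r - k * f r ^ 3) r := by
    intro r hr
    refine ((hΦd r hr).div (hasDerivAt_id r) hr.ne').congr_deriv ?_
    have := hr.ne'
    simp only [hw, id]
    field_simp
    ring
  have hΦb : ∀ r M, 0 < r → (∀ s, 0 < s → s ≤ r → |w s| ≤ M) → |Φ r| ≤ M * r := by
    intro r M hr hM
    have := norm_setIntegral_le_of_norm_le_const (μ := volume) (s := Ioc 0 r) (f := w) (C := M) (by simp) (fun s hs => hM s hs.1 hs.2)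
    simpa [measureReal_def, hr.le] using this
  have hdb : ∀ r ∈ Ioo (0:ℝ) 1, |Φ r / r| ≤ (1 + k) * (1 + 72) := by
    intro r hr
    have hr0 : 0 < r := hr.1
    have := hΦb r ((1 + k) * (1 + 72)) hr.1 (fun s h1 h2 => hwb 1 s h1 (h2.trans hr.2.le))
    rw [abs_div, abs_of_pos hr0, div_le_iff₀ hr0]
    exact this
  have hlip : LipschitzOnWith (Real.toNNReal ((1 + k) * (1 + 72))) f (Ioo 0 1) := by
    apply (convex_Ioo 0 1).lipschitzOnWith_of_nnnorm_hasDerivWithin_le (f' := fun r => Φ r / r)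
    · intro r hr
      exact (hd1 r hr.1).hasDerivWithinAt
    · intro r hr
      rw [← NNReal.coe_le_coe, coe_nnnorm, Real.norm_eq_abs, Real.coe_toNNReal _ (by positivity)]
      exact hdb r hr
  obtain ⟨g, hg, hgf⟩ := hlip.extend_real
  have hlim : Tendsto f (𝓝[>] 0) (𝓝 (g 0)) := by
    have := (hg.continuous.tendsto 0).mono_left (nhdsWithin_le_nhds (s := Ioi 0))
    refine this.congr' ?_
    filter_upwards [Ioo_mem_nhdsGT (zero_lt_one' ℝ)] with r hr
    exact (hgf hr).symm
  have hdlim : Tendsto (fun r => Φ r / r) (𝓝[>] 0) (𝓝 0) := by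
    have hb1 : ∀ᶠ r in 𝓝[>] (0:ℝ), |f r - k * f r ^ 3| < |g 0 - k * g 0 ^ 3| + 1 := by
      have : Tendsto (fun r => |f r - k * f r ^ 3|) (𝓝[>] 0) (𝓝 |g 0 - k * g 0 ^ 3|) :=
        (hlim.sub ((hlim.pow 3).const_mul k)).abs
      exact this.eventually (gt_mem_nhds (by linarith))
    rw [eventually_nhdsWithin_iff] at hb1
    obtain ⟨δ, hδ, hb2⟩ := Metric.eventually_nhds_iff.1 hb1
    set c := |g 0 - k * g 0 ^ 3| + 1
    have hb3 : ∀ᶠ r in 𝓝[>] (0:ℝ), ‖Φ r / r‖ ≤ c * r := by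
      filter_upwards [Ioo_mem_nhdsGT hδ] with r hr
      have hr0 : 0 < r := hr.1
      rw [Real.norm_eq_abs, abs_div, abs_of_pos hr0, div_le_iff₀ hr0]
      apply hΦb r (c * r) hr0
      intro s hs hsr
      simp only [hw]
      rw [abs_mul, abs_of_pos hs]
      have := hb2 (y := s) (by rw [dist_zero_right, Real.norm_eq_abs, abs_of_pos hs]; linarith [hr.2]) hs
      gcongr
    apply squeeze_zero_norm' hb3
    have : Tendsto (fun r : ℝ => c * r) (𝓝 0) (𝓝 (c * 0)) := Continuous.tendsto (by fun_prop) 0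
    rw [mul_zero] at this
    exact this.mono_left nhdsWithin_le_nhds
  have hsk : 0 < √k := Real.sqrt_pos.2 hkpos
  have hsk3 : √k ^ 3 = √k * k := by
    rw [pow_succ', Real.sq_sqrt hkpos.le]
  have hq1 : ∀ r, 0 < r → HasDerivAt (fun r => √k * f r) (√k * (Φ r / r)) r := fun r hr => (hd1 r hr).const_mul _
  have hq2 : ∀ r, 0 < r → HasDerivAt (fun r => √k * (Φ r / r)) (-(√k * (Φ r / r)) / r + √k * f r - (√k * f r) ^ 3) r := by
    intro r hr
    refine ((hd2 r hr).const_mul √k).congr_deriv ?_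
    rw [mul_pow, hsk3]; ring
  refine ⟨f, fun r => √k * (Φ r / r), √k * g 0, ⟨?_, hq1, hq2, hlim.const_mul _, ?_, ?_⟩, hD⟩
  · intro t ht
    have a := hf0 t ht
    rcases a.lt_or_eq with h | h
    · positivity
    · exfalso
      have hmin : IsLocalMin f t := by
        filter_upwards [Ioi_mem_nhds ht] with y hy
        rw [← h]; exact hf0 y hy
      have hz := hmin.hasDerivAt_eq_zero (hd1 t ht)
      have := ode_eqOn hq1 hq2 (v := fun _ => 0) (dv := fun _ => 0) (fun r _ => hasDerivAt_const _ _)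
        (fun r _ => by simpa using hasDerivAt_const r (0:ℝ)) ht (by simp [← h]) (by simp [hz]) r0 hr0
      simp only [mul_eq_zero] at this
      exact this.elim (fun h => hsk.ne' h) hr0'
  · have := hdlim.const_mul √k
    simpa using this
  · refine IntegrableOn.congr_fun (hB.const_mul k) (fun r _ => ?_) measurableSet_Ioi
    show k * (f r ^ 2 * r) = (√k * f r) ^ 2 * r
    rw [mul_pow, Real.sq_sqrt hkpos.le]; ring

/-- the sharp radial inequality -/
theorem sharp {u du : ℝ → ℝ} {α : ℝ} (U : RadSol u du α) {f g : ℝ → ℝ} (H : RC f g) :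
    D f ≤ N f g ^ 2 / (2 * ∫ r in Ioi 0, u r ^ 2 * r) := by
  obtain ⟨f0, du0, α0, F, hD⟩ := extremal_radSol
  have hK := KK_pos
  have hm := U.m_pos
  have e := F.unique U
  have h1 : D f0 = KK ^ 2 * (2 * ∫ r in Ioi 0, u r ^ 2 * r) := by
    rw [← U.four_eq, D, ← integral_const_mul]
    apply setIntegral_congr_fun measurableSet_Ioi
    intro r hr
    have e := e r hr
    simp only at e ⊢
    rw [← e, mul_pow, show √(1/KK)^4 = (√(1/KK)^2)^2 by ring, Real.sq_sqrt (by positivity)]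
    field_simp
  rw [h1] at hD
  have h2 : KK * (2 * ∫ r in Ioi 0, u r ^ 2 * r) ≤ 1 := by
    by_contra hc
    push Not at hc
    nlinarith
  have h3 := H.D_le_KK
  rw [le_div_iff₀ (by positivity)]
  have h4 : 0 ≤ N f g ^ 2 := by positivity
  calc _ ≤ KK * N f g ^ 2 * (2 * ∫ r in Ioi 0, u r ^ 2 * r) := by gcongr
    _ = (KK * (2 * ∫ r in Ioi 0, u r ^ 2 * r)) * N f g ^ 2 := by ring
    _ ≤ 1 * N f g ^ 2 := by gcongr
    _ = _ := one_mul _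

end RC


namespace Sob
open Set Topology Metric

lemma polar (F : E2 → ℝ) (hF : Integrable F) :
    ∃ (ν : Measure (sphere (0:E2) 1)), IsFiniteMeasure ν ∧ ν.real univ = 2 * π ∧
      ∫ z, F z = ∫ w, (∫ r in Ioi (0:ℝ), F (r • (w:E2)) * r) ∂ν := by
  refine ⟨(volume : Measure E2).toSphere, inferInstance, ?_, ?_⟩
  · rw [Measure.toSphere_real_apply_univ]
    simp [measureReal_def, Real.pi_pos.le]
  · have h1 : ∫ z, F z = ∫ z : ({(0:E2)}ᶜ : Set E2), F z ∂((volume : Measure E2).comap (↑)) := by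
      rw [integral_subtype_comap (measurableSet_singleton _).compl, restrict_compl_singleton]
    have h2 := (volume : Measure E2).measurePreserving_homeomorphUnitSphereProd.integral_comp
        (Homeomorph.measurableEmbedding _) (fun q => F (q.2.1 • (q.1:E2)))
    have h3 : Integrable (fun q : sphere (0:E2) 1 × Ioi (0:ℝ) => F (q.2.1 • (q.1:E2)))
        ((volume : Measure E2).toSphere.prod (Measure.volumeIoiPow (Module.finrank ℝ E2 - 1))) := by
      rw [← (volume : Measure E2).measurePreserving_homeomorphUnitSphereProd.integrable_comp_emb (Homeomorph.measurableEmbedding _)]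
      have : (fun q : sphere (0:E2) 1 × Ioi (0:ℝ) => F (q.2.1 • (q.1:E2))) ∘ (homeomorphUnitSphereProd E2) = fun z => F z.1 := by
        funext z
        have hz : ‖(z:E2)‖ ≠ 0 := norm_ne_zero_iff.2 z.2
        simp [smul_smul, mul_inv_cancel₀ hz]
      rw [this]
      have := hF.integrableOn (s := {0}ᶜ)
      rw [integrableOn_iff_comap_subtypeVal (measurableSet_singleton _).compl] at this
      exact this
    rw [h1, show (fun z : ({(0:E2)}ᶜ : Set E2) => F z) = fun z => F ((homeomorphUnitSphereProd E2 z).2.1 • ((homeomorphUnitSphereProd E2 z).1 : E2)) from ?_, h2, integral_prod _ h3]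
    · congr 1
      funext w
      simp only [Measure.volumeIoiPow, ENNReal.ofReal]
      rw [integral_withDensity_eq_integral_smul,
        integral_subtype_comap measurableSet_Ioi fun a ↦ Real.toNNReal (a ^ (Module.finrank ℝ E2 - 1)) • F (a • (w:E2))]
      · apply setIntegral_congr_fun measurableSet_Ioi
        intro r hr
        simp only
        rw [NNReal.smul_def, Real.coe_toNNReal _ (pow_nonneg (le_of_lt hr) _)]
        simp [mul_comm]
      · exact (measurable_subtype_coe.pow_const _).real_toNNReal
    · funext z
      have hz : ‖(z:E2)‖ ≠ 0 := norm_ne_zero_iff.2 z.2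
      simp [smul_smul, mul_inv_cancel₀ hz]

lemma corr_deriv {a b : E2 → ℝ} (ha : Continuous a) (ha' : HasCompactSupport a) (hb : ContDiff ℝ 1 b)
    (hb' : HasCompactSupport b) (w : E2) (ρ : ℝ) :
    HasDerivAt (fun ρ => ∫ x, a x * b (x + ρ • w)) (∫ x, a x * fderiv ℝ b (x + ρ • w) w) ρ := by
  have hfc := hb.continuous_fderiv one_ne_zero
  obtain ⟨B, hB⟩ := hfc.bounded_above_of_compact_support (hb'.fderiv ℝ)
  have hai := ha.integrable_of_hasCompactSupport ha' (μ := volume)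
  refine (hasDerivAt_integral_of_dominated_loc_of_deriv_le (𝕜 := ℝ) (μ := (volume : Measure E2)) (F := fun ρ x => a x * b (x + ρ • w)) (F' := fun ρ x => a x * fderiv ℝ b (x + ρ • w) w) (s := univ) (bound := fun x => |a x| * (B * ‖w‖)) univ_mem
    (Eventually.of_forall fun r => ?_) ?_ ?_ ?_ (hai.abs.mul_const _) ?_).2
  · exact (ha.mul (hb.continuous.comp (by fun_prop))).aestronglyMeasurable
  · exact (ha.mul (hb.continuous.comp (by fun_prop))).integrable_of_hasCompactSupport ha'.mul_right
  · exact (ha.mul ((hfc.comp (by fun_prop)).clm_apply continuous_const)).aestronglyMeasurable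
  · refine Eventually.of_forall fun x r _ => ?_
    rw [norm_mul, Real.norm_eq_abs]
    gcongr
    exact ((fderiv ℝ b (x + r • w)).le_opNorm w).trans (by gcongr; exact hB _)
  · refine Eventually.of_forall fun x r _ => ?_
    have h1 : HasDerivAt (fun r : ℝ => x + r • w) w r := by
      simpa using ((hasDerivAt_id r).smul_const w).const_add x
    have h2 := (hb.differentiable one_ne_zero (x + r • w)).hasFDerivAt.comp_hasDerivAt r h1
    exact h2.const_mul (a x)

lemma corr_cont {a b : E2 → ℝ} (ha : Continuous a) (ha' : HasCompactSupport a) (hb : Continuous b)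
    (hb' : HasCompactSupport b) (w : E2) : Continuous (fun ρ : ℝ => ∫ x, a x * b (x + ρ • w)) := by
  obtain ⟨B, hB⟩ := hb.bounded_above_of_compact_support hb'
  have hai := ha.integrable_of_hasCompactSupport ha' (μ := volume)
  refine continuous_of_dominated (bound := fun x => |a x| * B) (fun r => ?_) (fun r => ?_) (hai.abs.mul_const _) ?_
  · exact (ha.mul (hb.comp (by fun_prop))).aestronglyMeasurable
  · refine Eventually.of_forall fun x => ?_
    rw [norm_mul, Real.norm_eq_abs]
    gcongr
    exact hB _
  · refine Eventually.of_forall fun x => ?_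
    exact continuous_const.mul (hb.comp (by fun_prop))

lemma corr_zero {a b : E2 → ℝ} {R : ℝ} (ha : ∀ x, R < ‖x‖ → a x = 0) (hb : ∀ x, R < ‖x‖ → b x = 0)
    {w : E2} (hw : ‖w‖ = 1) {ρ : ℝ} (hρ : 2 * R < ρ) (hR : 0 ≤ R): ∫ x, a x * b (x + ρ • w) = 0 := by
  have : ∀ x, a x * b (x + ρ • w) = 0 := by
    intro x
    by_cases h : R < ‖x‖
    · simp [ha x h]
    · have : R < ‖x + ρ • w‖ := by
        have h1 : ‖ρ • w‖ ≤ ‖x + ρ • w‖ + ‖x‖ := by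
          have := norm_sub_le (x + ρ • w) x
          simpa using this
        rw [norm_smul, hw, mul_one, Real.norm_eq_abs, abs_of_pos (by linarith)] at h1
        linarith
      simp [hb _ this]
  simp [this]

lemma radial_id {g : E2 → ℝ} (hg : ContDiff ℝ 1 g) (hc : HasCompactSupport g) {w : E2} (hw : ‖w‖ = 1) :
    ∫ ρ in Ioi (0:ℝ), (∫ x, fderiv ℝ g x w * fderiv ℝ g (x + ρ • w) w) * ρ = - ∫ x, g x ^ 2 := by
  obtain ⟨R, hR⟩ := hc.isCompact.isBounded.subset_closedBall 0
  have hgz : ∀ x, |R| < ‖x‖ → x ∉ tsupport g := by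
    intro x hx h
    have := hR h
    rw [mem_closedBall_zero_iff] at this
    linarith [le_abs_self R]
  have hfc := hg.continuous_fderiv one_ne_zero
  have hg0 : ∀ x, |R| < ‖x‖ → g x = 0 := fun x hx => image_eq_zero_of_notMem_tsupport (hgz x hx)
  set d := fun x => fderiv ℝ g x w with hd
  have hdc : Continuous d := hfc.clm_apply continuous_const
  have hds : HasCompactSupport d := (hc.fderiv ℝ).comp_left (g := fun L : E2 →L[ℝ] ℝ => L w) rfl
  have hd0 : ∀ x, |R| < ‖x‖ → d x = 0 := fun x hx => by
    have : fderiv ℝ g x = 0 := by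
      by_contra h
      exact hgz x hx (support_fderiv_subset ℝ h)
    simp [hd, this]
  set φ := fun ρ : ℝ => ∫ x, g x * g (x + ρ • w) with hφ
  set φ1 := fun ρ : ℝ => ∫ x, d x * g (x + ρ • w) with hφ1
  set φ2 := fun ρ : ℝ => ∫ x, d x * d (x + ρ • w) with hφ2
  have h1 : ∀ ρ, HasDerivAt φ (-φ1 ρ) ρ := by
    intro ρ
    refine (corr_deriv hg.continuous hc hg hc w ρ).congr_deriv ?_
    have e : ∀ x, fderiv ℝ (fun y => g (y + ρ • w)) x = fderiv ℝ g (x + ρ • w) := fun x => by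
      rw [fderiv_comp_add_right]
    have hcs : Continuous (fun x => g (x + ρ • w)) := hg.continuous.comp (by fun_prop)
    have := integral_mul_fderiv_eq_neg_fderiv_mul_of_integrable (μ := (volume : Measure E2)) (f := g) (g := fun y => g (y + ρ • w)) (v := w) ?_ ?_ ?_ ?_ ?_
    · simp only [e] at this
      rw [this]
    · exact (hdc.mul hcs).integrable_of_hasCompactSupport hds.mul_right
    · simp only [e]
      exact (hg.continuous.mul (hdc.comp (by fun_prop : Continuous fun x => x + ρ • w))).integrable_of_hasCompactSupport hc.mul_right
    · exact (hg.continuous.mul hcs).integrable_of_hasCompactSupport hc.mul_right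
    · intro x _; exact hg.differentiable one_ne_zero x
    · intro x _; exact ((hg.differentiable one_ne_zero).comp (by fun_prop : Differentiable ℝ fun x => x + ρ • w)) x
  have h2 : ∀ ρ, HasDerivAt φ1 (φ2 ρ) ρ := fun ρ => corr_deriv hdc hds hg hc w ρ
  have hcont : Continuous φ2 := corr_cont hdc hds hdc hds w
  set T := 2 * |R| + 1 with hT
  have hTpos : 0 < T := by positivity
  have z2 : ∀ ρ, 2 * |R| < ρ → φ2 ρ = 0 := fun ρ h => corr_zero hd0 hd0 hw h (abs_nonneg _)
  have z1 : ∀ ρ, 2 * |R| < ρ → φ1 ρ = 0 := fun ρ h => corr_zero hd0 hg0 hw h (abs_nonneg _)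
  have z0 : ∀ ρ, 2 * |R| < ρ → φ ρ = 0 := fun ρ h => corr_zero hg0 hg0 hw h (abs_nonneg _)
  have e1 : ∫ ρ in Ioi (0:ℝ), φ2 ρ * ρ = ∫ ρ in Ioc (0:ℝ) T, φ2 ρ * ρ := by
    apply setIntegral_eq_of_subset_of_forall_sdiff_eq_zero measurableSet_Ioi Ioc_subset_Ioi_self
    intro r hr
    have h1 : 0 < r := hr.1
    have : T < r := by
      by_contra hh
      exact hr.2 ⟨h1, not_lt.1 hh⟩
    rw [z2 r (by linarith), zero_mul]
  show ∫ ρ in Ioi (0:ℝ), φ2 ρ * ρ = _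
  rw [e1, ← intervalIntegral.integral_of_le hTpos.le,
    intervalIntegral.integral_eq_sub_of_hasDerivAt (f := fun ρ => φ1 ρ * ρ + φ ρ)]
  · rw [z1 T (by linarith), z0 T (by linarith)]
    simp [hφ, pow_two]
  · intro ρ _
    refine (((h2 ρ).mul (hasDerivAt_id ρ)).add (h1 ρ)).congr_deriv ?_
    simp
  · exact (hcont.mul continuous_id).intervalIntegrable _ _

end Sob


namespace Sob
open Set Topology Metric

lemma integral_fderiv_zero {g : E2 → ℝ} (hg : ContDiff ℝ 1 g) (hc : HasCompactSupport g) (v : E2) :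
    ∫ x, fderiv ℝ g x v = 0 := by
  have hdc : Continuous (fun x => fderiv ℝ g x v) := (hg.continuous_fderiv one_ne_zero).clm_apply continuous_const
  have hds : HasCompactSupport (fun x => fderiv ℝ g x v) := (hc.fderiv ℝ).comp_left (g := fun L : E2 →L[ℝ] ℝ => L v) rfl
  have := integral_mul_fderiv_eq_neg_fderiv_mul_of_integrable (μ := (volume : Measure E2)) (f := fun _ => (1:ℝ)) (g := g) (v := v)
    (by simp) (by simpa using hdc.integrable_of_hasCompactSupport hds)
    (by simpa using hg.continuous.integrable_of_hasCompactSupport hc)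
    (fun x _ => differentiableAt_const _) (fun x _ => hg.differentiable one_ne_zero x)
  simpa using this

lemma refl_bound (a b w : E2) (hw : ‖w‖ = 1 ∨ w = 0) :
    -2 * (inner ℝ a w * inner ℝ b w) + inner ℝ a b ≤ ‖a‖ * ‖b‖ := by
  rcases hw with hw | rfl
  · have h1 : -2 * (inner ℝ a w * inner ℝ b w) + inner ℝ a b = inner ℝ (a - (2 * inner ℝ a w) • w) b := by
      rw [inner_sub_left, inner_smul_left, real_inner_comm w b]; simp; ring
    have h2 : ‖a - (2 * inner ℝ a w) • w‖ = ‖a‖ := by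
      rw [← sq_eq_sq₀ (norm_nonneg _) (norm_nonneg _), norm_sub_sq_real, inner_smul_right, norm_smul, hw, Real.norm_eq_abs, mul_one, sq_abs]
      ring
    rw [h1, ← h2]
    exact real_inner_le_norm _ _
  · simp; exact real_inner_le_norm _ _

theorem sobolev {g : E2 → ℝ} (hg : ContDiff ℝ 1 g) (hc : HasCompactSupport g) :
    4 * π * ∫ x, g x ^ 2 ≤ (∫ x, ‖fderiv ℝ g x‖) ^ 2 := by
  have hfc := hg.continuous_fderiv one_ne_zero
  set p : E2 → E2 := fun x => (InnerProductSpace.toDual ℝ E2).symm (fderiv ℝ g x) with hp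
  have hpi : ∀ x v, inner ℝ (p x) v = fderiv ℝ g x v := fun x v => InnerProductSpace.toDual_symm_apply
  have hpn : ∀ x, ‖p x‖ = ‖fderiv ℝ g x‖ := fun x => LinearIsometryEquiv.norm_map _ _
  have hpc : Continuous p := (LinearIsometryEquiv.continuous _).comp hfc
  obtain ⟨R, hR⟩ := hc.isCompact.isBounded.subset_closedBall 0
  have hp0 : ∀ x, |R| < ‖x‖ → p x = 0 := by
    intro x hx
    have : fderiv ℝ g x = 0 := by
      by_contra h
      have := hR (support_fderiv_subset ℝ h)
      rw [mem_closedBall_zero_iff] at this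
      linarith [le_abs_self R]
    simp [hp, this]
  have hpcs : HasCompactSupport p := HasCompactSupport.intro (isCompact_closedBall 0 |R|) (fun x hx => hp0 x (by simpa using hx))
  have hpint : Integrable (fun x => ‖p x‖) := hpc.norm.integrable_of_hasCompactSupport hpcs.norm
  have hshift : Continuous (fun q : E2 × E2 => p (q.1 + q.2)) := hpc.comp (by fun_prop)
  have hfst : Continuous (fun q : E2 × E2 => p q.1) := hpc.comp continuous_fst
  set B : E2 × E2 → ℝ := fun q => ‖p q.1‖ * ‖p (q.1 + q.2)‖ with hB
  have hBi : Integrable B := by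
    apply Continuous.integrable_of_hasCompactSupport (hfst.norm.mul hshift.norm)
    refine HasCompactSupport.intro ((isCompact_closedBall (0:E2) |R|).prod (isCompact_closedBall (0:E2) (2 * |R|))) ?_
    rintro ⟨x, z⟩ hxz
    simp only [mem_prod, mem_closedBall_zero_iff, not_and_or, not_le] at hxz
    by_cases hx : |R| < ‖x‖
    · simp [hp0 x hx]
    · have h2 : 2 * |R| < ‖z‖ := hxz.resolve_left hx
      have : |R| < ‖x + z‖ := by
        have h1 : ‖z‖ ≤ ‖x + z‖ + ‖x‖ := by
          have := norm_sub_le (x + z) x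
          simpa using this
        linarith
      simp [hp0 _ this]
  have hBv : ∫ q, B q = (∫ x, ‖p x‖) ^ 2 := by
    rw [show (∫ q, B q) = ∫ q, B q ∂((volume : Measure E2).prod (volume : Measure E2)) from rfl, integral_prod _ hBi]
    simp only [hB]
    simp_rw [integral_const_mul, integral_add_left_eq_self (fun y => ‖p y‖)]
    rw [integral_mul_const, pow_two]
  set n : E2 → E2 := fun z => ‖z‖⁻¹ • z with hn
  have hnm : Measurable n := (measurable_norm.inv).smul measurable_id
  have hn1 : ∀ z, ‖n z‖ = 1 ∨ n z = 0 := by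
    intro z
    by_cases h : z = 0
    · right; simp [hn, h]
    · left; simp [hn, norm_smul, h]
  have hnle : ∀ z, ‖n z‖ ≤ 1 := fun z => by
    rcases hn1 z with h | h
    · exact h.le
    · simp [h]
  set F1 : E2 × E2 → ℝ := fun q => inner ℝ (p q.1) (n q.2) * inner ℝ (p (q.1 + q.2)) (n q.2) with hF1
  set F2 : E2 × E2 → ℝ := fun q => inner ℝ (p q.1) (p (q.1 + q.2)) with hF2
  have hF1i : Integrable F1 := by
    refine hBi.mono' ?_ (Eventually.of_forall fun q => ?_)
    · exact ((hfst.measurable.inner (hnm.comp measurable_snd)).mul (hshift.measurable.inner (hnm.comp measurable_snd))).aestronglyMeasurable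
    · simp only [hF1, hB, norm_mul]
      have h1 : ∀ v : E2, ‖(inner ℝ v (n q.2) : ℝ)‖ ≤ ‖v‖ := fun v =>
        (norm_inner_le_norm _ _).trans (mul_le_of_le_one_right (norm_nonneg _) (hnle _))
      gcongr <;> exact h1 _
  have hF2i : Integrable F2 := by
    refine hBi.mono' (hfst.inner hshift).aestronglyMeasurable (Eventually.of_forall fun q => ?_)
    exact norm_inner_le_norm _ _
  have hF2v : ∫ q, F2 q = 0 := by
    rw [show (∫ q, F2 q) = ∫ q, F2 q ∂((volume : Measure E2).prod (volume : Measure E2)) from rfl, integral_prod _ hF2i]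
    simp only [hF2]
    have : ∀ x : E2, ∫ z, inner ℝ (p x) (p (x + z)) = 0 := by
      intro x
      rw [integral_add_left_eq_self (μ := (volume : Measure E2)) (fun y => (inner ℝ (p x) (p y) : ℝ)) x,
        ← integral_fderiv_zero hg hc (p x)]
      congr 1
      funext y
      rw [← hpi, real_inner_comm]
    simp [this]
  have hF1v : ∫ q, F1 q = -(2 * π * ∫ x, g x ^ 2) := by
    rw [show (∫ q, F1 q) = ∫ q, F1 q ∂((volume : Measure E2).prod (volume : Measure E2)) from rfl, integral_prod_symm _ hF1i]
    obtain ⟨ν, _, hν, hpol⟩ := polar (fun z => ∫ x, F1 (x, z)) hF1i.integral_prod_right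
    rw [hpol]
    have : ∀ w : sphere (0:E2) 1, ∫ r in Ioi (0:ℝ), (∫ x, F1 (x, r • (w:E2))) * r = - ∫ x, g x ^ 2 := by
      intro w
      have hw : ‖(w:E2)‖ = 1 := by simp
      rw [← radial_id hg hc hw]
      apply setIntegral_congr_fun measurableSet_Ioi
      intro r hr
      have hr : 0 < r := hr
      have e : n (r • (w:E2)) = w := by
        simp only [hn, norm_smul, hw, Real.norm_eq_abs, abs_of_pos hr, mul_one, smul_smul]
        rw [inv_mul_cancel₀ hr.ne', one_smul]
      simp only [hF1, e, hpi]
    simp_rw [this]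
    rw [integral_const, hν, smul_eq_mul]
    ring
  have key : ∫ q, (-2 * F1 q + F2 q) ≤ ∫ q, B q :=
    integral_mono ((hF1i.const_mul (-2)).add hF2i) hBi (fun q => refl_bound _ _ _ (hn1 _))
  rw [integral_add (hF1i.const_mul (-2)) hF2i, integral_const_mul, hF2v, hF1v, hBv] at key
  simp_rw [hpn] at key
  linarith

end Sob


namespace Rea
open Set Topology Metric

lemma cs_set {X : Type*} [MeasurableSpace X] {μ : Measure X} {f : X → ℝ} {S : Set X} (hS : MeasurableSet S) (hμ : μ S ≠ ⊤)
    (h1 : IntegrableOn f S μ) (h2 : IntegrableOn (fun x => f x ^ 2) S μ) :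
    (∫ x in S, f x ∂μ) ^ 2 ≤ (∫ x in S, f x ^ 2 ∂μ) * μ.real S := by
  set V := μ.real S with hV
  set I := ∫ x in S, f x ∂μ with hI
  set J := ∫ x in S, f x ^ 2 ∂μ with hJ
  have hc : ∀ c : ℝ, IntegrableOn (fun _ => c) S μ := fun c => integrableOn_const hμ
  have key : ∀ l : ℝ, 0 ≤ J - 2 * l * I + l ^ 2 * V := by
    intro l
    have h : 0 ≤ ∫ x in S, (f x - l) ^ 2 ∂μ := integral_nonneg fun x => sq_nonneg _
    have e : ∫ x in S, (f x - l) ^ 2 ∂μ = J - 2 * l * I + l ^ 2 * V := by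
      have : ∀ x, (f x - l) ^ 2 = f x ^ 2 - 2 * l * f x + l ^ 2 := fun x => by ring
      simp_rw [this]
      have i1 : IntegrableOn (fun x => f x ^ 2 - 2 * l * f x) S μ := h2.sub (h1.const_mul _)
      rw [integral_add i1 (hc _), integral_sub h2 (h1.const_mul _), integral_const_mul, setIntegral_const, smul_eq_mul]
      ring
    linarith
  have hV0 : 0 ≤ V := measureReal_nonneg
  rcases hV0.lt_or_eq with h | h
  · have := key (I / V)
    have e : J - 2 * (I / V) * I + (I / V) ^ 2 * V = (J * V - I ^ 2) / V := by field_simp; ring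
    rw [e] at this
    have := (div_nonneg_iff.1 this)
    rcases this with h' | h' <;> linarith
  · have h0 : I = 0 := by
      rw [hI]
      apply setIntegral_measure_zero
      exact (measureReal_eq_zero_iff hμ).1 h.symm
    rw [h0, ← h]; simp

/-- trapezoid cut-off -/
def tz (t s η v : ℝ) : ℝ := max 0 (min 1 (min ((v - t) / η) ((t + s - v) / η)))

lemma tz_cont (t s η : ℝ) : Continuous (tz t s η) := by unfold tz; fun_prop
lemma tz_nonneg (t s η v : ℝ) : 0 ≤ tz t s η v := le_max_left _ _
lemma tz_le_one (t s η v : ℝ) : tz t s η v ≤ 1 := max_le zero_le_one (min_le_left _ _)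
lemma tz_zero {t s η v : ℝ} (hη : 0 < η) (h : v ≤ t ∨ t + s ≤ v) : tz t s η v = 0 := by
  unfold tz
  apply max_eq_left
  refine (min_le_right _ _).trans ?_
  rcases h with h | h
  · exact (min_le_left _ _).trans (div_nonpos_of_nonpos_of_nonneg (by linarith) hη.le)
  · exact (min_le_right _ _).trans (div_nonpos_of_nonpos_of_nonneg (by linarith) hη.le)
lemma tz_one {t s η v : ℝ} (hη : 0 < η) (h1 : t + η ≤ v) (h2 : v ≤ t + s - η) : tz t s η v = 1 := by
  unfold tz
  have a : 1 ≤ (v - t) / η := by rw [le_div_iff₀ hη]; linarith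
  have b : 1 ≤ (t + s - v) / η := by rw [le_div_iff₀ hη]; linarith
  rw [min_eq_left (le_min a b)]; simp

def TZ (t s η v : ℝ) : ℝ := ∫ x in t..v, tz t s η x

lemma TZ_deriv (t s η v : ℝ) : HasDerivAt (TZ t s η) (tz t s η v) v :=
  intervalIntegral.integral_hasDerivAt_right ((tz_cont t s η).intervalIntegrable _ _)
    ((tz_cont t s η).stronglyMeasurableAtFilter _ _) (tz_cont t s η).continuousAt

lemma TZ_contDiff (t s η : ℝ) : ContDiff ℝ 1 (TZ t s η) := by
  rw [contDiff_one_iff_deriv]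
  refine ⟨fun v => (TZ_deriv t s η v).differentiableAt, ?_⟩
  have : deriv (TZ t s η) = tz t s η := funext fun v => (TZ_deriv t s η v).deriv
  rw [this]; exact tz_cont _ _ _

lemma TZ_zero {t s η v : ℝ} (hη : 0 < η) (h : v ≤ t) : TZ t s η v = 0 := by
  unfold TZ
  rw [intervalIntegral.integral_congr (g := fun _ => 0)]
  · simp
  · intro x hx
    rw [uIcc_of_ge h] at hx
    exact tz_zero hη (Or.inl hx.2)

lemma TZ_ge {t s η v : ℝ} (hη : 0 < η) (hs : 2 * η ≤ s) (h : t + s ≤ v) : s - 2 * η ≤ TZ t s η v := by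
  unfold TZ
  have i : ∀ a b, IntervalIntegrable (tz t s η) volume a b := fun a b => (tz_cont t s η).intervalIntegrable _ _
  rw [← intervalIntegral.integral_add_adjacent_intervals (i t (t+η)) (i (t+η) v),
    ← intervalIntegral.integral_add_adjacent_intervals (i (t+η) (t+s-η)) (i (t+s-η) v)]
  have e1 : ∫ x in (t+η)..(t+s-η), tz t s η x = s - 2 * η := by
    rw [intervalIntegral.integral_congr (g := fun _ => (1:ℝ))]
    · simp; ring
    · intro x hx
      rw [uIcc_of_le (by linarith)] at hx
      exact tz_one hη hx.1 hx.2
  have e2 : 0 ≤ ∫ x in t..(t+η), tz t s η x := intervalIntegral.integral_nonneg (by linarith) (fun x _ => tz_nonneg _ _ _ _)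
  have e3 : 0 ≤ ∫ x in (t+s-η)..v, tz t s η x := intervalIntegral.integral_nonneg (by linarith) (fun x _ => tz_nonneg _ _ _ _)
  linarith

lemma hcs_pow {f : E2 → ℝ} (hc : HasCompactSupport f) {k : ℕ} (hk : k ≠ 0) : HasCompactSupport (fun x => f x ^ k) := by
  apply hc.mono
  intro x hx hx0
  apply hx
  simp only
  rw [hx0, zero_pow hk]

lemma int_pow {f : E2 → ℝ} (hf : Continuous f) (hc : HasCompactSupport f) {k : ℕ} (hk : k ≠ 0) : Integrable (fun x => f x ^ k) := 
  (show Continuous (fun x => f x ^ k) by fun_prop).integrable_of_hasCompactSupport (hcs_pow hc hk)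

variable {u : E2 → ℝ}

lemma lvl_fin (hu : ContDiff ℝ 1 u) (hc : HasCompactSupport u) {t : ℝ} (ht : 0 ≤ t) : volume {x | t < u x} ≠ ⊤ := by
  apply ne_top_of_le_ne_top (hc.isCompact.measure_lt_top (μ := volume)).ne
  apply measure_mono
  intro x hx
  apply subset_tsupport
  have : t < u x := hx
  exact (ht.trans_lt this).ne'

lemma lvl_meas (hu : ContDiff ℝ 1 u) (t : ℝ) : MeasurableSet {x | t < u x} :=
  measurableSet_lt measurable_const hu.continuous.measurable

lemma band_aux (hu : ContDiff ℝ 1 u) (hc : HasCompactSupport u) {t s : ℝ} (ht : 0 ≤ t) (hs : 0 < s)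
    {S : Set E2} (hS : S = {x | t < u x ∧ u x < t + s}) (hSm : MeasurableSet S)
    (hfi : Integrable (fun x => ‖fderiv ℝ u x‖)) {η : ℝ} (hη : 0 < η) (hη2 : 2 * η ≤ s) :
    4 * π * (s - 2 * η) ^ 2 * volume.real {x | t + s < u x} ≤ (∫ x in S, ‖fderiv ℝ u x‖) ^ 2 := by
  set w := fun x => TZ t s η (u x) with hw
  have hwd : ContDiff ℝ 1 w := (TZ_contDiff t s η).comp hu
  have hwc : HasCompactSupport w := hc.comp_left (TZ_zero hη ht)
  have hwf : ∀ x, ‖fderiv ℝ w x‖ = tz t s η (u x) * ‖fderiv ℝ u x‖ := by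
    intro x
    have := ((TZ_deriv t s η (u x)).comp_hasFDerivAt x (hu.differentiable one_ne_zero x).hasFDerivAt).fderiv
    rw [show fderiv ℝ w x = _ from this, norm_smul, Real.norm_eq_abs, abs_of_nonneg (tz_nonneg _ _ _ _)]
  have h1 := Sob.sobolev hwd hwc
  have h2 : ∫ x, ‖fderiv ℝ w x‖ ≤ ∫ x in S, ‖fderiv ℝ u x‖ := by
    rw [← integral_indicator hSm]
    apply integral_mono ((hwd.continuous_fderiv one_ne_zero).norm.integrable_of_hasCompactSupport (hwc.fderiv ℝ).norm) (hfi.indicator hSm)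
    intro x
    simp only
    rw [hwf]
    by_cases hx : x ∈ S
    · rw [indicator_of_mem hx]
      exact mul_le_of_le_one_left (norm_nonneg _) (tz_le_one _ _ _ _)
    · rw [indicator_of_notMem hx, tz_zero hη, zero_mul]
      by_contra hh
      push Not at hh
      exact hx (by rw [hS]; exact hh)
  have h3 : (s - 2 * η) ^ 2 * volume.real {x | t + s < u x} ≤ ∫ x, w x ^ 2 := by
    have e : (s - 2 * η) ^ 2 * volume.real {x | t + s < u x} = ∫ x, {x | t + s < u x}.indicator (fun _ => (s - 2 * η) ^ 2) x := by
      rw [integral_indicator (lvl_meas hu _), setIntegral_const, smul_eq_mul, mul_comm]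
    rw [e]
    apply integral_mono
    · rw [integrable_indicator_iff (lvl_meas hu _)]
      exact integrableOn_const (lvl_fin hu hc (add_nonneg ht hs.le))
    · exact int_pow hwd.continuous hwc two_ne_zero
    · intro x
      by_cases hx : t + s < u x
      · simp only
        rw [indicator_of_mem (show x ∈ {x | t + s < u x} from hx)]
        have := TZ_ge hη hη2 hx.le
        exact pow_le_pow_left₀ (by linarith) this 2
      · simp only
        rw [indicator_of_notMem (show x ∉ {x | t + s < u x} from hx)]
        positivity
  have h4 : 0 ≤ ∫ x, ‖fderiv ℝ w x‖ := integral_nonneg fun _ => norm_nonneg _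
  calc _ = 4 * π * ((s - 2 * η) ^ 2 * volume.real {x | t + s < u x}) := by ring
    _ ≤ 4 * π * ∫ x, w x ^ 2 := mul_le_mul_of_nonneg_left h3 (by positivity)
    _ ≤ _ := h1
    _ ≤ _ := pow_le_pow_left₀ h4 h2 2

lemma band (hu : ContDiff ℝ 1 u) (hc : HasCompactSupport u) {t s : ℝ} (ht : 0 ≤ t) (hs : 0 < s) :
    4 * π * s ^ 2 * volume.real {x | t + s < u x} ≤ (∫ x in {x | t < u x ∧ u x < t + s}, gradSq u x) *
      (volume.real {x | t < u x} - volume.real {x | t + s < u x}) := by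
  set S := {x | t < u x ∧ u x < t + s} with hS
  have hSm : MeasurableSet S := (measurableSet_lt measurable_const hu.continuous.measurable).inter
    (measurableSet_lt hu.continuous.measurable measurable_const)
  have hSf : volume S ≠ ⊤ := ne_top_of_le_ne_top (lvl_fin hu hc ht) (measure_mono fun x hx => hx.1)
  have hfc := hu.continuous_fderiv one_ne_zero
  have hfi : Integrable (fun x => ‖fderiv ℝ u x‖) := hfc.norm.integrable_of_hasCompactSupport (hc.fderiv ℝ).norm
  have hfi2 : Integrable (fun x => ‖fderiv ℝ u x‖ ^ 2) := int_pow hfc.norm (hc.fderiv ℝ).norm two_ne_zero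
  have hcs := cs_set hSm hSf hfi.integrableOn hfi2.integrableOn
  have hvol : volume.real S ≤ volume.real {x | t < u x} - volume.real {x | t + s < u x} := by
    rw [le_sub_iff_add_le, ← measureReal_union ?_ (lvl_meas hu _) hSf (lvl_fin hu hc (add_nonneg ht hs.le))]
    · apply measureReal_mono _ (lvl_fin hu hc ht)
      rintro x (hx | hx)
      · exact hx.1
      · have : t + s < u x := hx
        show t < u x
        linarith
    · rw [Set.disjoint_left]
      intro x hx hx2
      exact lt_asymm hx.2 hx2
  have hlim : 4 * π * s ^ 2 * volume.real {x | t + s < u x} ≤ (∫ x in S, ‖fderiv ℝ u x‖) ^ 2 := by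
    have : Tendsto (fun η : ℝ => 4 * π * (s - 2 * η) ^ 2 * volume.real {x | t + s < u x}) (𝓝[>] 0)
        (𝓝 (4 * π * (s - 2 * 0) ^ 2 * volume.real {x | t + s < u x})) :=
      (Continuous.tendsto (by fun_prop) 0).mono_left nhdsWithin_le_nhds
    simp only [mul_zero, sub_zero] at this
    refine le_of_tendsto this ?_
    filter_upwards [Ioo_mem_nhdsGT (show 0 < s / 2 by positivity)] with η hη
    exact band_aux hu hc ht hs hS hSm hfi hη.1 (by linarith [hη.2])
  refine hlim.trans (hcs.trans ?_)
  exact mul_le_mul_of_nonneg_left hvol (integral_nonneg fun _ => by positivity)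

/-- nested indicators -/
lemma nest (b : ℕ → ℝ) (hb : ∀ k, b k = 0 ∨ b k = 1) (hanti : Antitone b) (p : ℕ) (hp : p ≠ 0) (n : ℕ) :
    (∑ k ∈ Finset.range n, b k) ^ p = ∑ k ∈ Finset.range n, (((k:ℝ) + 1) ^ p - (k:ℝ) ^ p) * b k := by
  induction n with
  | zero => simp [hp]
  | succ n ih =>
    rw [Finset.sum_range_succ, Finset.sum_range_succ, ← ih]
    rcases hb n with h | h
    · simp [h]
    · have : ∑ k ∈ Finset.range n, b k = n := by
        rw [Finset.sum_congr rfl (g := fun _ => (1:ℝ))]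
        · simp
        · intro k hk
          have h1 := hanti (Finset.mem_range.1 hk).le
          rcases hb k with h2 | h2
          · linarith
          · exact h2
      rw [this, h]; ring

end Rea


namespace Rea
open Set Topology Metric

def bb (ρ x : ℝ) : ℝ := if x < ρ then 1 else 0

lemma bb_01 (ρ x : ℝ) : bb ρ x = 0 ∨ bb ρ x = 1 := by unfold bb; split_ifs <;> simp
lemma bb_nonneg (ρ x : ℝ) : 0 ≤ bb ρ x := by rcases bb_01 ρ x with h | h <;> rw [h]; norm_num
lemma bb_mono (x : ℝ) {ρ σ : ℝ} (h : ρ ≤ σ) : bb ρ x ≤ bb σ x := by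
  unfold bb; split_ifs <;> first | linarith | norm_num

lemma bb_eq (ρ : ℝ) : EqOn (fun x => bb ρ x * x) ((Ioo 0 ρ).indicator (fun x => x)) (Ioi 0) := by
  intro x hx
  have hx : 0 < x := hx
  by_cases h : x < ρ
  · simp [bb, h, hx]
  · simp [bb, h]

lemma bb_intOn (ρ : ℝ) : IntegrableOn (fun x => bb ρ x * x) (Ioi 0) := by
  rw [integrableOn_congr_fun (bb_eq ρ) measurableSet_Ioi]
  apply Integrable.integrableOn
  rw [integrable_indicator_iff measurableSet_Ioo]
  exact (continuous_id.integrableOn_Icc (a := 0) (b := ρ)).mono_set Ioo_subset_Icc_self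

lemma bb_int {ρ : ℝ} (hρ : 0 ≤ ρ) : ∫ x in Ioi 0, bb ρ x * x = ρ ^ 2 / 2 := by
  rw [setIntegral_congr_fun measurableSet_Ioi (bb_eq ρ), setIntegral_indicator measurableSet_Ioo,
    inter_eq_right.2 Ioo_subset_Ioi_self, ← integral_Ioc_eq_integral_Ioo, ← intervalIntegral.integral_of_le hρ]
  simp

def TT (r : ℕ → ℝ) (n : ℕ) (x : ℝ) : ℝ := ∑ k ∈ Finset.range n, bb (r k) x

lemma TT_nonneg (r : ℕ → ℝ) (n : ℕ) (x : ℝ) : 0 ≤ TT r n x := Finset.sum_nonneg fun _ _ => bb_nonneg _ _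

lemma TT_pow {r : ℕ → ℝ} (hr : Antitone r) (n : ℕ) {p : ℕ} (hp : p ≠ 0) (x : ℝ) :
    TT r n x ^ p * x = ∑ k ∈ Finset.range n, (((k:ℝ) + 1) ^ p - (k:ℝ) ^ p) * (bb (r k) x * x) := by
  unfold TT
  rw [nest _ (fun k => bb_01 _ _) (fun i j hij => bb_mono x (hr hij)) p hp, Finset.sum_mul]
  exact Finset.sum_congr rfl fun k _ => by ring

lemma TT_intOn {r : ℕ → ℝ} (hr : Antitone r) (n : ℕ) {p : ℕ} (hp : p ≠ 0) :
    IntegrableOn (fun x => TT r n x ^ p * x) (Ioi 0) := by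
  simp_rw [TT_pow hr n hp]
  exact integrable_finsetSum _ fun k _ => (bb_intOn _).const_mul _

lemma TT_int {r : ℕ → ℝ} (hr : Antitone r) (h0 : ∀ k, 0 ≤ r k) (n : ℕ) {p : ℕ} (hp : p ≠ 0) :
    ∫ x in Ioi 0, TT r n x ^ p * x = ∑ k ∈ Finset.range n, (((k:ℝ) + 1) ^ p - (k:ℝ) ^ p) * (r k ^ 2 / 2) := by
  simp_rw [TT_pow hr n hp]
  rw [integral_finsetSum _ fun k _ => (bb_intOn _).const_mul _]
  refine Finset.sum_congr rfl fun k _ => ?_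
  rw [integral_const_mul, bb_int (h0 k)]

/-- level counting -/
lemma lv_int {u : E2 → ℝ} (hu : ContDiff ℝ 1 u) (hc : HasCompactSupport u) {t : ℕ → ℝ} (ht : Monotone t) (h0 : ∀ k, 0 ≤ t k)
    (n : ℕ) {p : ℕ} (hp : p ≠ 0) :
    Integrable (fun x => (∑ k ∈ Finset.range n, bb (u x) (t k)) ^ p) ∧
    ∫ x, (∑ k ∈ Finset.range n, bb (u x) (t k)) ^ p = ∑ k ∈ Finset.range n, (((k:ℝ) + 1) ^ p - (k:ℝ) ^ p) * volume.real {x | t k < u x} := by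
  have e : ∀ x, (∑ k ∈ Finset.range n, bb (u x) (t k)) ^ p = ∑ k ∈ Finset.range n, (((k:ℝ) + 1) ^ p - (k:ℝ) ^ p) * bb (u x) (t k) := by
    intro x
    refine nest _ (fun k => bb_01 _ _) ?_ p hp n
    intro i j hij
    simp only [bb]
    have := ht hij
    split_ifs <;> first | linarith | norm_num
  have e2 : ∀ k, (fun x => bb (u x) (t k)) = {x | t k < u x}.indicator (fun _ => 1) := by
    intro k; ext x
    by_cases h : t k < u x
    · rw [indicator_of_mem (show x ∈ {x | t k < u x} from h)]; simp [bb, h]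
    · rw [indicator_of_notMem (show x ∉ {x | t k < u x} from h)]; simp [bb, h]
  have i : ∀ k, Integrable (fun x => bb (u x) (t k)) := by
    intro k
    rw [e2, integrable_indicator_iff (lvl_meas hu _)]
    exact integrableOn_const (lvl_fin hu hc (h0 k))
  simp_rw [e]
  refine ⟨integrable_finsetSum _ fun k _ => (i k).const_mul _, ?_⟩
  rw [integral_finsetSum _ fun k _ => (i k).const_mul _]
  refine Finset.sum_congr rfl fun k _ => ?_
  rw [integral_const_mul, e2, integral_indicator (lvl_meas hu _), setIntegral_const]
  simp

lemma cnt_lower {s : ℝ} (hs : 0 < s) (v : ℝ) (n : ℕ) :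
    min v ((n + 1) * s) - s ≤ s * ∑ k ∈ Finset.range n, bb v ((k + 1) * s) := by
  induction n with
  | zero => simp
  | succ n ih =>
    rw [Finset.sum_range_succ, mul_add]
    push_cast
    simp only [bb] at ih ⊢
    split_ifs with h
    · have : min v ((n + 1 + 1) * s) ≤ min v ((n + 1) * s) + s := by
        rw [min_eq_right h.le]; exact (min_le_right _ _).trans (by linarith)
      linarith
    · have : min v ((n + 1 + 1) * s) ≤ min v ((n + 1) * s) := by
        rw [min_eq_left (not_lt.1 h)]; exact min_le_left _ _
      linarith

lemma cnt_upper {s : ℝ} (hs : 0 < s) {v : ℝ} (hv : 0 < v) (n : ℕ) :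
    s * ∑ k ∈ Finset.range n, bb v (k * s) ≤ min (v + s) (n * s) := by
  induction n with
  | zero => simp; positivity
  | succ n ih =>
    rw [Finset.sum_range_succ, mul_add]
    push_cast
    simp only [bb] at ih ⊢
    have h1 := ih.trans (min_le_left _ _)
    have h2 := ih.trans (min_le_right _ _)
    split_ifs with h
    · exact le_min (by linarith) (by linarith)
    · exact le_min (by linarith) (by linarith)

lemma cnt_upper0 {s : ℝ} (hs : 0 < s) {v : ℝ} (hv : v ≤ 0) (n : ℕ) :
    ∑ k ∈ Finset.range n, bb v (k * s) = 0 := by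
  apply Finset.sum_eq_zero
  intro k _
  have : 0 ≤ (k:ℝ) * s := by positivity
  simp only [bb]
  rw [if_neg (by linarith)]

/-! ladder -/
def LF (r : ℕ → ℝ) (s : ℝ) (n : ℕ) (x : ℝ) : ℝ := ∑ k ∈ Finset.range n, s * lc (r (k+1)) (r k) x
def LG (r : ℕ → ℝ) (s : ℝ) (n : ℕ) (x : ℝ) : ℝ := ∑ k ∈ Finset.range n, s * lcd (r (k+1)) (r k) x

lemma RC_zero : RC (fun _ => 0) (fun _ => 0) where
  cont := continuousOn_const
  der := ⟨∅, by simp, fun r _ => hasDerivAt_const _ _⟩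
  meas := aestronglyMeasurable_const
  iA := by simp
  iB := by simp
  iD := by simp

variable {r : ℕ → ℝ} {s : ℝ} {n : ℕ}

lemma LF_RC : ∀ {n : ℕ}, (∀ k ≤ n, 0 < r k) → (∀ k < n, r (k+1) < r k) → RC (LF r s n) (LG r s n) := by
  intro n
  induction n with
  | zero => 
    intro _ _
    have e1 : LF r s 0 = fun _ => 0 := by ext x; simp [LF]
    have e2 : LG r s 0 = fun _ => 0 := by ext x; simp [LG]
    rw [e1, e2]; exact RC_zero
  | succ n ih =>
    intro h0 hd
    have := (ih (fun k hk => h0 k (by omega)) (fun k hk => hd k (by omega))).add_smul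
      (lc_RC (h0 (n+1) le_rfl) (hd n (by omega))) s
    convert this using 1
    · ext x; simp [LF, Finset.sum_range_succ]
    · ext x; simp [LG, Finset.sum_range_succ]

lemma LG_zero (hr : Antitone r) {x : ℝ} (hx : x ≤ r n) : LG r s n x = 0 := by
  apply Finset.sum_eq_zero
  intro k hk
  have : r n ≤ r (k+1) := hr (Finset.mem_range.1 hk)
  rw [lcd, indicator_of_notMem]
  · simp
  · rintro ⟨h, _⟩; linarith

lemma LG_A (hr : Antitone r) : ∀ {n : ℕ}, (∀ k ≤ n, 0 < r k) → (∀ k < n, r (k+1) < r k) →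
    ∫ x in Ioi 0, LG r s n x ^ 2 * x = ∑ k ∈ Finset.range n, s ^ 2 * (Real.log (r k) - Real.log (r (k+1)))⁻¹ := by
  intro n
  induction n with
  | zero => intro _ _; simp [LG]
  | succ n ih =>
    intro h0 hd
    have h0' : ∀ k ≤ n, 0 < r k := fun k hk => h0 k (by omega)
    have hd' : ∀ k < n, r (k+1) < r k := fun k hk => hd k (by omega)
    rw [Finset.sum_range_succ, ← ih h0' hd', ← lcd_A (h0 (n+1) le_rfl) (hd n (by omega)), ← integral_const_mul,
      ← integral_add (LF_RC h0' hd').iA ((lcd_iA (h0 (n+1) le_rfl) (hd n (by omega))).const_mul _)]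
    congr 1
    ext x
    have e : LG r s (n+1) x = LG r s n x + s * lcd (r (n+1)) (r n) x := by simp [LG, Finset.sum_range_succ]
    rw [e]
    by_cases hx : x ≤ r n
    · rw [LG_zero hr hx]; ring
    · rw [show lcd (r (n+1)) (r n) x = 0 by
        rw [lcd, indicator_of_notMem]
        rintro ⟨_, h⟩; exact hx h.le]
      ring

lemma LF_le (hs : 0 ≤ s) (h0 : ∀ k ≤ n, 0 < r k) (hd : ∀ k < n, r (k+1) < r k) (x : ℝ) : LF r s n x ≤ s * TT r n x := by
  rw [LF, TT, Finset.mul_sum]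
  apply Finset.sum_le_sum
  intro k hk
  have hk := Finset.mem_range.1 hk
  apply mul_le_mul_of_nonneg_left _ hs
  unfold bb
  split_ifs with h
  · exact lc_le_one _ _ _
  · rw [lc_of_ge (h0 (k+1) hk) (hd k hk) (not_lt.1 h)]

lemma LF_ge (hs : 0 ≤ s) (h0 : ∀ k ≤ n, 0 < r k) (hd : ∀ k < n, r (k+1) < r k) {x : ℝ} (hx : 0 < x) :
    s * TT (fun k => r (k+1)) n x ≤ LF r s n x := by
  rw [LF, TT, Finset.mul_sum]
  apply Finset.sum_le_sum
  intro k hk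
  have hk := Finset.mem_range.1 hk
  apply mul_le_mul_of_nonneg_left _ hs
  unfold bb
  split_ifs with h
  · rw [lc_of_le (h0 (k+1) hk) (hd k hk) hx h.le]
  · exact lc_nonneg _ _ _

lemma LF_nonneg (hs : 0 ≤ s) (x : ℝ) : 0 ≤ LF r s n x :=
  Finset.sum_nonneg fun _ _ => mul_nonneg hs (lc_nonneg _ _ _)

/-- abstract ladder inequality -/
lemma ladder {q dq : ℝ → ℝ} {α : ℝ} (U : RadSol q dq α) (hr : Antitone r) (hr0 : ∀ k, 0 ≤ r k) (hs : 0 ≤ s)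
    (h0 : ∀ k ≤ n, 0 < r k) (hd : ∀ k < n, r (k+1) < r k) :
    s ^ 4 * ∑ k ∈ Finset.range n, (((k:ℝ) + 1) ^ 4 - (k:ℝ) ^ 4) * (r (k+1) ^ 2 / 2) ≤
    ((∑ k ∈ Finset.range n, s ^ 2 * (Real.log (r k) - Real.log (r (k+1)))⁻¹) +
      s ^ 2 * ∑ k ∈ Finset.range n, (((k:ℝ) + 1) ^ 2 - (k:ℝ) ^ 2) * (r k ^ 2 / 2)) ^ 2 / (2 * ∫ r in Ioi 0, q r ^ 2 * r) := by
  have H := LF_RC (s := s) h0 hd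
  have h1 := RC.sharp U H
  have hr' : Antitone (fun k => r (k+1)) := fun i j hij => hr (by omega)
  have hD : s ^ 4 * ∑ k ∈ Finset.range n, (((k:ℝ) + 1) ^ 4 - (k:ℝ) ^ 4) * (r (k+1) ^ 2 / 2) ≤ RC.D (LF r s n) := by
    rw [← TT_int hr' (fun k => hr0 _) n four_ne_zero, ← integral_const_mul, RC.D]
    apply setIntegral_mono_on ((TT_intOn hr' n four_ne_zero).const_mul _) H.iD measurableSet_Ioi
    intro x hx
    have hx : 0 < x := hx
    have := pow_le_pow_left₀ (mul_nonneg hs (TT_nonneg _ _ _)) (LF_ge hs h0 hd hx) 4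
    calc _ = (s * TT (fun k => r (k+1)) n x) ^ 4 * x := by ring
      _ ≤ _ := mul_le_mul_of_nonneg_right this hx.le
  have hN : RC.N (LF r s n) (LG r s n) ≤ (∑ k ∈ Finset.range n, s ^ 2 * (Real.log (r k) - Real.log (r (k+1)))⁻¹) +
      s ^ 2 * ∑ k ∈ Finset.range n, (((k:ℝ) + 1) ^ 2 - (k:ℝ) ^ 2) * (r k ^ 2 / 2) := by
    rw [RC.N, LG_A hr h0 hd, ← TT_int hr hr0 n two_ne_zero, ← integral_const_mul]
    apply add_le_add le_rfl
    apply setIntegral_mono_on H.iB ((TT_intOn hr n two_ne_zero).const_mul _) measurableSet_Ioi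
    intro x hx
    have hx : 0 < x := hx
    have := pow_le_pow_left₀ (LF_nonneg (r := r) (n := n) hs x) (LF_le hs h0 hd x) 2
    calc _ ≤ (s * TT r n x) ^ 2 * x := mul_le_mul_of_nonneg_right this hx.le
      _ = _ := by ring
  refine hD.trans (h1.trans ?_)
  apply div_le_div_of_nonneg_right (pow_le_pow_left₀ (RC.N_nonneg _ _) hN 2)
  linarith [U.m_pos]

end Rea


namespace Rea
open Set Topology Metric

variable {u : E2 → ℝ}

lemma log_step {m₁ m₂ A s : ℝ} (h2 : 0 < m₂) (h : m₂ < m₁) (hb : 4 * π * s ^ 2 * m₂ ≤ A * (m₁ - m₂)) :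
    2 * π * (s ^ 2 * (Real.log √(m₁ / π) - Real.log √(m₂ / π))⁻¹) ≤ A + 4 * π * s ^ 2 := by
  have h1 : 0 < m₁ := h2.trans h
  have e : Real.log √(m₁ / π) - Real.log √(m₂ / π) = Real.log (m₁ / m₂) / 2 := by
    rw [Real.log_sqrt (by positivity), Real.log_sqrt (by positivity), Real.log_div h1.ne' pi_ne_zero,
      Real.log_div h2.ne' pi_ne_zero, Real.log_div h1.ne' h2.ne']
    ring
  have hl : (m₁ - m₂) / m₁ ≤ Real.log (m₁ / m₂) := by
    have := Real.one_sub_inv_le_log_of_pos (show 0 < m₁ / m₂ by positivity)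
    rw [inv_div] at this
    have e2 : (m₁ - m₂) / m₁ = 1 - m₂ / m₁ := by field_simp
    linarith
  have hp : 0 < (m₁ - m₂) / m₁ := div_pos (by linarith) h1
  rw [e, inv_div]
  have : 2 / Real.log (m₁ / m₂) ≤ 2 / ((m₁ - m₂) / m₁) := div_le_div_of_nonneg_left (by norm_num) hp hl
  calc 2 * π * (s ^ 2 * (2 / Real.log (m₁ / m₂))) ≤ 2 * π * (s ^ 2 * (2 / ((m₁ - m₂) / m₁))) := by
        refine mul_le_mul_of_nonneg_left (mul_le_mul_of_nonneg_left this (by positivity)) (by positivity)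
    _ = 4 * π * s ^ 2 * m₂ / (m₁ - m₂) + 4 * π * s ^ 2 := by
        have : m₁ - m₂ ≠ 0 := by linarith
        field_simp; ring
    _ ≤ A + 4 * π * s ^ 2 := by
        gcongr
        rw [div_le_iff₀ (by linarith)]
        exact hb

lemma gradSq_int (hu : ContDiff ℝ 1 u) (hc : HasCompactSupport u) : Integrable (gradSq u) :=
  int_pow (hu.continuous_fderiv one_ne_zero).norm (hc.fderiv ℝ).norm two_ne_zero

lemma bands_sum (hu : ContDiff ℝ 1 u) (hc : HasCompactSupport u) {s : ℝ} (hs : 0 < s) (n : ℕ) :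
    ∑ k ∈ Finset.range n, ∫ x in {x | k * s < u x ∧ u x < k * s + s}, gradSq u x ≤ ∫ x, gradSq u x := by
  have hi := gradSq_int hu hc
  rw [← integral_biUnion_finset]
  · exact setIntegral_le_integral hi (Eventually.of_forall fun x => by simp only [gradSq]; positivity)
  · intro k _
    exact (measurableSet_lt measurable_const hu.continuous.measurable).inter
      (measurableSet_lt hu.continuous.measurable measurable_const)
  · intro i _ j _ hij
    show Disjoint _ _
    rw [Set.disjoint_left]
    rintro x ⟨h1, h2⟩ ⟨h3, h4⟩
    rcases lt_or_gt_of_ne hij with h | h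
    · have : (i:ℝ) + 1 ≤ j := by exact_mod_cast h
      nlinarith
    · have : (j:ℝ) + 1 ≤ i := by exact_mod_cast h
      nlinarith
  · intro k _; exact hi.integrableOn

lemma nn_step {q dq : ℝ → ℝ} {α : ℝ} (U : RadSol q dq α) (hu : ContDiff ℝ 1 u) (hc : HasCompactSupport u) (hu0 : ∀ x, 0 ≤ u x)
    {x0 : E2} (hx0 : 0 < u x0) (hmax : ∀ x, u x ≤ u x0) {s : ℝ} {n : ℕ} (hs : s * (n + 1) = u x0) :
    (∫ x, u x ^ 4) - 4 * s * ∫ x, u x ^ 3 ≤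
      ((∫ x, gradSq u x) + 4 * π * s * u x0 + ((∫ x, u x ^ 2) + 2 * s * (∫ x, u x) + s ^ 2 * volume.real {x | 0 < u x})) ^ 2
        / (4 * π * ∫ r in Ioi 0, q r ^ 2 * r) := by
  have hs0 : 0 < s := by
    by_contra h
    have : s * (n + 1) ≤ 0 := mul_nonpos_of_nonpos_of_nonneg (not_lt.1 h) (by positivity)
    linarith
  set μ : ℕ → ℝ := fun k => volume.real {x | k * s < u x} with hμ
  have hμ0 : ∀ k, 0 ≤ μ k := fun k => measureReal_nonneg
  have hks : ∀ k : ℕ, 0 ≤ (k:ℝ) * s := fun k => by positivity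
  have hμa : Antitone μ := by
    intro i j hij
    refine measureReal_mono ?_ (lvl_fin hu hc (hks i))
    intro x hx
    have hx : j * s < u x := hx
    show i * s < u x
    have : (i:ℝ) * s ≤ j * s := by gcongr
    linarith
  have hμp : ∀ k ≤ n, 0 < μ k := by
    intro k hk
    apply ENNReal.toReal_pos _ (lvl_fin hu hc (hks k))
    apply ne_of_gt
    refine (isOpen_lt continuous_const hu.continuous).measure_pos volume ⟨x0, ?_⟩
    show k * s < u x0
    have : (k:ℝ) ≤ n := by exact_mod_cast hk
    nlinarith
  have hband : ∀ k : ℕ, 4 * π * s ^ 2 * μ (k+1) ≤ (∫ x in {x | k * s < u x ∧ u x < k * s + s}, gradSq u x) * (μ k - μ (k+1)) := by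
    intro k
    have := band hu hc (hks k) hs0
    simp only [hμ]
    push_cast
    rw [show ((k:ℝ) + 1) * s = k * s + s by ring]
    exact this
  have hμd : ∀ k < n, μ (k+1) < μ k := by
    intro k hk
    have h1 := hband k
    have h2 := hμp (k+1) hk
    have h3 : 0 < 4 * π * s ^ 2 * μ (k+1) := by positivity
    have h4 : 0 ≤ ∫ x in {x | k * s < u x ∧ u x < k * s + s}, gradSq u x := integral_nonneg fun x => by simp only [gradSq, Pi.zero_apply]; positivity
    by_contra h5
    have := mul_nonpos_of_nonneg_of_nonpos h4 (show μ k - μ (k+1) ≤ 0 by linarith)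
    linarith
  set r : ℕ → ℝ := fun k => √(μ k / π) with hr
  have hr2 : ∀ k, r k ^ 2 = μ k / π := fun k => Real.sq_sqrt (div_nonneg (hμ0 k) pi_pos.le)
  have hra : Antitone r := fun i j hij => Real.sqrt_le_sqrt (div_le_div_of_nonneg_right (hμa hij) pi_pos.le)
  have L := ladder (s := s) (n := n) U hra (fun k => Real.sqrt_nonneg _) hs0.le
    (fun k hk => Real.sqrt_pos.2 (div_pos (hμp k hk) pi_pos))
    (fun k hk => Real.sqrt_lt_sqrt (div_nonneg (hμ0 _) pi_pos.le) (div_lt_div_of_pos_right (hμd k hk) pi_pos))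
  have hm := U.m_pos
  set m := ∫ r in Ioi 0, q r ^ 2 * r with hmdef
  have hA : 2 * π * ∑ k ∈ Finset.range n, s ^ 2 * (Real.log (r k) - Real.log (r (k+1)))⁻¹ ≤ (∫ x, gradSq u x) + 4 * π * s * u x0 := by
    rw [Finset.mul_sum]
    calc _ ≤ ∑ k ∈ Finset.range n, ((∫ x in {x | k * s < u x ∧ u x < k * s + s}, gradSq u x) + 4 * π * s ^ 2) := by
          apply Finset.sum_le_sum
          intro k hk
          have hk := Finset.mem_range.1 hk
          exact log_step (hμp (k+1) hk) (hμd k hk) (hband k)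
      _ = (∑ k ∈ Finset.range n, ∫ x in {x | k * s < u x ∧ u x < k * s + s}, gradSq u x) + n * (4 * π * s ^ 2) := by
          rw [Finset.sum_add_distrib]; simp
      _ ≤ _ := by
          apply add_le_add (bands_sum hu hc hs0 n)
          rw [← hs]
          have : 0 ≤ 4 * π * s ^ 2 := by positivity
          nlinarith
  have i2 := int_pow hu.continuous hc two_ne_zero
  have i1 : Integrable u := by simpa using int_pow hu.continuous hc one_ne_zero
  have i3 := int_pow hu.continuous hc three_ne_zero
  have i4 := int_pow hu.continuous hc four_ne_zero
  have iind : Integrable ({x | 0 < u x}.indicator (fun _ => (1:ℝ))) := by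
    rw [integrable_indicator_iff (lvl_meas hu _)]
    exact integrableOn_const (lvl_fin hu hc le_rfl)
  have hB : 2 * π * (s ^ 2 * ∑ k ∈ Finset.range n, (((k:ℝ) + 1) ^ 2 - (k:ℝ) ^ 2) * (r k ^ 2 / 2)) ≤
      (∫ x, u x ^ 2) + 2 * s * (∫ x, u x) + s ^ 2 * volume.real {x | 0 < u x} := by
    obtain ⟨j1, j2⟩ := lv_int hu hc (t := fun k : ℕ => k * s) (fun i j hij => by simp only; gcongr) hks n two_ne_zero
    have e : 2 * π * (s ^ 2 * ∑ k ∈ Finset.range n, (((k:ℝ) + 1) ^ 2 - (k:ℝ) ^ 2) * (r k ^ 2 / 2)) =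
        s ^ 2 * ∑ k ∈ Finset.range n, (((k:ℝ) + 1) ^ 2 - (k:ℝ) ^ 2) * μ k := by
      rw [mul_left_comm, Finset.mul_sum]
      congr 1
      refine Finset.sum_congr rfl fun k _ => ?_
      rw [hr2]; field_simp
    rw [e, ← j2, ← integral_const_mul]
    have k1 : Integrable (fun x => u x ^ 2 + 2 * s * u x) := i2.add (i1.const_mul _)
    have k2 : Integrable (fun x => s ^ 2 * {x | 0 < u x}.indicator (fun _ => (1:ℝ)) x) := iind.const_mul _
    have e2 : (∫ x, u x ^ 2) + 2 * s * (∫ x, u x) + s ^ 2 * volume.real {x | 0 < u x} =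
        ∫ x, ((u x ^ 2 + 2 * s * u x) + s ^ 2 * {x | 0 < u x}.indicator (fun _ => (1:ℝ)) x) := by
      rw [integral_add k1 k2, integral_add i2 (i1.const_mul _), integral_const_mul, integral_const_mul,
        integral_indicator (lvl_meas hu _), setIntegral_const]
      simp
    rw [e2]
    apply integral_mono (j1.const_mul _) (k1.add k2)
    intro x
    simp only [Pi.add_apply]
    by_cases hx : 0 < u x
    · rw [indicator_of_mem (show x ∈ {x | 0 < u x} from hx)]
      have := (cnt_upper hs0 hx n).trans (min_le_left _ _)
      have h3 : 0 ≤ s * ∑ k ∈ Finset.range n, bb (u x) (k * s) := mul_nonneg hs0.le (Finset.sum_nonneg fun _ _ => bb_nonneg _ _)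
      have := pow_le_pow_left₀ h3 this 2
      rw [mul_pow] at this
      linarith
    · rw [indicator_of_notMem (show x ∉ {x | 0 < u x} from hx), cnt_upper0 hs0 (not_lt.1 hx)]
      have := hu0 x
      simp
      positivity
  have hD : (∫ x, u x ^ 4) - 4 * s * (∫ x, u x ^ 3) ≤
      2 * π * (s ^ 4 * ∑ k ∈ Finset.range n, (((k:ℝ) + 1) ^ 4 - (k:ℝ) ^ 4) * (r (k+1) ^ 2 / 2)) := by
    obtain ⟨j1, j2⟩ := lv_int hu hc (t := fun k : ℕ => (k + 1) * s) (fun i j hij => by simp only; gcongr) (fun k => by positivity) n four_ne_zero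
    have e : 2 * π * (s ^ 4 * ∑ k ∈ Finset.range n, (((k:ℝ) + 1) ^ 4 - (k:ℝ) ^ 4) * (r (k+1) ^ 2 / 2)) =
        s ^ 4 * ∑ k ∈ Finset.range n, (((k:ℝ) + 1) ^ 4 - (k:ℝ) ^ 4) * volume.real {x | (k + 1) * s < u x} := by
      rw [mul_left_comm, Finset.mul_sum]
      congr 1
      refine Finset.sum_congr rfl fun k _ => ?_
      rw [hr2]
      simp only [hμ]
      push_cast
      field_simp
    rw [e, ← j2, ← integral_const_mul, ← integral_const_mul, ← integral_sub i4 (i3.const_mul _)]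
    apply integral_mono (i4.sub (i3.const_mul _)) (j1.const_mul _)
    intro x
    simp only [Pi.sub_apply]
    have h1 := cnt_lower hs0 (u x) n
    have h2 : u x ≤ (n + 1) * s := by rw [mul_comm, hs]; exact hmax x
    rw [min_eq_left h2] at h1
    have hux := hu0 x
    rw [← mul_pow]
    by_cases hus : s ≤ u x
    · refine le_trans ?_ (pow_le_pow_left₀ (by linarith) h1 4)
      have : (u x - s) ^ 4 = u x ^ 4 - 4 * s * u x ^ 3 + s ^ 2 * (2 * u x ^ 2 + (2 * u x - s) ^ 2) := by ring
      rw [this]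
      have : 0 ≤ s ^ 2 * (2 * u x ^ 2 + (2 * u x - s) ^ 2) := by positivity
      linarith
    · have h4 : u x ^ 4 - 4 * s * u x ^ 3 = u x ^ 3 * (u x - 4 * s) := by ring
      rw [h4]
      have : u x ^ 3 * (u x - 4 * s) ≤ 0 := mul_nonpos_of_nonneg_of_nonpos (by positivity) (by linarith)
      refine this.trans (by positivity)
  refine hD.trans ?_
  set X := (∑ k ∈ Finset.range n, s ^ 2 * (Real.log (r k) - Real.log (r (k+1)))⁻¹) +
      s ^ 2 * ∑ k ∈ Finset.range n, (((k:ℝ) + 1) ^ 2 - (k:ℝ) ^ 2) * (r k ^ 2 / 2) with hX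
  have hX0 : 0 ≤ X := by
    apply add_nonneg
    · apply Finset.sum_nonneg
      intro k hk
      have : Real.log (r (k+1)) ≤ Real.log (r k) := Real.log_le_log
        (Real.sqrt_pos.2 (div_pos (hμp (k+1) (Finset.mem_range.1 hk)) pi_pos)) (hra (Nat.le_succ k))
      exact mul_nonneg (sq_nonneg _) (inv_nonneg.2 (by linarith))
    · apply mul_nonneg (sq_nonneg _)
      apply Finset.sum_nonneg
      intro k _
      have : (0:ℝ) ≤ (k + 1) ^ 2 - k ^ 2 := by ring_nf; positivity
      positivity
  calc _ ≤ 2 * π * (X ^ 2 / (2 * m)) := mul_le_mul_of_nonneg_left L (by positivity)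
    _ = (2 * π * X) ^ 2 / (4 * π * m) := by field_simp; ring
    _ ≤ _ := by
      apply div_le_div_of_nonneg_right _ (by positivity)
      apply pow_le_pow_left₀ (by positivity)
      rw [hX, mul_add]
      exact add_le_add hA hB

theorem nn_ineq {q dq : ℝ → ℝ} {α : ℝ} (U : RadSol q dq α) (hu : ContDiff ℝ 1 u) (hc : HasCompactSupport u) (hu0 : ∀ x, 0 ≤ u x) :
    (∫ x, u x ^ 4) ≤ ((∫ x, gradSq u x) + ∫ x, u x ^ 2) ^ 2 / (4 * π * ∫ r in Ioi 0, q r ^ 2 * r) := by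
  have hm := U.m_pos
  by_cases h : ∃ x, 0 < u x
  · obtain ⟨y, hy⟩ := h
    obtain ⟨x0, hx0⟩ := hu.continuous.exists_forall_ge_of_hasCompactSupport hc
    have hpos : 0 < u x0 := hy.trans_le (hx0 y)
    have key := fun n : ℕ => nn_step U hu hc hu0 hpos hx0 (s := u x0 / (n + 1)) (n := n) (by field_simp)
    have hs : Tendsto (fun n : ℕ => u x0 / ((n:ℝ) + 1)) atTop (𝓝 0) :=
      tendsto_const_nhds.div_atTop (tendsto_atTop_add_const_right _ _ tendsto_natCast_atTop_atTop)
    have c1 : Continuous (fun s : ℝ => (∫ x, u x ^ 4) - 4 * s * ∫ x, u x ^ 3) := by fun_prop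
    have c2 : Continuous (fun s : ℝ => ((∫ x, gradSq u x) + 4 * π * s * u x0 + ((∫ x, u x ^ 2) + 2 * s * (∫ x, u x) + s ^ 2 * volume.real {x | 0 < u x})) ^ 2
        / (4 * π * ∫ r in Ioi 0, q r ^ 2 * r)) := by fun_prop
    have := le_of_tendsto_of_tendsto' ((c1.tendsto 0).comp hs) ((c2.tendsto 0).comp hs) key
    simpa using this
  · push Not at h
    have e : ∀ x, u x = 0 := fun x => le_antisymm (h x) (hu0 x)
    simp only [e]
    simp
    positivity

end Rea


namespace Rea
open Set Topology Metric

/-- sign removal -/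
lemma c1_ineq {K : ℝ} (hK : 0 < K)
    (hP : ∀ u : E2 → ℝ, ContDiff ℝ 1 u → HasCompactSupport u → (∀ x, 0 ≤ u x) → (∫ x, u x ^ 4) ≤ ((∫ x, gradSq u x) + ∫ x, u x ^ 2) ^ 2 / K)
    {u : E2 → ℝ} (hu : ContDiff ℝ 1 u) (hc : HasCompactSupport u) :
    (∫ x, u x ^ 4) ≤ ((∫ x, gradSq u x) + ∫ x, u x ^ 2) ^ 2 / K := by
  set F : ℕ → E2 → ℝ := fun n x => RC.sa (1/((n:ℝ)+1)) (u x) with hF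
  have hδ : ∀ n : ℕ, (0:ℝ) < 1/((n:ℝ)+1) := fun n => by positivity
  have hd : ∀ n, ContDiff ℝ 1 (F n) := by
    intro n
    have : ContDiff ℝ 1 (fun x => √(u x ^ 2 + (1/((n:ℝ)+1)) ^ 2) - (1/((n:ℝ)+1))) := by
      refine ContDiff.sub (ContDiff.sqrt (by fun_prop) ?_) contDiff_const
      intro x
      have := hδ n
      positivity
    exact this
  have hcs : ∀ n, HasCompactSupport (F n) := by
    intro n
    apply hc.mono
    intro x hx hx0
    apply hx
    simp only [hF, hx0]
    have h1 := RC.sa_nonneg (hδ n) 0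
    have h2 := RC.sa_le (hδ n) 0
    simp at h1 h2 ⊢
    linarith
  have hg : ∀ n x, gradSq (F n) x ≤ gradSq u x := by
    intro n x
    have h1 := ((RC.sa_deriv (hδ n) (u x)).comp_hasFDerivAt x (hu.differentiable one_ne_zero x).hasFDerivAt).fderiv
    have h2 : fderiv ℝ (F n) x = _ := h1
    simp only [gradSq]
    rw [h2, norm_smul, mul_pow, Real.norm_eq_abs, sq_abs]
    exact mul_le_of_le_one_left (sq_nonneg _) (RC.sa_deriv_le (hδ n) _)
  have h2 : ∀ n x, F n x ^ 2 ≤ u x ^ 2 := by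
    intro n x
    rw [← sq_abs (u x)]
    exact pow_le_pow_left₀ (RC.sa_nonneg (hδ n) _) (RC.sa_le (hδ n) _) 2
  have key := fatou_helper (μ := volume) (F := fun n x => F n x ^ 4) (h := fun x => |u x| ^ 4)
    (C := fun _ => ((∫ x, gradSq u x) + ∫ x, u x ^ 2) ^ 2 / K) (c := ((∫ x, gradSq u x) + ∫ x, u x ^ 2) ^ 2 / K)
    (fun n => int_pow (hd n).continuous (hcs n) four_ne_zero)
    (fun n => Eventually.of_forall fun x => by positivity)
    (fun n => by
      refine (hP _ (hd n) (hcs n) (fun x => RC.sa_nonneg (hδ n) _)).trans ?_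
      apply div_le_div_of_nonneg_right _ hK.le
      apply pow_le_pow_left₀
      · exact add_nonneg (integral_nonneg fun x => by simp only [gradSq, Pi.zero_apply]; positivity) (integral_nonneg fun x => sq_nonneg _)
      · exact add_le_add (integral_mono (gradSq_int (hd n) (hcs n)) (gradSq_int hu hc) (hg n))
          (integral_mono (int_pow (hd n).continuous (hcs n) two_ne_zero) (int_pow hu.continuous hc two_ne_zero) (h2 n)))
    tendsto_const_nhds
    (Eventually.of_forall fun x => (RC.sa_tendsto (u x)).pow 4)
  have e : ∀ x, |u x| ^ 4 = u x ^ 4 := fun x => Even.pow_abs (by decide) _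
  simp_rw [e] at key
  exact key.2

lemma jensen {φ h : E2 → ℝ} (hφ0 : ∀ x, 0 ≤ φ x) (hφi : Integrable φ) (hφ1 : ∫ x, φ x = 1)
    (h1 : Integrable (fun x => φ x * h x)) (h2 : Integrable (fun x => φ x * h x ^ 2)) :
    (∫ x, φ x * h x) ^ 2 ≤ ∫ x, φ x * h x ^ 2 := by
  set c := ∫ x, φ x * h x with hc
  have hn : 0 ≤ ∫ x, φ x * (h x - c) ^ 2 := integral_nonneg fun x => mul_nonneg (hφ0 x) (sq_nonneg _)
  have e : ∀ x, φ x * (h x - c) ^ 2 = φ x * h x ^ 2 - 2 * c * (φ x * h x) + c ^ 2 * φ x := fun x => by ring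
  simp_rw [e] at hn
  have i1 : Integrable (fun x => φ x * h x ^ 2 - 2 * c * (φ x * h x)) := h2.sub (h1.const_mul _)
  rw [integral_add i1 (hφi.const_mul _), integral_sub h2 (h1.const_mul _), integral_const_mul, integral_const_mul, hφ1, ← hc] at hn
  nlinarith

lemma shift_int {h : E2 → ℝ} (hi : Integrable h) {φ : E2 → ℝ} (hφ : Continuous φ) (hφc : HasCompactSupport φ) (x : E2) :
    Integrable (fun t => φ t * h (x - t)) := by
  obtain ⟨C, hC⟩ := hφ.bounded_above_of_compact_support hφc
  exact (hi.comp_sub_left x).bdd_mul hφ.aestronglyMeasurable (Eventually.of_forall hC)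

open Convolution in
/-- the mollified inequality -/
lemma cs_ineq {K : ℝ} (hK : 0 < K)
    (hP : ∀ u : E2 → ℝ, ContDiff ℝ 1 u → HasCompactSupport u → (∫ x, u x ^ 4) ≤ ((∫ x, gradSq u x) + ∫ x, u x ^ 2) ^ 2 / K)
    {v : E2 → ℝ} (hv : Differentiable ℝ v) (hc : HasCompactSupport v) (hg : Integrable (gradSq v)) :
    (∫ x, v x ^ 4) ≤ ((∫ x, gradSq v x) + ∫ x, v x ^ 2) ^ 2 / K := by
  have hvc := hv.continuous
  have iv : Integrable v := hvc.integrable_of_hasCompactSupport hc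
  have iv2 := int_pow hvc hc two_ne_zero
  have hvl : LocallyIntegrable v := hvc.locallyIntegrable
  have hgm : Measurable (fun x => fderiv ℝ v x) := measurable_fderiv ℝ v
  have ig : Integrable (fun x => ‖fderiv ℝ v x‖) := by
    have i1 : Integrable ((tsupport v).indicator (fun _ => (1:ℝ))) := by
      rw [integrable_indicator_iff hc.isCompact.measurableSet]
      exact integrableOn_const (hc.isCompact.measure_lt_top (μ := volume)).ne
    refine (i1.add hg).mono' hgm.norm.aestronglyMeasurable (Eventually.of_forall fun x => ?_)
    simp only [Pi.add_apply, gradSq]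
    rw [norm_norm]
    by_cases hx : x ∈ tsupport v
    · rw [indicator_of_mem hx]
      nlinarith [sq_nonneg (‖fderiv ℝ v x‖ - 1)]
    · rw [indicator_of_notMem hx]
      have : fderiv ℝ v x = 0 := by
        by_contra h
        exact hx (support_fderiv_subset ℝ h)
      rw [this]; simp
  let φ : ℕ → ContDiffBump (0:E2) := fun n => ⟨1/((n:ℝ)+2), 1/((n:ℝ)+1), by positivity, by
    apply one_div_lt_one_div_of_lt <;> [positivity; linarith]⟩
  have hφ : Tendsto (fun n => (φ n).rOut) atTop (𝓝 0) := tendsto_one_div_add_atTop_nhds_zero_nat (𝕜 := ℝ)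
  set ψ : ℕ → E2 → ℝ := fun n => (φ n).normed volume with hψ
  have ψ0 : ∀ n x, 0 ≤ ψ n x := fun n x => (φ n).nonneg_normed x
  have ψd : ∀ n, ContDiff ℝ 1 (ψ n) := fun n => (φ n).contDiff_normed
  have ψc : ∀ n, HasCompactSupport (ψ n) := fun n => (φ n).hasCompactSupport_normed
  have ψ1 : ∀ n, ∫ x, ψ n x = 1 := fun n => (φ n).integral_normed
  have ψi : ∀ n, Integrable (ψ n) := fun n => (φ n).integrable_normed
  set w : ℕ → E2 → ℝ := fun n => (ψ n ⋆[ContinuousLinearMap.lsmul ℝ ℝ, volume] v) with hw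
  have wd : ∀ n, ContDiff ℝ 1 (w n) := fun n => (ψc n).contDiff_convolution_left _ (ψd n) hvl
  have wc : ∀ n, HasCompactSupport (w n) := fun n => (ψc n).convolution _ hc
  have wl : ∀ x, Tendsto (fun n => w n x) atTop (𝓝 (v x)) := fun x =>
    ContDiffBump.convolution_tendsto_right_of_continuous hφ hvc x
  have wx : ∀ n x, w n x = ∫ t, ψ n t * v (x - t) := fun n x => rfl
  have w2 : ∀ n, ∫ x, w n x ^ 2 ≤ ∫ x, v x ^ 2 := by
    intro n
    have e := integral_convolution (ContinuousLinearMap.lsmul ℝ ℝ) (ψi n) iv2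
    have ie := (ψi n).integrable_convolution (ContinuousLinearMap.lsmul ℝ ℝ) iv2
    rw [ψ1] at e
    simp only [ContinuousLinearMap.lsmul_apply, one_smul] at e
    rw [← e]
    apply integral_mono (int_pow (wd n).continuous (wc n) two_ne_zero) ie
    intro x
    simp only
    rw [wx]
    exact jensen (h := fun t => v (x - t)) (ψ0 n) (ψi n) (ψ1 n) (shift_int iv (ψd n).continuous (ψc n) x) (shift_int iv2 (ψd n).continuous (ψc n) x)
  have wg : ∀ n x, ‖fderiv ℝ (w n) x‖ ≤ ∫ t, ψ n t * ‖fderiv ℝ v (x - t)‖ := by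
    intro n x
    have hi := shift_int ig (ψd n).continuous (ψc n) x
    apply ContinuousLinearMap.opNorm_le_bound _ (integral_nonneg fun t => mul_nonneg (ψ0 n t) (norm_nonneg _))
    intro e
    have h1 := ((ψc n).hasFDerivAt_convolution_left (ContinuousLinearMap.lsmul ℝ ℝ) (ψd n) hvl x).fderiv
    have hex := ((ψc n).fderiv ℝ).convolutionExists_left ((ContinuousLinearMap.lsmul ℝ ℝ).precompL E2) ((ψd n).continuous_fderiv one_ne_zero) hvl x
    have h2 : fderiv ℝ (w n) x e = ∫ t, fderiv ℝ (ψ n) t e * v (x - t) := by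
      rw [show fderiv ℝ (w n) x = _ from h1, convolution_def, ContinuousLinearMap.integral_apply hex]
      rfl
    have hsd : ∀ t, HasFDerivAt (fun t => v (x - t)) (-(fderiv ℝ v (x - t))) t := by
      intro t
      have a1 : HasFDerivAt (fun t : E2 => x - t) (-(ContinuousLinearMap.id ℝ E2)) t := (hasFDerivAt_id t).const_sub x
      have := (hv (x - t)).hasFDerivAt.comp t a1
      have e2 : -(fderiv ℝ v (x - t)) = (fderiv ℝ v (x - t)).comp (-(ContinuousLinearMap.id ℝ E2)) := by ext z; simp
      rw [e2]
      exact this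
    have hie : Integrable (fun y => fderiv ℝ v y e) := by
      refine (ig.mul_const ‖e‖).mono' ((hgm.apply_continuousLinearMap e).aestronglyMeasurable) (Eventually.of_forall fun y => ?_)
      exact ContinuousLinearMap.le_opNorm _ _
    have hie2 := shift_int hie (ψd n).continuous (ψc n) x
    have h3 : ∫ t, ψ n t * fderiv ℝ (fun t => v (x - t)) t e = - ∫ t, fderiv ℝ (ψ n) t e * v (x - t) := by
      apply integral_mul_fderiv_eq_neg_fderiv_mul_of_integrable
      · have c1 : Continuous (fun t => fderiv ℝ (ψ n) t e) := ((ψd n).continuous_fderiv one_ne_zero).clm_apply continuous_const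
        have c2 : HasCompactSupport (fun t => fderiv ℝ (ψ n) t e) := by
          apply ((ψc n).fderiv ℝ).mono
          intro t ht h0
          apply ht
          simp [h0]
        exact shift_int iv c1 c2 x
      · have : ∀ t, ψ n t * fderiv ℝ (fun t => v (x - t)) t e = -(ψ n t * fderiv ℝ v (x - t) e) := by
          intro t; rw [(hsd t).fderiv]; simp
        simp_rw [this]
        exact hie2.neg
      · exact shift_int iv (ψd n).continuous (ψc n) x
      · intro t _; exact (ψd n).differentiable one_ne_zero t
      · intro t _; exact (hsd t).differentiableAt
    have h4 : fderiv ℝ (w n) x e = ∫ t, ψ n t * fderiv ℝ v (x - t) e := by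
      have : ∀ t, ψ n t * fderiv ℝ (fun t => v (x - t)) t e = -(ψ n t * fderiv ℝ v (x - t) e) := by
        intro t; rw [(hsd t).fderiv]; simp
      simp_rw [this] at h3
      rw [integral_neg] at h3
      rw [h2]; linarith
    rw [h4, ← integral_mul_const]
    refine (norm_integral_le_integral_norm _).trans ?_
    apply integral_mono hie2.norm (hi.mul_const _)
    intro t
    simp only
    rw [norm_mul, Real.norm_of_nonneg (ψ0 n t), mul_assoc]
    exact mul_le_mul_of_nonneg_left (ContinuousLinearMap.le_opNorm _ _) (ψ0 n t)
  have wg2 : ∀ n, ∫ x, gradSq (w n) x ≤ ∫ x, gradSq v x := by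
    intro n
    have e := integral_convolution (ContinuousLinearMap.lsmul ℝ ℝ) (ψi n) hg
    have ie := (ψi n).integrable_convolution (ContinuousLinearMap.lsmul ℝ ℝ) hg
    rw [ψ1] at e
    simp only [ContinuousLinearMap.lsmul_apply, one_smul] at e
    rw [← e]
    apply integral_mono (gradSq_int (wd n) (wc n)) ie
    intro x
    have := jensen (h := fun t => ‖fderiv ℝ v (x - t)‖) (ψ0 n) (ψi n) (ψ1 n) (shift_int ig (ψd n).continuous (ψc n) x) (shift_int hg (ψd n).continuous (ψc n) x)
    exact (pow_le_pow_left₀ (norm_nonneg _) (wg n x) 2).trans this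
  have key := fatou_helper (μ := volume) (F := fun n x => w n x ^ 4) (h := fun x => v x ^ 4)
    (C := fun _ => ((∫ x, gradSq v x) + ∫ x, v x ^ 2) ^ 2 / K) (c := ((∫ x, gradSq v x) + ∫ x, v x ^ 2) ^ 2 / K)
    (fun n => int_pow (wd n).continuous (wc n) four_ne_zero)
    (fun n => Eventually.of_forall fun x => by positivity)
    (fun n => by
      refine (hP _ (wd n) (wc n)).trans ?_
      apply div_le_div_of_nonneg_right _ hK.le
      apply pow_le_pow_left₀
      · exact add_nonneg (integral_nonneg fun x => by simp only [gradSq, Pi.zero_apply]; positivity) (integral_nonneg fun x => sq_nonneg _)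
      · exact add_le_add (wg2 n) (w2 n))
    tendsto_const_nhds
    (Eventually.of_forall fun x => (wl x).pow 4)
  exact key.2

end Rea


namespace Rea
open Set Topology Metric

lemma gradSq_nonneg (u : E2 → ℝ) (x : E2) : 0 ≤ gradSq u x := by simp only [gradSq]; positivity

lemma gradSq_meas (u : E2 → ℝ) : Measurable (gradSq u) := ((measurable_fderiv ℝ u).norm).pow_const 2

lemma fderiv_scale {u : E2 → ℝ} (hu : Differentiable ℝ u) (c : ℝ) (x : E2) : fderiv ℝ (fun x => u (c • x)) x = c • fderiv ℝ u (c • x) := by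
  have a1 : HasFDerivAt (fun t : E2 => c • t) (c • (ContinuousLinearMap.id ℝ E2)) x := (hasFDerivAt_id x).const_smul c
  have := ((hu (c • x)).hasFDerivAt.comp x a1).fderiv
  have e : (fderiv ℝ u (c • x)).comp (c • (ContinuousLinearMap.id ℝ E2)) = c • fderiv ℝ u (c • x) := by ext z; simp
  rw [← e]; exact this

lemma gradSq_scale {u : E2 → ℝ} (hu : Differentiable ℝ u) (c : ℝ) (x : E2) : gradSq (fun x => u (c • x)) x = c ^ 2 * gradSq u (c • x) := by
  simp only [gradSq]
  rw [fderiv_scale hu, norm_smul, mul_pow, Real.norm_eq_abs, sq_abs]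

lemma cut_ineq {K : ℝ} (hK : 0 < K)
    (hP : ∀ v : E2 → ℝ, Differentiable ℝ v → HasCompactSupport v → Integrable (gradSq v) → (∫ x, v x ^ 4) ≤ ((∫ x, gradSq v x) + ∫ x, v x ^ 2) ^ 2 / K)
    {u : E2 → ℝ} (hu : Differentiable ℝ u) (h2 : Integrable (fun x => u x ^ 2)) (hg : Integrable (gradSq u)) :
    (∫ x, u x ^ 4) ≤ ((∫ x, gradSq u x) + ∫ x, u x ^ 2) ^ 2 / K := by
  let b : ContDiffBump (0:E2) := ⟨1, 2, by norm_num, by norm_num⟩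
  have bd : ContDiff ℝ 1 b := b.contDiff
  have bc : HasCompactSupport b := b.hasCompactSupport
  obtain ⟨L, hL⟩ := (bd.continuous_fderiv one_ne_zero).bounded_above_of_compact_support (bc.fderiv ℝ)
  have hL0 : 0 ≤ L := (norm_nonneg _).trans (hL 0)
  set c : ℕ → ℝ := fun n => 1 / ((n:ℝ) + 1) with hcdef
  have c0 : ∀ n, 0 < c n := fun n => by simp only [hcdef]; positivity
  have cl : Tendsto c atTop (𝓝 0) := tendsto_one_div_add_atTop_nhds_zero_nat (𝕜 := ℝ)
  set χ : ℕ → E2 → ℝ := fun n x => b (c n • x) with hχ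
  have χd : ∀ n, Differentiable ℝ (χ n) := fun n => (bd.differentiable one_ne_zero).comp (differentiable_id.const_smul (c n))
  have χ0 : ∀ n x, 0 ≤ χ n x := fun n x => b.nonneg
  have χ1 : ∀ n x, χ n x ≤ 1 := fun n x => b.le_one
  have χc : ∀ n, HasCompactSupport (χ n) := fun n => bc.comp_smul (c0 n).ne'
  have χg : ∀ n x, ‖fderiv ℝ (χ n) x‖ ≤ c n * L := by
    intro n x
    rw [show fderiv ℝ (χ n) x = c n • fderiv ℝ b (c n • x) from fderiv_scale (bd.differentiable one_ne_zero) _ _, norm_smul, Real.norm_of_nonneg (c0 n).le]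
    exact mul_le_mul_of_nonneg_left (hL _) (c0 n).le
  have χl : ∀ x, Tendsto (fun n => χ n x) atTop (𝓝 1) := by
    intro x
    have h1 : Tendsto (fun n => b (c n • x)) atTop (𝓝 (b ((0:ℝ) • x))) := (bd.continuous.tendsto _).comp (cl.smul_const x)
    rw [zero_smul, b.one_of_mem_closedBall (mem_closedBall_self b.rIn_pos.le)] at h1
    exact h1
  set w : ℕ → E2 → ℝ := fun n x => χ n x * u x with hw
  have wd : ∀ n, Differentiable ℝ (w n) := fun n => (χd n).mul hu
  have wc : ∀ n, HasCompactSupport (w n) := fun n => (χc n).mul_right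
  have wg : ∀ n x, gradSq (w n) x ≤ (1 + c n * L) * gradSq u x + (c n * L + (c n * L) ^ 2) * u x ^ 2 := by
    intro n x
    have e : fderiv ℝ (w n) x = χ n x • fderiv ℝ u x + u x • fderiv ℝ (χ n) x := (((χd n x).hasFDerivAt).mul (hu x).hasFDerivAt).fderiv
    have h1 : ‖fderiv ℝ (w n) x‖ ≤ ‖fderiv ℝ u x‖ + |u x| * (c n * L) := by
      rw [e]
      refine (norm_add_le _ _).trans ?_
      rw [norm_smul, norm_smul, Real.norm_of_nonneg (χ0 n x), Real.norm_eq_abs]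
      exact add_le_add (mul_le_of_le_one_left (norm_nonneg _) (χ1 n x)) (mul_le_mul_of_nonneg_left (χg n x) (abs_nonneg _))
    have h2 := pow_le_pow_left₀ (norm_nonneg _) h1 2
    simp only [gradSq]
    have h3 : 0 ≤ c n * L := mul_nonneg (c0 n).le hL0
    have h4 := mul_nonneg h3 (sq_nonneg (‖fderiv ℝ u x‖ - |u x|))
    have h5 := sq_abs (u x)
    refine h2.trans ?_
    rw [← h5]
    nlinarith
  have wgi : ∀ n, Integrable (gradSq (w n)) := by
    intro n
    refine ((hg.const_mul (1 + c n * L)).add (h2.const_mul (c n * L + (c n * L) ^ 2))).mono' (gradSq_meas _).aestronglyMeasurable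
      (Eventually.of_forall fun x => ?_)
    rw [Real.norm_of_nonneg (gradSq_nonneg _ _)]
    exact wg n x
  have w2 : ∀ n, ∫ x, w n x ^ 2 ≤ ∫ x, u x ^ 2 := by
    intro n
    apply integral_mono (int_pow (wd n).continuous (wc n) two_ne_zero) h2
    intro x
    simp only [hw]
    rw [mul_pow]
    exact mul_le_of_le_one_left (sq_nonneg _) (pow_le_one₀ (χ0 n x) (χ1 n x))
  have w3 : ∀ n, ∫ x, gradSq (w n) x ≤ (1 + c n * L) * (∫ x, gradSq u x) + (c n * L + (c n * L) ^ 2) * ∫ x, u x ^ 2 := by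
    intro n
    rw [← integral_const_mul, ← integral_const_mul, ← integral_add (hg.const_mul _) (h2.const_mul _)]
    exact integral_mono (wgi n) ((hg.const_mul _).add (h2.const_mul _)) (wg n)
  have cont : Continuous (fun c : ℝ => ((1 + c * L) * (∫ x, gradSq u x) + (c * L + (c * L) ^ 2) * (∫ x, u x ^ 2) + ∫ x, u x ^ 2) ^ 2 / K) := by fun_prop
  have lim := (cont.tendsto 0).comp cl
  simp only [zero_mul, add_zero, one_mul, zero_pow two_ne_zero] at lim
  have key := fatou_helper (μ := volume) (F := fun n x => w n x ^ 4) (h := fun x => u x ^ 4) (c := ((∫ x, gradSq u x) + ∫ x, u x ^ 2) ^ 2 / K)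
    (fun n => int_pow (wd n).continuous (wc n) four_ne_zero)
    (fun n => Eventually.of_forall fun x => by positivity)
    (fun n => by
      refine (hP _ (wd n) (wc n) (wgi n)).trans ?_
      refine div_le_div_of_nonneg_right ?_ hK.le
      refine pow_le_pow_left₀ ?_ (add_le_add (w3 n) (w2 n)) 2
      exact add_nonneg (integral_nonneg fun x => gradSq_nonneg _ _) (integral_nonneg fun x => sq_nonneg _))
    lim
    (Eventually.of_forall fun x => by
      have := ((χl x).mul_const (u x)).pow 4
      rw [one_mul] at this; exact this)
  exact key.2

lemma int_scale (f : E2 → ℝ) (c : ℝ) : ∫ x, f (c • x) = (c ^ 2)⁻¹ * ∫ x, f x := by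
  rw [Measure.integral_comp_smul]
  simp

/-- Gagliardo-Nirenberg on the unit sphere -/
lemma gn_of {K : ℝ} (hK : 0 < K)
    (hP : ∀ u : E2 → ℝ, Differentiable ℝ u → Integrable (fun x => u x ^ 2) → Integrable (gradSq u) →
      (∫ x, u x ^ 4) ≤ ((∫ x, gradSq u x) + ∫ x, u x ^ 2) ^ 2 / K)
    {u : E2 → ℝ} (hu : IsH1 u) (h1 : ∫ x, u x ^ 2 = 1) : ∫ x, u x ^ 4 ≤ 4 / K * ∫ x, gradSq u x := by
  obtain ⟨hd, i2, ig, i4⟩ := hu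
  set A := ∫ x, gradSq u x with hA
  have hA0 : 0 ≤ A := integral_nonneg fun x => gradSq_nonneg _ _
  apply le_of_forall_pos_le_add
  intro δ hδ
  set η := δ * K / 4 with hη
  have hη0 : 0 < η := by positivity
  set l := √(A + η) with hl
  have hl0 : 0 < l := Real.sqrt_pos.2 (by positivity)
  have hl2 : l ^ 2 = A + η := Real.sq_sqrt (by positivity)
  have hc : l⁻¹ ≠ 0 := by positivity
  have g := hP (fun x => u (l⁻¹ • x)) (hd.comp (show Differentiable ℝ (fun x : E2 => l⁻¹ • x) by fun_prop)) (i2.comp_smul hc)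
    (by
      have : gradSq (fun x => u (l⁻¹ • x)) = fun x => (l⁻¹) ^ 2 * gradSq u (l⁻¹ • x) := funext fun x => gradSq_scale hd _ x
      rw [this]
      exact (ig.comp_smul hc).const_mul _)
  simp_rw [gradSq_scale hd] at g
  rw [integral_const_mul, int_scale (gradSq u), int_scale (fun x => u x ^ 2), int_scale (fun x => u x ^ 4), h1, ← hA] at g
  have e1 : ((l⁻¹) ^ 2)⁻¹ = l ^ 2 := by field_simp
  have e2 : (l⁻¹) ^ 2 * (l ^ 2 * A) = A := by field_simp
  rw [e1, e2, mul_one] at g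
  have h3 : (A + l ^ 2) ^ 2 ≤ (2 * l ^ 2) ^ 2 := pow_le_pow_left₀ (by positivity) (by rw [hl2]; linarith) 2
  have h4 : l ^ 2 * ∫ x, u x ^ 4 ≤ l ^ 2 * (4 / K * l ^ 2) := by
    refine g.trans ((div_le_div_of_nonneg_right h3 hK.le).trans (le_of_eq ?_))
    field_simp; ring
  have h5 := le_of_mul_le_mul_left h4 (by positivity)
  refine h5.trans (le_of_eq ?_)
  rw [hl2, hη]; field_simp

theorem gn {q dq : ℝ → ℝ} {α : ℝ} (U : RadSol q dq α) {u : E2 → ℝ} (hu : IsH1 u) (h1 : ∫ x, u x ^ 2 = 1) :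
    ∫ x, u x ^ 4 ≤ 2 / (2 * π * ∫ r in Ioi 0, q r ^ 2 * r) * ∫ x, gradSq u x := by
  have hm := U.m_pos
  have hK : 0 < 4 * π * ∫ r in Ioi 0, q r ^ 2 * r := by positivity
  have := gn_of hK (fun u a b c => cut_ineq hK (fun v a b c => cs_ineq hK (fun w a b => c1_ineq hK (fun z a b c => nn_ineq U a b c) a b) a b c) a b c) hu h1
  convert this using 2
  field_simp

end Rea


namespace GS
open Set Topology Metric

def e0 : E2 := EuclideanSpace.single 0 1
def e1 : E2 := EuclideanSpace.single 1 1

lemma e0_0 : e0 0 = 1 := by simp [e0]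
lemma e0_1 : e0 1 = 0 := by simp [e0]
lemma e1_0 : e1 0 = 0 := by simp [e1]
lemma e1_1 : e1 1 = 1 := by simp [e1]

lemma decomp (y : E2) : y = y 0 • e0 + y 1 • e1 := by
  ext i; fin_cases i <;> simp [e0_0, e0_1, e1_0, e1_1]

lemma nsq (y : E2) : ‖y‖ ^ 2 = y 0 ^ 2 + y 1 ^ 2 := by
  rw [EuclideanSpace.norm_sq_eq]; simp

def J (y : E2) : E2 := (-y 1) • e0 + y 0 • e1

lemma rot {Q : E2 → ℝ} (hd : Differentiable ℝ Q) (hr : ∀ x y : E2, ‖x‖ = ‖y‖ → Q x = Q y) (y : E2) :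
    y 0 * fderiv ℝ Q y e1 - y 1 * fderiv ℝ Q y e0 = 0 := by
  have hγ : HasDerivAt (fun θ : ℝ => cos θ • y + sin θ • J y) (J y) 0 := by
    have := ((Real.hasDerivAt_cos 0).smul_const y).add ((Real.hasDerivAt_sin 0).smul_const (J y))
    have e : (-sin 0) • y + cos 0 • J y = J y := by simp
    rw [e] at this; exact this
  have hn : ∀ θ : ℝ, ‖cos θ • y + sin θ • J y‖ = ‖y‖ := by
    intro θ
    have : ‖cos θ • y + sin θ • J y‖ ^ 2 = ‖y‖ ^ 2 := by
      rw [nsq, nsq]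
      simp [J, e0_0, e0_1, e1_0, e1_1]
      nlinarith [sin_sq_add_cos_sq θ]
    exact (pow_left_inj₀ (norm_nonneg _) (norm_nonneg _) two_ne_zero).1 this
  have h0 : cos (0:ℝ) • y + sin (0:ℝ) • J y = y := by simp
  have h1 : HasDerivAt (fun θ : ℝ => Q (cos θ • y + sin θ • J y)) (fderiv ℝ Q (cos (0:ℝ) • y + sin (0:ℝ) • J y) (J y)) 0 :=
    (hd (cos (0:ℝ) • y + sin (0:ℝ) • J y)).hasFDerivAt.comp_hasDerivAt (0:ℝ) hγ
  have h2 : (fun θ : ℝ => Q (cos θ • y + sin θ • J y)) = fun _ => Q y := funext fun θ => hr _ _ (hn θ)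
  rw [h2, h0] at h1
  have := h1.unique (hasDerivAt_const (0:ℝ) (Q y))
  simp only [J, map_add, map_smul, smul_eq_mul] at this
  linarith

lemma e0n : ‖e0‖ = 1 := by simp [e0]
lemma re0n {r : ℝ} (hr : 0 ≤ r) : ‖r • e0‖ = r := by rw [norm_smul, e0n, Real.norm_of_nonneg hr, mul_one]

def qq (Q : E2 → ℝ) (r : ℝ) : ℝ := Q (r • e0)
def dqq (Q : E2 → ℝ) (r : ℝ) : ℝ := fderiv ℝ Q (r • e0) e0

lemma ray (r : ℝ) : HasDerivAt (fun r : ℝ => r • e0) e0 r := by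
  simpa using (hasDerivAt_id r).smul_const e0

lemma qq_d {Q : E2 → ℝ} (hd : Differentiable ℝ Q) (r : ℝ) : HasDerivAt (qq Q) (dqq Q r) r :=
  (hd (r • e0)).hasFDerivAt.comp_hasDerivAt r (ray r)

lemma Q_eq {Q : E2 → ℝ} (hr : ∀ x y : E2, ‖x‖ = ‖y‖ → Q x = Q y) (x : E2) : Q x = qq Q ‖x‖ :=
  hr _ _ (re0n (norm_nonneg x)).symm

lemma finr : Module.finrank ℝ E2 = 2 := by simp

lemma volb : (volume : Measure E2).real (ball 0 1) = π := by
  rw [Measure.real, EuclideanSpace.volume_ball_fin_two]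
  simp [pi_pos.le]

lemma polar (f : ℝ → ℝ) : ∫ x : E2, f ‖x‖ = 2 * π * ∫ r in Ioi 0, f r * r := by
  rw [integral_fun_norm_addHaar, volb, finr]
  simp only [smul_eq_mul, nsmul_eq_mul, Nat.cast_ofNat, Nat.add_one_sub_one, pow_one, mul_assoc]
  congr 2
  simp_rw [mul_comm]

lemma polar_int (f : ℝ → ℝ) : Integrable (fun x : E2 => f ‖x‖) ↔ IntegrableOn (fun r => f r * r) (Ioi 0) := by
  rw [integrable_fun_norm_addHaar, finr]
  simp only [smul_eq_mul, Nat.add_one_sub_one, pow_one]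
  simp_rw [mul_comm]

theorem radSol {Q : E2 → ℝ} (hQ : IsGroundState Q) : RadSol (qq Q) (dqq Q) (Q 0) := by
  obtain ⟨hc, hpos, hrad, hH, heq⟩ := hQ
  have hd : Differentiable ℝ Q := hc.differentiable two_ne_zero
  have hc1 : ContDiff ℝ 1 (fderiv ℝ Q) := hc.fderiv_right (by norm_num)
  have F : ∀ v : E2, Differentiable ℝ (fun y => fderiv ℝ Q y v) := fun v => (hc1.differentiable one_ne_zero).clm_apply (differentiable_const v)
  have Fc : Continuous (dqq Q) := (F e0).continuous.comp (by fun_prop : Continuous fun r : ℝ => r • e0)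
  have qc : Continuous (qq Q) := hd.continuous.comp (by fun_prop : Continuous fun r : ℝ => r • e0)
  have d0 : dqq Q 0 = 0 := by
    have h1 := qq_d hd 0
    have h2 : HasDerivAt (fun r => qq Q (-r)) (dqq Q (-0) * (-1)) 0 := (qq_d hd (-0)).comp (0:ℝ) (hasDerivAt_neg (0:ℝ))
    have h3 : (fun r => qq Q (-r)) = qq Q := by
      funext r; exact hrad _ _ (by rw [neg_smul, norm_neg])
    rw [h3] at h2
    have := h1.unique h2
    rw [neg_zero] at this; linarith
  refine ⟨fun r _ => hpos _, fun r _ => qq_d hd r, ?_, ?_, ?_, ?_⟩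
  · intro r hr
    have k1 : HasDerivAt (dqq Q) (fderiv ℝ (fun y => fderiv ℝ Q y e0) (r • e0) e0) r :=
      HasFDerivAt.comp_hasDerivAt (l := fun y => fderiv ℝ Q y e0) r ((F e0) (r • e0)).hasFDerivAt (ray r)
    have c0 : ∀ i : Fin 2, HasFDerivAt (fun y : E2 => y i) (EuclideanSpace.proj i : E2 →L[ℝ] ℝ) (r • e0) := fun i => (EuclideanSpace.proj i : E2 →L[ℝ] ℝ).hasFDerivAt
    have k2 := (((c0 0).mul (F e1 (r • e0)).hasFDerivAt).sub ((c0 1).mul (F e0 (r • e0)).hasFDerivAt))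
    have k3 : ((fun y : E2 => y 0) * fun y => fderiv ℝ Q y e1) - ((fun y : E2 => y 1) * fun y => fderiv ℝ Q y e0) = fun _ => 0 := funext fun y => rot hd hrad y
    rw [k3] at k2
    have k4 := congrArg (fun L : E2 →L[ℝ] ℝ => L e1) (k2.unique (hasFDerivAt_const (0:ℝ) (r • e0)))
    simp [e0_0, e0_1, e1_0, e1_1] at k4
    have k5 := heq (r • e0)
    simp only [lap, Fin.sum_univ_two] at k5
    change -(fderiv ℝ (fun y => fderiv ℝ Q y e0) (r • e0) e0 + fderiv ℝ (fun y => fderiv ℝ Q y e1) (r • e0) e1) + qq Q r - qq Q r ^ 3 = 0 at k5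
    have k6 : fderiv ℝ (fun y => fderiv ℝ Q y e1) (r • e0) e1 = dqq Q r / r := by
      rw [eq_div_iff hr.ne']; unfold dqq; linarith
    have : fderiv ℝ (fun y => fderiv ℝ Q y e0) (r • e0) e0 = -dqq Q r / r + qq Q r - qq Q r ^ 3 := by
      rw [k6] at k5; rw [neg_div]; linarith
    rw [← this]; exact k1
  · have := (qc.tendsto 0).mono_left (nhdsWithin_le_nhds (s := Ioi 0))
    simpa [qq] using this
  · have := (Fc.tendsto 0).mono_left (nhdsWithin_le_nhds (s := Ioi 0))
    rwa [d0] at this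
  · rw [← polar_int (fun r => qq Q r ^ 2)]
    refine hH.2.1.congr (ae_of_all _ fun x => ?_)
    simp only; rw [Q_eq hrad]

lemma mass {Q : E2 → ℝ} (hQ : IsGroundState Q) : ∫ x, Q x ^ 2 = 2 * π * ∫ r in Ioi 0, qq Q r ^ 2 * r := by
  rw [← polar (fun r => qq Q r ^ 2)]
  exact integral_congr_ae (ae_of_all _ fun x => by simp only; rw [Q_eq hQ.2.2.1])

lemma mass_pos {Q : E2 → ℝ} (hQ : IsGroundState Q) : 0 < ∫ x, Q x ^ 2 := by
  rw [mass hQ]; have := (radSol hQ).m_pos; positivity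

lemma four {Q : E2 → ℝ} (hQ : IsGroundState Q) : ∫ x, Q x ^ 4 = 2 * ∫ x, Q x ^ 2 := by
  have : ∫ x, Q x ^ 4 = 2 * π * ∫ r in Ioi 0, qq Q r ^ 4 * r := by
    rw [← polar (fun r => qq Q r ^ 4)]
    exact integral_congr_ae (ae_of_all _ fun x => by simp only; rw [Q_eq hQ.2.2.1])
  rw [this, mass hQ, (radSol hQ).four_eq]; ring

lemma grad_eq {Q : E2 → ℝ} (hQ : IsGroundState Q) {x : E2} (hx : x ≠ 0) : gradSq Q x = dqq Q ‖x‖ ^ 2 := by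
  have hd : Differentiable ℝ Q := hQ.1.differentiable two_ne_zero
  have dn : DifferentiableAt ℝ (fun x : E2 => ‖x‖) x := (differentiableAt_id).norm ℝ hx
  have h1 : HasFDerivAt (fun x : E2 => qq Q ‖x‖) (dqq Q ‖x‖ • fderiv ℝ (fun x : E2 => ‖x‖) x) x :=
    (qq_d hd ‖x‖).comp_hasFDerivAt x dn.hasFDerivAt
  have h2 : (fun x : E2 => qq Q ‖x‖) = Q := funext fun x => (Q_eq hQ.2.2.1 x).symm
  rw [h2] at h1
  have h3 : ‖fderiv ℝ (fun x : E2 => ‖x‖) x‖ = 1 := norm_fderiv_norm dn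
  rw [gradSq, h1.fderiv, norm_smul, h3, mul_one, Real.norm_eq_abs, sq_abs]

lemma grad {Q : E2 → ℝ} (hQ : IsGroundState Q) : ∫ x, gradSq Q x = ∫ x, Q x ^ 2 := by
  have : ∫ x, gradSq Q x = 2 * π * ∫ r in Ioi 0, dqq Q r ^ 2 * r := by
    rw [← polar (fun r => dqq Q r ^ 2)]
    refine integral_congr_ae ?_
    have : ∀ᵐ x : E2, x ≠ 0 := by
      simp [ae_iff]
    filter_upwards [this] with x hx using grad_eq hQ hx
  rw [this, mass hQ, (radSol hQ).dsq_eq]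

/-- Gagliardo-Nirenberg with the sharp constant. -/
theorem gnQ {Q : E2 → ℝ} (hQ : IsGroundState Q) {u : E2 → ℝ} (hu : IsH1 u) (h1 : ∫ x, u x ^ 2 = 1) :
    ∫ x, u x ^ 4 ≤ 2 / (∫ x, Q x ^ 2) * ∫ x, gradSq u x := by
  rw [mass hQ]; exact Rea.gn (radSol hQ) hu h1

/-- moments -/
lemma moment {Q : E2 → ℝ} (hQ : IsGroundState Q) {k : ℝ} (hk : 0 ≤ k) : Integrable (fun x => ‖x‖ ^ k * Q x ^ 2) := by
  have := (polar_int (fun r => r ^ k * qq Q r ^ 2)).2 (by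
    refine ((radSol hQ).sq_int (k := k + 1) (by positivity)).congr_fun (fun r (hr : 0 < r) => ?_) measurableSet_Ioi
    simp only; rw [rpow_add hr, rpow_one]; ring)
  refine this.congr (ae_of_all _ fun x => ?_)
  simp only; rw [Q_eq hQ.2.2.1]

end GS


namespace Tr
open Set Topology Metric

lemma gradSq_smul {u : E2 → ℝ} (hu : Differentiable ℝ u) (c : ℝ) (x : E2) : gradSq (fun x => c * u x) x = c ^ 2 * gradSq u x := by
  simp only [gradSq]
  rw [fderiv_const_mul (hu x), norm_smul, mul_pow, Real.norm_eq_abs, sq_abs]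

lemma gradSq_shift (u : E2 → ℝ) (z x : E2) : gradSq (fun x => u (x - z)) x = gradSq u (x - z) := by
  simp only [gradSq]
  rw [fderiv_comp_sub]

lemma int_ss (f : E2 → ℝ) (c : ℝ) (z : E2) : ∫ x, f (c • (x - z)) = (c ^ 2)⁻¹ * ∫ x, f x := by
  rw [integral_sub_right_eq_self (fun x => f (c • x)) z, Rea.int_scale]

lemma int_ss' {f : E2 → ℝ} (hf : Integrable f) {c : ℝ} (hc : c ≠ 0) (z : E2) : Integrable (fun x => f (c • (x - z))) :=
  (hf.comp_smul hc).comp_sub_right z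

lemma gradSq_ss {u : E2 → ℝ} (hu : Differentiable ℝ u) (c k : ℝ) (z x : E2) :
    gradSq (fun x => k * u (c • (x - z))) x = k ^ 2 * c ^ 2 * gradSq u (c • (x - z)) := by
  rw [gradSq_smul (u := fun x => u (c • (x - z))) (hu.comp (by fun_prop)), gradSq_shift (fun x => u (c • x)), Rea.gradSq_scale hu, mul_assoc]

lemma poly_int {Q : E2 → ℝ} (hQ : IsGroundState Q) {S : ℝ} (hS : 0 ≤ S) : Integrable (fun x => (1 + ‖x‖) ^ S * Q x ^ 2) := by
  have h1 : Integrable (fun x => 2 ^ S * (Q x ^ 2 + ‖x‖ ^ S * Q x ^ 2)) := (hQ.2.2.2.1.2.1.add (GS.moment hQ hS)).const_mul _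
  refine h1.mono' ?_ (ae_of_all _ fun x => ?_)
  · have : Continuous (fun x : E2 => (1 + ‖x‖) ^ S) := by
      refine Continuous.rpow_const (by fun_prop) fun x => Or.inl (by positivity)
    exact (this.mul (hQ.1.continuous.pow 2)).aestronglyMeasurable
  · rw [Real.norm_of_nonneg (by positivity)]
    have k : (1 + ‖x‖) ^ S ≤ 2 ^ S * (1 + ‖x‖ ^ S) := by
      rcases le_total ‖x‖ 1 with h | h
      · calc (1 + ‖x‖) ^ S ≤ 2 ^ S := rpow_le_rpow (by positivity) (by linarith) hS
          _ ≤ _ := le_mul_of_one_le_right (by positivity) (by have : 0 ≤ ‖x‖ ^ S := by positivity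
                                                              linarith)
      · calc (1 + ‖x‖) ^ S ≤ (2 * ‖x‖) ^ S := rpow_le_rpow (by positivity) (by linarith) hS
          _ = 2 ^ S * ‖x‖ ^ S := mul_rpow (by norm_num) (by positivity)
          _ ≤ _ := mul_le_mul_of_nonneg_left (by linarith) (by positivity)
    calc _ ≤ 2 ^ S * (1 + ‖x‖ ^ S) * Q x ^ 2 := mul_le_mul_of_nonneg_right k (by positivity)
      _ = _ := by ring

lemma pot_bound {n : ℕ} (pts : Fin n → E2) (pe : Fin n → ℝ) (hpe : ∀ i, 0 < pe i) (i : Fin n) {τ0 : ℝ} (h0 : 0 < τ0) :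
    ∃ K, 0 < K ∧ ∀ τ, τ0 ≤ τ → ∀ x : E2, ∏ j, ‖x - pts j‖ ^ pe j ≤ K * τ ^ (-pe i) * (1 + ‖τ • (x - pts i)‖) ^ (∑ j, pe j) := by
  set D := ∑ j, ‖pts i - pts j‖ with hD
  have hD0 : 0 ≤ D := Finset.sum_nonneg fun _ _ => norm_nonneg _
  obtain ⟨L, hL⟩ : ∃ L, L = 1 + τ0⁻¹ + D := ⟨_, rfl⟩
  have hL0 : 1 ≤ L := by have : 0 < τ0⁻¹ := by positivity
                         linarith
  have hLp : 0 < L := by linarith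
  refine ⟨L ^ (∑ j, pe j), rpow_pos_of_pos hLp _, fun τ hτ x => ?_⟩
  have ht : 0 < τ := h0.trans_le hτ
  obtain ⟨r, hr⟩ : ∃ r, r = ‖τ • (x - pts i)‖ := ⟨_, rfl⟩
  rw [← hr]
  have hr' : r = τ * ‖x - pts i‖ := by rw [hr, norm_smul, Real.norm_of_nonneg ht.le]
  have hr0 : 0 ≤ r := hr ▸ norm_nonneg _
  have hb : 0 < L * (1 + r) := mul_pos hLp (by linarith)
  have key : ∀ j, ‖x - pts j‖ ^ pe j ≤ (if j = i then τ ^ (-pe i) else 1) * (L * (1 + r)) ^ pe j := by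
    intro j
    split_ifs with hj
    · subst hj
      rw [rpow_neg ht.le, ← inv_rpow ht.le, ← mul_rpow (by positivity) (by positivity)]
      refine rpow_le_rpow (by positivity) ?_ (hpe j).le
      rw [show ‖x - pts j‖ = τ⁻¹ * r by rw [hr']; field_simp]
      refine mul_le_mul_of_nonneg_left ?_ (by positivity)
      nlinarith
    · rw [one_mul]
      refine rpow_le_rpow (by positivity) ?_ (hpe j).le
      have h1 : ‖x - pts j‖ ≤ ‖x - pts i‖ + ‖pts i - pts j‖ := by
        have := norm_add_le (x - pts i) (pts i - pts j); simpa using this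
      have h2 : ‖pts i - pts j‖ ≤ D := Finset.single_le_sum (f := fun j => ‖pts i - pts j‖) (fun _ _ => norm_nonneg _) (Finset.mem_univ j)
      have h3 : ‖x - pts i‖ ≤ τ0⁻¹ * r := by
        rw [hr', ← mul_assoc]
        refine le_mul_of_one_le_left (norm_nonneg _) ?_
        rw [inv_mul_eq_div, one_le_div h0]; exact hτ
      have h4 : 0 < τ0⁻¹ := by positivity
      nlinarith [mul_nonneg hD0 hr0]
  calc ∏ j, ‖x - pts j‖ ^ pe j ≤ ∏ j, ((if j = i then τ ^ (-pe i) else 1) * (L * (1 + r)) ^ pe j) :=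
        Finset.prod_le_prod (fun _ _ => by positivity) fun j _ => key j
    _ = τ ^ (-pe i) * (L * (1 + r)) ^ (∑ j, pe j) := by
        rw [Finset.prod_mul_distrib, Finset.prod_ite_eq' Finset.univ i, if_pos (Finset.mem_univ i), Real.rpow_sum_of_pos hb]
    _ = _ := by rw [mul_rpow (by positivity) (by positivity)]; ring

theorem trial {Q : E2 → ℝ} (hQ : IsGroundState Q) {n : ℕ}
    {pts : Fin n → E2} {pe : Fin n → ℝ} (hpe : ∀ i, 0 < pe i)
    {h : E2 → ℝ} {C' : ℝ} (hC : 0 < C') (hh : ∀ x, C' < h x ∧ h x < 1 / C')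
    {V : E2 → ℝ} (hV : ∀ x, V x = h x * ∏ i, ‖x - pts i‖ ^ pe i)
    {p : ℝ} (i : Fin n) (hi : pe i = p) (hm : AEStronglyMeasurable V) :
    ∃ M : ℝ, 0 < M ∧ ∀ a : ℝ, 0 ≤ a → a < (∫ x : E2, Q x ^ 2) → ∃ v, InH V v ∧ (∫ x, v x ^ 2) = 1 ∧
      Ea V a v ≤ M * ((∫ x : E2, Q x ^ 2) - a) ^ (p / (2 + p)) := by
  have hA := GS.mass_pos hQ
  have h4 := GS.four hQ
  have hg := GS.grad hQ
  set A := ∫ x, Q x ^ 2 with hAdef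
  have hp : 0 < p := hi ▸ hpe i
  set τ0 := A ^ (-(1 / (2 + p))) with hτ0
  have ht0 : 0 < τ0 := by positivity
  obtain ⟨K, hK, hb⟩ := pot_bound pts pe hpe i ht0
  rw [hi] at hb
  set S := ∑ j, pe j with hS
  have hS0 : 0 ≤ S := Finset.sum_nonneg fun j _ => (hpe j).le
  have hG := poly_int hQ hS0
  set G := ∫ x : E2, (1 + ‖x‖) ^ S * Q x ^ 2 with hGdef
  have hG0 : 0 ≤ G := integral_nonneg fun x => by positivity
  have hd : Differentiable ℝ Q := hQ.1.differentiable two_ne_zero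
  obtain ⟨-, i2, ig, i4⟩ := hQ.2.2.2.1
  refine ⟨1 / A + K * G / (C' * A), by positivity, fun a ha haA => ?_⟩
  set d := A - a with hdd
  have hd0 : 0 < d := by linarith
  set τ := d ^ (-(1 / (2 + p))) with hτ
  have ht : 0 < τ := by positivity
  have htt : τ0 ≤ τ := rpow_le_rpow_of_nonpos hd0 (by linarith) (by rw [neg_nonpos]; positivity)
  have e1 : τ ^ 2 * d = d ^ (p / (2 + p)) := by
    have : τ ^ 2 = d ^ (-(2 / (2 + p))) := by
      rw [hτ, ← rpow_natCast, ← rpow_mul hd0.le]; congr 1; push_cast; ring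
    rw [this]
    nth_rewrite 2 [← rpow_one d]
    rw [← rpow_add hd0]; congr 1; field_simp; ring
  have e2 : τ ^ (-p) = d ^ (p / (2 + p)) := by
    rw [hτ, ← rpow_mul hd0.le]; congr 1; field_simp
  set k := τ / √A with hk
  have hsA : 0 < √A := Real.sqrt_pos.2 hA
  have hk2 : k ^ 2 = τ ^ 2 / A := by rw [hk, div_pow, Real.sq_sqrt hA.le]
  set v : E2 → ℝ := fun x => k * Q (τ • (x - pts i)) with hv
  have v2 : (fun x => v x ^ 2) = fun x => k ^ 2 * Q (τ • (x - pts i)) ^ 2 := funext fun x => by simp only [hv]; ring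
  have v4 : (fun x => v x ^ 4) = fun x => k ^ 4 * Q (τ • (x - pts i)) ^ 4 := funext fun x => by simp only [hv]; ring
  have vg : gradSq v = fun x => k ^ 2 * τ ^ 2 * gradSq Q (τ • (x - pts i)) := funext fun x => gradSq_ss hd _ _ _ _
  have I2 : ∫ x, v x ^ 2 = 1 := by
    rw [v2, integral_const_mul, int_ss (fun x => Q x ^ 2), ← hAdef, hk2]; field_simp
  have Ig : ∫ x, gradSq v x = τ ^ 2 := by
    rw [vg, integral_const_mul, int_ss (gradSq Q), hg, hk2]; field_simp
  have I4 : ∫ x, v x ^ 4 = 2 * τ ^ 2 / A := by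
    rw [v4, integral_const_mul, int_ss (fun x => Q x ^ 4), h4, show k ^ 4 = (k ^ 2) ^ 2 by ring, hk2]; field_simp
  have vd : Differentiable ℝ v := (hd.comp (show Differentiable ℝ (fun x : E2 => τ • (x - pts i)) by fun_prop)).const_mul k
  have B : ∀ x, ‖V x * v x ^ 2‖ ≤ (1 / C' * K * τ ^ (-p) * k ^ 2) * ((1 + ‖τ • (x - pts i)‖) ^ S * Q (τ • (x - pts i)) ^ 2) := by
    intro x
    have hP : 0 ≤ ∏ j, ‖x - pts j‖ ^ pe j := Finset.prod_nonneg fun j _ => by positivity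
    have hx := hh x
    rw [Real.norm_of_nonneg (by rw [hV]; exact mul_nonneg (mul_nonneg (by linarith) hP) (sq_nonneg _)), hV]
    have : h x * ∏ j, ‖x - pts j‖ ^ pe j ≤ 1 / C' * (K * τ ^ (-p) * (1 + ‖τ • (x - pts i)‖) ^ S) :=
      mul_le_mul hx.2.le (hb τ htt x) hP (by positivity)
    calc _ ≤ 1 / C' * (K * τ ^ (-p) * (1 + ‖τ • (x - pts i)‖) ^ S) * v x ^ 2 := mul_le_mul_of_nonneg_right this (sq_nonneg _)
      _ = _ := by simp only [hv]; ring
  have iB := (int_ss' hG ht.ne' (pts i)).const_mul (1 / C' * K * τ ^ (-p) * k ^ 2)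
  have iV : Integrable (fun x => V x * v x ^ 2) :=
    iB.mono' (hm.mul (vd.continuous.pow 2).aestronglyMeasurable) (ae_of_all _ B)
  have IV : ∫ x, V x * v x ^ 2 ≤ K * G / (C' * A) * d ^ (p / (2 + p)) := by
    refine (integral_mono iV iB fun x => (le_abs_self _).trans (B x)).trans (le_of_eq ?_)
    rw [integral_const_mul, int_ss (fun x => (1 + ‖x‖) ^ S * Q x ^ 2), ← hGdef, hk2, e2]; field_simp
  refine ⟨v, ⟨⟨vd, ?_, ?_, ?_⟩, iV⟩, I2, ?_⟩
  · rw [v2]; exact (int_ss' i2 ht.ne' _).const_mul _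
  · rw [vg]; exact (int_ss' ig ht.ne' _).const_mul _
  · rw [v4]; exact (int_ss' i4 ht.ne' _).const_mul _
  · rw [Ea, Ig, I4]
    have : τ ^ 2 - a / 2 * (2 * τ ^ 2 / A) = 1 / A * d ^ (p / (2 + p)) := by
      rw [← e1, hdd]; field_simp
    rw [add_mul]; linarith

end Tr


namespace Mn
open Set Topology Metric

lemma hom {V u v : E2 → ℝ} {a : ℝ} (hu : IsMinimizer V a u) (hv : InH V v) (hm : 0 < ∫ x, v x ^ 2) :
    0 ≤ ((∫ x, gradSq v x) + ∫ x, V x * v x ^ 2) * (∫ x, v x ^ 2) - a / 2 * (∫ x, v x ^ 4) - Ea V a u * (∫ x, v x ^ 2) ^ 2 := by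
  obtain ⟨⟨vd, i2, ig, i4⟩, iV⟩ := hv
  set m := ∫ x, v x ^ 2 with hmd
  set k := (√m)⁻¹ with hk
  have hk2 : k ^ 2 = m⁻¹ := by rw [hk, inv_pow, Real.sq_sqrt hm.le]
  have w2 : (fun x => (k * v x) ^ 2) = fun x => k ^ 2 * v x ^ 2 := funext fun x => by ring
  have w4 : (fun x => (k * v x) ^ 4) = fun x => k ^ 4 * v x ^ 4 := funext fun x => by ring
  have wV : (fun x => V x * (k * v x) ^ 2) = fun x => k ^ 2 * (V x * v x ^ 2) := funext fun x => by ring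
  have wg : gradSq (fun x => k * v x) = fun x => k ^ 2 * gradSq v x := funext fun x => Tr.gradSq_smul vd k x
  have := hu.2.2 (fun x => k * v x) ⟨⟨vd.const_mul k, by rw [w2]; exact i2.const_mul _, by rw [wg]; exact ig.const_mul _,
    by rw [w4]; exact i4.const_mul _⟩, by rw [wV]; exact iV.const_mul _⟩ (by
      rw [w2, integral_const_mul, ← hmd, hk2]; field_simp)
  rw [show Ea V a (fun x => k * v x) = (∫ x, k ^ 2 * gradSq v x) + (∫ x, k ^ 2 * (V x * v x ^ 2)) - a / 2 * ∫ x, k ^ 4 * v x ^ 4 by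
    rw [Ea, wg, w4, wV]] at this
  rw [integral_const_mul, integral_const_mul, integral_const_mul, show k ^ 4 = (k ^ 2) ^ 2 by ring, hk2] at this
  have h2 := mul_le_mul_of_nonneg_right this (sq_nonneg m)
  have e : (m⁻¹ * (∫ x, gradSq v x) + m⁻¹ * (∫ x, V x * v x ^ 2) - a / 2 * (m⁻¹ ^ 2 * ∫ x, v x ^ 4)) * m ^ 2 =
    ((∫ x, gradSq v x) + ∫ x, V x * v x ^ 2) * m - a / 2 * (∫ x, v x ^ 4) := by field_simp
  linarith

lemma psq_deriv (t : ℝ) : HasDerivAt (fun t : ℝ => (max t 0) ^ 2) (2 * max t 0) t := by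
  rcases lt_trichotomy t 0 with h | h | h
  · rw [max_eq_right h.le, mul_zero]
    refine (hasDerivAt_const t (0:ℝ)).congr_of_eventuallyEq ?_
    filter_upwards [Iio_mem_nhds h] with s hs
    rw [max_eq_right (le_of_lt hs)]; norm_num
  · subst h
    rw [max_self, mul_zero]
    have : (fun t : ℝ => (max t 0) ^ 2) =O[𝓝 0] fun x => ‖x - 0‖ ^ 2 := by
      refine Asymptotics.IsBigO.of_bound 1 (Eventually.of_forall fun x => ?_)
      rw [norm_pow, norm_pow, norm_norm, one_mul, sub_zero]
      refine pow_le_pow_left₀ (norm_nonneg _) ?_ 2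
      rw [Real.norm_of_nonneg (le_max_right _ _), Real.norm_eq_abs]
      exact max_le (le_abs_self _) (abs_nonneg _)
    have h2 := (this.hasFDerivAt (𝕜 := ℝ) (by norm_num)).hasDerivAt
    simpa using h2
  · rw [max_eq_left h.le]
    have : HasDerivAt (fun t : ℝ => t ^ 2) (2 * t) t := by simpa using hasDerivAt_pow 2 t
    refine this.congr_of_eventuallyEq ?_
    filter_upwards [Ioi_mem_nhds h] with s hs
    rw [max_eq_left (le_of_lt hs)]

/-- smooth positive part -/
def pp (d t : ℝ) : ℝ := RC.sa d (max t 0)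

lemma pp_deriv {d : ℝ} (hd : 0 < d) (t : ℝ) : HasDerivAt (pp d) (max t 0 / √((max t 0) ^ 2 + d ^ 2)) t := by
  have h1 := (psq_deriv t).add_const (d ^ 2)
  have h2 := (h1.sqrt (by positivity)).sub_const d
  have e : 2 * max t 0 / (2 * √(max t 0 ^ 2 + d ^ 2)) = max t 0 / √((max t 0) ^ 2 + d ^ 2) := by
    rw [mul_div_mul_left _ _ two_ne_zero]
  rw [← e]; exact h2

lemma pp_zero {d t : ℝ} (hd : 0 < d) (ht : t ≤ 0) : pp d t = 0 := by
  have : √(d ^ 2) = d := Real.sqrt_sq hd.le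
  simp [pp, RC.sa, max_eq_right ht, this]

lemma dct {f : E2 → ℝ} (hf : Integrable f) {S : Set E2} (hS : MeasurableSet S) {κ : ℕ → E2 → ℝ}
    (hm : ∀ n, Measurable (κ n)) (h0 : ∀ n x, 0 ≤ κ n x) (h1 : ∀ n x, κ n x ≤ 1)
    (hz : ∀ n x, x ∉ S → κ n x = 0) (hl : ∀ x ∈ S, Tendsto (fun n => κ n x) atTop (𝓝 1)) :
    Tendsto (fun n => ∫ x, κ n x * f x) atTop (𝓝 (∫ x in S, f x)) := by
  rw [← integral_indicator hS]
  refine tendsto_integral_of_dominated_convergence (fun x => ‖f x‖) (fun n => (hm n).aestronglyMeasurable.mul hf.aestronglyMeasurable) hf.norm ?_ ?_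
  · intro n; refine ae_of_all _ fun x => ?_
    rw [norm_mul, Real.norm_of_nonneg (h0 n x)]
    exact mul_le_of_le_one_left (norm_nonneg _) (h1 n x)
  · refine ae_of_all _ fun x => ?_
    by_cases hx : x ∈ S
    · rw [indicator_of_mem hx]; simpa using (hl x hx).mul_const (f x)
    · rw [indicator_of_notMem hx]; simp [hz _ x hx]

lemma kap_int {f κ : E2 → ℝ} (hf : Integrable f) (hm : Measurable κ) (h0 : ∀ x, 0 ≤ κ x) (h1 : ∀ x, κ x ≤ 1) :
    Integrable (fun x => κ x * f x) := by
  refine hf.norm.mono' (hm.aestronglyMeasurable.mul hf.aestronglyMeasurable) (ae_of_all _ fun x => ?_)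
  rw [norm_mul, Real.norm_of_nonneg (h0 x)]
  exact mul_le_of_le_one_left (norm_nonneg _) (h1 x)

lemma setpos {u : E2 → ℝ} (hu : Continuous u) {k : ℕ} (hk : k ≠ 0) (hk2 : Even k) (hi : Integrable (fun x => u x ^ k)) (hne : {x | 0 < u x}.Nonempty) :
    0 < ∫ x in {x | 0 < u x}, u x ^ k := by
  have ho : IsOpen {x | 0 < u x} := isOpen_lt continuous_const hu
  rw [setIntegral_pos_iff_support_of_nonneg_ae (ae_of_all _ fun x => hk2.pow_nonneg _) hi.integrableOn]
  have : Function.support (fun x => u x ^ k) ∩ {x | 0 < u x} = {x | 0 < u x} := by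
    apply inter_eq_right.2
    intro x hx
    exact pow_ne_zero k (ne_of_gt hx)
  rw [this]
  exact ho.measure_pos volume hne

lemma half {V u : E2 → ℝ} {a : ℝ} (hu : IsMinimizer V a u) (hne : {x | 0 < u x}.Nonempty) :
    0 ≤ ((∫ x in {x | 0 < u x}, gradSq u x) + ∫ x in {x | 0 < u x}, V x * u x ^ 2) * (∫ x in {x | 0 < u x}, u x ^ 2)
      - a / 2 * (∫ x in {x | 0 < u x}, u x ^ 4) - Ea V a u * (∫ x in {x | 0 < u x}, u x ^ 2) ^ 2 := by
  obtain ⟨⟨ud, i2, ig, i4⟩, iV⟩ := hu.1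
  have uc := ud.continuous
  set S := {x | 0 < u x} with hSd
  have hS : MeasurableSet S := (isOpen_lt continuous_const uc).measurableSet
  set d : ℕ → ℝ := fun n => 1 / ((n:ℝ) + 1) with hd
  have d0 : ∀ n, 0 < d n := fun n => by simp only [hd]; positivity
  have dl : Tendsto d atTop (𝓝 0) := tendsto_one_div_add_atTop_nhds_zero_nat (𝕜 := ℝ)
  set v : ℕ → E2 → ℝ := fun n x => pp (d n) (u x) with hv
  set κ : ℕ → E2 → ℝ := fun n x => (v n x / u x) ^ 2 with hκ
  set κ' : ℕ → E2 → ℝ := fun n x => (max (u x) 0 / √((max (u x) 0) ^ 2 + d n ^ 2)) ^ 2 with hκ'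
  have vd : ∀ n, Differentiable ℝ (v n) := fun n x =>
    ((pp_deriv (d0 n) (u x)).comp_hasFDerivAt x (ud x).hasFDerivAt).differentiableAt
  have vz : ∀ n x, x ∉ S → v n x = 0 := fun n x hx => pp_zero (d0 n) (not_lt.1 hx)
  have vn : ∀ n x, 0 ≤ v n x := fun n x => RC.sa_nonneg (d0 n) _
  have vle : ∀ n x, x ∈ S → v n x ≤ u x := by
    intro n x hx
    have h0 : 0 < u x := hx
    exact (RC.sa_le (d0 n) (max (u x) 0)).trans (by rw [abs_of_nonneg (le_max_right _ _), max_eq_left h0.le])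
  have vt : ∀ x, x ∈ S → Tendsto (fun n => v n x) atTop (𝓝 (u x)) := by
    intro x hx
    have h0 : 0 < u x := hx
    have := RC.sa_tendsto (max (u x) 0)
    have e : |max (u x) 0| = u x := by rw [abs_of_nonneg (le_max_right _ _), max_eq_left h0.le]
    rw [e] at this; exact this
  have vg : ∀ n, gradSq (v n) = fun x => κ' n x * gradSq u x := by
    intro n; funext x
    have := ((pp_deriv (d0 n) (u x)).comp_hasFDerivAt x (ud x).hasFDerivAt).fderiv
    have e : fderiv ℝ (v n) x = (max (u x) 0 / √((max (u x) 0) ^ 2 + d n ^ 2)) • fderiv ℝ u x := this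
    simp only [gradSq, hκ']
    rw [e, norm_smul, mul_pow, Real.norm_eq_abs, sq_abs]
  have κm : ∀ n, Measurable (κ n) := fun n => (((vd n).continuous.measurable).div uc.measurable).pow_const 2
  have κ'm : ∀ n, Measurable (κ' n) := fun n => by
    refine Measurable.pow_const (Measurable.div ?_ ?_) 2
    · exact (uc.max continuous_const).measurable
    · exact (by fun_prop : Continuous fun x => √((max (u x) 0) ^ 2 + d n ^ 2)).measurable
  have κ0 : ∀ n x, 0 ≤ κ n x := fun n x => sq_nonneg _
  have κ'0 : ∀ n x, 0 ≤ κ' n x := fun n x => sq_nonneg _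
  have κz : ∀ n x, x ∉ S → κ n x = 0 := fun n x hx => by simp [hκ, vz n x hx]
  have κ'z : ∀ n x, x ∉ S → κ' n x = 0 := fun n x hx => by
    have h0 : u x ≤ 0 := not_lt.1 hx
    simp [hκ', max_eq_right h0]
  have κ1 : ∀ n x, κ n x ≤ 1 := by
    intro n x
    by_cases hx : x ∈ S
    · have h0 : 0 < u x := hx
      exact pow_le_one₀ (div_nonneg (vn n x) h0.le) ((div_le_one h0).2 (vle n x hx))
    · rw [κz n x hx]; norm_num
  have κ'1 : ∀ n x, κ' n x ≤ 1 := fun n x => RC.sa_deriv_le (d0 n) _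
  have κt : ∀ x ∈ S, Tendsto (fun n => κ n x) atTop (𝓝 1) := by
    intro x hx
    have h0 : 0 < u x := hx
    have := ((vt x hx).div_const (u x)).pow 2
    rwa [div_self h0.ne', one_pow] at this
  have κ't : ∀ x ∈ S, Tendsto (fun n => κ' n x) atTop (𝓝 1) := by
    intro x hx
    have h0 : 0 < u x := hx
    have h1 : Tendsto (fun n => √((max (u x) 0) ^ 2 + d n ^ 2)) atTop (𝓝 √((max (u x) 0) ^ 2 + 0 ^ 2)) :=
      ((dl.pow 2).const_add _).sqrt
    have e : √((max (u x) 0) ^ 2 + 0 ^ 2) = u x := by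
      rw [max_eq_left h0.le, zero_pow two_ne_zero, add_zero, Real.sqrt_sq h0.le]
    rw [e] at h1
    have := ((tendsto_const_nhds (x := max (u x) 0)).div h1 h0.ne').pow 2
    have e2 : (max (u x) 0 / u x) ^ 2 = 1 := by rw [max_eq_left h0.le, div_self h0.ne', one_pow]
    rw [e2] at this; exact this
  have v2 : ∀ n, (fun x => v n x ^ 2) = fun x => κ n x * u x ^ 2 := by
    intro n; funext x
    by_cases hx : x ∈ S
    · have h0 : u x ≠ 0 := ne_of_gt hx
      simp only [hκ]; field_simp
    · simp [κz n x hx, vz n x hx]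
  have v4 : ∀ n, (fun x => v n x ^ 4) = fun x => κ n x ^ 2 * u x ^ 4 := by
    intro n; funext x
    have : v n x ^ 2 = κ n x * u x ^ 2 := congrFun (v2 n) x
    rw [show v n x ^ 4 = (v n x ^ 2) ^ 2 by ring, this]; ring
  have vV : ∀ n, (fun x => V x * v n x ^ 2) = fun x => κ n x * (V x * u x ^ 2) := by
    intro n; funext x
    have : v n x ^ 2 = κ n x * u x ^ 2 := congrFun (v2 n) x
    rw [this]; ring
  have T2 := dct i2 hS κm κ0 κ1 κz κt
  have Tg := dct ig hS κ'm κ'0 κ'1 κ'z κ't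
  have TV := dct iV hS κm κ0 κ1 κz κt
  have T4 := dct (κ := fun n x => κ n x ^ 2) i4 hS (fun n => (κm n).pow_const 2) (fun n x => sq_nonneg _) (fun n x => pow_le_one₀ (κ0 n x) (κ1 n x))
    (fun n x hx => by simp [κz n x hx]) (fun x hx => by simpa using (κt x hx).pow 2)
  have hm := setpos uc two_ne_zero even_two i2 hne
  have TT := (((Tg.add TV).mul T2).sub (T4.const_mul (a / 2))).sub ((T2.pow 2).const_mul (Ea V a u))
  refine ge_of_tendsto TT ?_
  filter_upwards [T2.eventually_const_lt hm] with n hn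
  have H : InH V (v n) := ⟨⟨vd n, by rw [v2]; exact kap_int i2 (κm n) (κ0 n) (κ1 n), by rw [vg]; exact kap_int ig (κ'm n) (κ'0 n) (κ'1 n),
    by rw [v4]; exact kap_int i4 ((κm n).pow_const 2) (fun x => sq_nonneg _) (fun x => pow_le_one₀ (κ0 n x) (κ1 n x))⟩,
    by rw [vV]; exact kap_int iV (κm n) (κ0 n) (κ1 n)⟩
  have := hom hu H (by rw [v2]; exact hn)
  rw [v2, v4, vV, vg] at this
  exact this

lemma gradSq_neg (u : E2 → ℝ) : gradSq (fun x => -u x) = gradSq u := by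
  funext x; simp only [gradSq]; rw [fderiv_fun_neg, norm_neg]

lemma neg_min {V u : E2 → ℝ} {a : ℝ} (hu : IsMinimizer V a u) : IsMinimizer V a (fun x => -u x) := by
  have e2 : ∀ x, (-u x) ^ 2 = u x ^ 2 := fun x => by ring
  have e4 : ∀ x, (-u x) ^ 4 = u x ^ 4 := fun x => by ring
  obtain ⟨⟨⟨ud, i2, ig, i4⟩, iV⟩, h1, hm⟩ := hu
  refine ⟨⟨⟨ud.neg, by simpa only [e2] using i2, by rw [gradSq_neg]; exact ig, by simpa only [e4] using i4⟩, by simpa only [e2] using iV⟩,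
    by simpa only [e2] using h1, ?_⟩
  have : Ea V a (fun x => -u x) = Ea V a u := by
    simp only [Ea, e2, e4, gradSq_neg]
  rw [this]; exact hm

lemma split {u f : E2 → ℝ} (hu : Continuous u) (hf : Integrable f) (h0 : ∀ x, 0 ≤ f x) :
    (∫ x in {x | 0 < u x}, f x) + (∫ x in {x | 0 < -u x}, f x) ≤ ∫ x, f x := by
  have m1 : MeasurableSet {x | 0 < u x} := (isOpen_lt continuous_const hu).measurableSet
  have m2 : MeasurableSet {x | 0 < -u x} := (isOpen_lt continuous_const hu.neg).measurableSet
  rw [← setIntegral_union ?_ m2 hf.integrableOn hf.integrableOn]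
  · exact setIntegral_le_integral hf (ae_of_all _ h0)
  · rw [Set.disjoint_left]; intro x (h1 : 0 < u x) (h2 : 0 < -u x); linarith

lemma split_eq {u f : E2 → ℝ} (hu : Continuous u) (hf : Integrable f) (h0 : ∀ x, u x = 0 → f x = 0) :
    (∫ x in {x | 0 < u x}, f x) + (∫ x in {x | 0 < -u x}, f x) = ∫ x, f x := by
  have m1 : MeasurableSet {x | 0 < u x} := (isOpen_lt continuous_const hu).measurableSet
  have m2 : MeasurableSet {x | 0 < -u x} := (isOpen_lt continuous_const hu.neg).measurableSet
  rw [← setIntegral_union ?_ m2 hf.integrableOn hf.integrableOn]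
  · refine setIntegral_eq_integral_of_forall_compl_eq_zero fun x hx => h0 x ?_
    simp only [mem_union, mem_ofPred_eq, not_or] at hx
    linarith [hx.1, hx.2]
  · rw [Set.disjoint_left]; intro x (h1 : 0 < u x) (h2 : 0 < -u x); linarith

theorem sign {V u : E2 → ℝ} {a : ℝ} (ha : 0 < a) (hu : IsMinimizer V a u) : (∀ x, 0 ≤ u x) ∨ ∀ x, 0 ≤ -u x := by
  by_contra hcon
  push Not at hcon
  obtain ⟨⟨y, hy⟩, ⟨z, hz⟩⟩ := hcon
  have n1 : {x | 0 < u x}.Nonempty := ⟨z, by simpa using hz⟩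
  have n2 : {x | 0 < -u x}.Nonempty := ⟨y, by simpa using hy⟩
  obtain ⟨⟨⟨ud, i2, ig, i4⟩, iV⟩, h1, hm⟩ := id hu
  have uc := ud.continuous
  have H1 := half hu n1
  have H2 := half (neg_min hu) n2
  have nu := neg_min hu
  have e2 : ∀ x, (-u x) ^ 2 = u x ^ 2 := fun x => by ring
  have e4 : ∀ x, (-u x) ^ 4 = u x ^ 4 := fun x => by ring
  have eE : Ea V a (fun x => -u x) = Ea V a u := by
    simp only [Ea, e2, e4, gradSq_neg]
  rw [eE] at H2
  have p1 := setpos uc two_ne_zero even_two i2 n1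
  have p2 := setpos uc.neg two_ne_zero even_two nu.1.1.2.1 n2
  have q1 := setpos uc (k := 4) (by norm_num) (by decide) i4 n1
  have q2 := setpos uc.neg (k := 4) (by norm_num) (by decide) nu.1.1.2.2.2 n2
  simp only [Pi.neg_apply, e2, e4, gradSq_neg] at H2 p2 q2
  have sg := split uc ig (Rea.gradSq_nonneg u)
  have s2 := split_eq uc i2 (fun x hx => by simp [hx])
  have s4 := split_eq uc i4 (fun x hx => by simp [hx])
  have sV := split_eq uc iV (fun x hx => by simp [hx])
  have hE : Ea V a u = (∫ x, gradSq u x) + (∫ x, V x * u x ^ 2) - a / 2 * (∫ x, u x ^ 4) := rfl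
  rw [h1] at s2
  generalize (∫ x in {x | 0 < u x}, gradSq u x) = A1 at *
  generalize (∫ x in {x | 0 < -u x}, gradSq u x) = A2 at *
  generalize (∫ x in {x | 0 < u x}, V x * u x ^ 2) = V1 at *
  generalize (∫ x in {x | 0 < -u x}, V x * u x ^ 2) = V2 at *
  generalize (∫ x in {x | 0 < u x}, u x ^ 2) = m1 at *
  generalize (∫ x in {x | 0 < -u x}, u x ^ 2) = m2 at *
  generalize (∫ x in {x | 0 < u x}, u x ^ 4) = D1 at *
  generalize (∫ x in {x | 0 < -u x}, u x ^ 4) = D2 at *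
  have k1 : a / 2 * D1 / m1 ≤ A1 + V1 - Ea V a u * m1 := by
    rw [div_le_iff₀ p1]; nlinarith
  have k2 : a / 2 * D2 / m2 ≤ A2 + V2 - Ea V a u * m2 := by
    rw [div_le_iff₀ p2]; nlinarith
  have k3 : a / 2 * D1 < a / 2 * D1 / m1 := by
    rw [lt_div_iff₀ p1]; exact mul_lt_of_lt_one_right (by positivity) (by linarith)
  have k4 : a / 2 * D2 < a / 2 * D2 / m2 := by
    rw [lt_div_iff₀ p2]; exact mul_lt_of_lt_one_right (by positivity) (by linarith)
  have k5 : Ea V a u * m1 + Ea V a u * m2 = Ea V a u := by rw [← mul_add, s2, mul_one]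
  have k6 : a / 2 * D1 + a / 2 * D2 = a / 2 * ∫ x, u x ^ 4 := by rw [← mul_add, s4]
  linarith

end Mn


namespace Mn
open Set Topology Metric
open GS

lemma dual_sq (L : E2 →L[ℝ] ℝ) : ‖L‖ ^ 2 = L e0 ^ 2 + L e1 ^ 2 := by
  set g := (InnerProductSpace.toDual ℝ E2).symm L with hg
  have h1 : ‖L‖ = ‖g‖ := ((InnerProductSpace.toDual ℝ E2).symm.norm_map L).symm
  have h2 : ∀ y, L y = inner ℝ g y := fun y => (InnerProductSpace.toDual_symm_apply (𝕜 := ℝ) (x := y) (y := L)).symm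
  rw [h1, nsq, h2, h2]
  simp [e0, e1, EuclideanSpace.inner_single_right]

/-- partial derivatives -/
def pd (v : E2) (u : E2 → ℝ) (x : E2) : ℝ := fderiv ℝ u x v

lemma gradSq_pd (u : E2 → ℝ) (x : E2) : gradSq u x = pd e0 u x ^ 2 + pd e1 u x ^ 2 := dual_sq _

lemma pd_meas (v : E2) (u : E2 → ℝ) : Measurable (pd v u) := measurable_fderiv_apply_const ℝ u v

def BB (u φ : E2 → ℝ) (x : E2) : ℝ := pd e0 u x * pd e0 φ x + pd e1 u x * pd e1 φ x

lemma BB_int {u φ : E2 → ℝ} (hu : Integrable (gradSq u)) (hφ : Integrable (gradSq φ)) : Integrable (BB u φ) := by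
  refine (hu.add hφ).mono' ?_ (ae_of_all _ fun x => ?_)
  · exact (((pd_meas _ _).mul (pd_meas _ _)).add ((pd_meas _ _).mul (pd_meas _ _))).aestronglyMeasurable
  · rw [Pi.add_apply, gradSq_pd, gradSq_pd, Real.norm_eq_abs, abs_le]
    simp only [BB]
    constructor <;> nlinarith [sq_nonneg (pd e0 u x + pd e0 φ x), sq_nonneg (pd e1 u x + pd e1 φ x), sq_nonneg (pd e0 u x - pd e0 φ x), sq_nonneg (pd e1 u x - pd e1 φ x), sq_nonneg (pd e0 u x), sq_nonneg (pd e0 φ x), sq_nonneg (pd e1 u x), sq_nonneg (pd e1 φ x)]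

lemma gradSq_add {u φ : E2 → ℝ} (hu : Differentiable ℝ u) (hφ : Differentiable ℝ φ) (t : ℝ) (x : E2) :
    gradSq (fun x => u x + t * φ x) x = gradSq u x + 2 * t * BB u φ x + t ^ 2 * gradSq φ x := by
  have h : ∀ v, pd v (fun x => u x + t * φ x) x = pd v u x + t * pd v φ x := by
    intro v
    have := ((hu x).hasFDerivAt.add ((hφ x).hasFDerivAt.const_mul t)).fderiv
    have e : fderiv ℝ (fun x => u x + t * φ x) x = fderiv ℝ u x + t • fderiv ℝ φ x := this
    simp only [pd]; rw [e]; simp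
  rw [gradSq_pd, gradSq_pd, gradSq_pd, h, h, BB]; ring

lemma quad {f g k : E2 → ℝ} (hf : Integrable f) (hg : Integrable g) (hk : Integrable k) (c d : ℝ) :
    ∫ x, (f x + c * g x + d * k x) = (∫ x, f x) + c * (∫ x, g x) + d * ∫ x, k x := by
  have h1 : Integrable (fun x => f x + c * g x) := hf.add (hg.const_mul c)
  rw [integral_add h1 (hk.const_mul d), integral_add hf (hg.const_mul c), integral_const_mul, integral_const_mul]

theorem super {V u φ : E2 → ℝ} {a : ℝ} (hu : IsMinimizer V a u) (hd : Differentiable ℝ φ) (hc : HasCompactSupport φ)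
    (hg : Integrable (gradSq φ)) (hV1 : Integrable (fun x => V x * u x * φ x)) (hV2 : Integrable (fun x => V x * φ x ^ 2)) :
    0 ≤ (∫ x, BB u φ x) + (∫ x, V x * u x * φ x) - a * (∫ x, u x ^ 3 * φ x)
      - (2 * Ea V a u - ((∫ x, gradSq u x) + ∫ x, V x * u x ^ 2)) * ∫ x, u x * φ x := by
  obtain ⟨⟨⟨ud, i2, ig, i4⟩, iV⟩, h1, hm⟩ := id hu
  have uc := ud.continuous
  have φc := hd.continuous
  have J1 : Integrable (fun x => u x * φ x) := (uc.mul φc).integrable_of_hasCompactSupport hc.mul_left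
  have J2 : Integrable (fun x => φ x ^ 2) := Rea.int_pow φc hc two_ne_zero
  have K1 : Integrable (fun x => u x ^ 3 * φ x) := ((uc.pow 3).mul φc).integrable_of_hasCompactSupport hc.mul_left
  have K2 : Integrable (fun x => u x ^ 2 * φ x ^ 2) := ((uc.pow 2).mul (φc.pow 2)).integrable_of_hasCompactSupport (Rea.hcs_pow hc two_ne_zero).mul_left
  have K3 : Integrable (fun x => u x * φ x ^ 3) := (uc.mul (φc.pow 3)).integrable_of_hasCompactSupport (Rea.hcs_pow hc three_ne_zero).mul_left
  have K4 : Integrable (fun x => φ x ^ 4) := Rea.int_pow φc hc four_ne_zero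
  have iB := BB_int ig hg
  have F2 : ∀ t : ℝ, Integrable (fun x => u x ^ 2 + 2 * t * (u x * φ x) + t ^ 2 * φ x ^ 2) := fun t => (i2.add (J1.const_mul _)).add (J2.const_mul _)
  have I2 : ∀ t : ℝ, ∫ x, (u x ^ 2 + 2 * t * (u x * φ x) + t ^ 2 * φ x ^ 2) = 1 + 2 * t * (∫ x, u x * φ x) + t ^ 2 * ∫ x, φ x ^ 2 := by
    intro t
    rw [quad i2 J1 J2, h1]
  have FV : ∀ t : ℝ, Integrable (fun x => V x * u x ^ 2 + 2 * t * (V x * u x * φ x) + t ^ 2 * (V x * φ x ^ 2)) := fun t => (iV.add (hV1.const_mul _)).add (hV2.const_mul _)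
  have IV : ∀ t : ℝ, ∫ x, (V x * u x ^ 2 + 2 * t * (V x * u x * φ x) + t ^ 2 * (V x * φ x ^ 2)) = (∫ x, V x * u x ^ 2) + 2 * t * (∫ x, V x * u x * φ x) + t ^ 2 * ∫ x, V x * φ x ^ 2 := by
    intro t
    rw [quad iV hV1 hV2]
  have Fg : ∀ t : ℝ, Integrable (fun x => gradSq u x + 2 * t * BB u φ x + t ^ 2 * gradSq φ x) := fun t => (ig.add (iB.const_mul _)).add (hg.const_mul _)
  have Ig : ∀ t : ℝ, ∫ x, (gradSq u x + 2 * t * BB u φ x + t ^ 2 * gradSq φ x) = (∫ x, gradSq u x) + 2 * t * (∫ x, BB u φ x) + t ^ 2 * ∫ x, gradSq φ x := by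
    intro t
    rw [quad ig iB hg]
  have F41 : ∀ t : ℝ, Integrable (fun x => u x ^ 4 + 4 * t * (u x ^ 3 * φ x)) := fun t => i4.add (K1.const_mul _)
  have F42 : ∀ t : ℝ, Integrable (fun x => u x ^ 4 + 4 * t * (u x ^ 3 * φ x) + 6 * t ^ 2 * (u x ^ 2 * φ x ^ 2)) := fun t => (F41 t).add (K2.const_mul _)
  have F43 : ∀ t : ℝ, Integrable (fun x => u x ^ 4 + 4 * t * (u x ^ 3 * φ x) + 6 * t ^ 2 * (u x ^ 2 * φ x ^ 2) + 4 * t ^ 3 * (u x * φ x ^ 3)) := fun t => (F42 t).add (K3.const_mul _)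
  have F4 : ∀ t : ℝ, Integrable (fun x => u x ^ 4 + 4 * t * (u x ^ 3 * φ x) + 6 * t ^ 2 * (u x ^ 2 * φ x ^ 2) + 4 * t ^ 3 * (u x * φ x ^ 3) + t ^ 4 * φ x ^ 4) := fun t => (F43 t).add (K4.const_mul _)
  have I4 : ∀ t : ℝ, ∫ x, (u x ^ 4 + 4 * t * (u x ^ 3 * φ x) + 6 * t ^ 2 * (u x ^ 2 * φ x ^ 2) + 4 * t ^ 3 * (u x * φ x ^ 3) + t ^ 4 * φ x ^ 4) =
      (∫ x, u x ^ 4) + 4 * t * (∫ x, u x ^ 3 * φ x) + 6 * t ^ 2 * (∫ x, u x ^ 2 * φ x ^ 2) + 4 * t ^ 3 * (∫ x, u x * φ x ^ 3) + t ^ 4 * ∫ x, φ x ^ 4 := by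
    intro t
    rw [integral_add (F43 t) (K4.const_mul _), integral_add (F42 t) (K3.const_mul _), integral_add (F41 t) (K2.const_mul _), integral_add i4 (K1.const_mul _),
      integral_const_mul, integral_const_mul, integral_const_mul, integral_const_mul]
  have e2 : ∀ t : ℝ, (fun x => (u x + t * φ x) ^ 2) = fun x => u x ^ 2 + 2 * t * (u x * φ x) + t ^ 2 * φ x ^ 2 := fun t => funext fun x => by ring
  have eV : ∀ t : ℝ, (fun x => V x * (u x + t * φ x) ^ 2) = fun x => V x * u x ^ 2 + 2 * t * (V x * u x * φ x) + t ^ 2 * (V x * φ x ^ 2) := fun t => funext fun x => by ring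
  have eg : ∀ t : ℝ, gradSq (fun x => u x + t * φ x) = fun x => gradSq u x + 2 * t * BB u φ x + t ^ 2 * gradSq φ x := fun t => funext fun x => gradSq_add ud hd t x
  have e4 : ∀ t : ℝ, (fun x => (u x + t * φ x) ^ 4) = fun x => u x ^ 4 + 4 * t * (u x ^ 3 * φ x) + 6 * t ^ 2 * (u x ^ 2 * φ x ^ 2) + 4 * t ^ 3 * (u x * φ x ^ 3) + t ^ 4 * φ x ^ 4 := fun t => funext fun x => by ring
  have H : ∀ t : ℝ, InH V (fun x => u x + t * φ x) := fun t => ⟨⟨ud.add (hd.const_mul t), by rw [e2]; exact F2 t, by rw [eg]; exact Fg t, by rw [e4]; exact F4 t⟩, by rw [eV]; exact FV t⟩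
  have HH := fun t => hom hu (H t)
  simp only [eg, eV, e2, e4, I2, IV, Ig, I4] at HH
  have hE : Ea V a u = (∫ x, gradSq u x) + (∫ x, V x * u x ^ 2) - a / 2 * (∫ x, u x ^ 4) := rfl
  generalize (∫ x, u x * φ x) = m1 at *
  generalize (∫ x, φ x ^ 2) = m2 at *
  generalize (∫ x, gradSq u x) = A0 at *
  generalize (∫ x, BB u φ x) = A1 at *
  generalize (∫ x, gradSq φ x) = A2 at *
  generalize (∫ x, V x * u x ^ 2) = V0 at *
  generalize (∫ x, V x * u x * φ x) = V1 at *
  generalize (∫ x, V x * φ x ^ 2) = V2 at *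
  generalize (∫ x, u x ^ 4) = D0 at *
  generalize (∫ x, u x ^ 3 * φ x) = D1 at *
  generalize (∫ x, u x ^ 2 * φ x ^ 2) = D2 at *
  generalize (∫ x, u x * φ x ^ 3) = D3 at *
  generalize (∫ x, φ x ^ 4) = D4 at *
  generalize Ea V a u = e at *
  have lim1 : Tendsto (fun t : ℝ => 1 + 2 * t * m1 + t ^ 2 * m2) (𝓝[>] 0) (𝓝 1) := by
    have : Continuous (fun t : ℝ => 1 + 2 * t * m1 + t ^ 2 * m2) := by fun_prop
    simpa using (this.tendsto 0).mono_left (nhdsWithin_le_nhds (s := Ioi 0))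
  set P : ℝ → ℝ := fun t => 2 * (A1 + V1 - a * D1 - (2 * e - (A0 + V0)) * m1) + t * ((A2 + V2 + 4 * (A1 + V1) * m1 + (A0 + V0) * m2 - 3 * a * D2 - e * (2 * m2 + 4 * m1 ^ 2))
      + t * (2 * (A1 + V1) * m2 + 2 * (A2 + V2) * m1 - 2 * a * D3 - 4 * e * m1 * m2) + t ^ 2 * ((A2 + V2) * m2 - a / 2 * D4 - e * m2 ^ 2)) with hP
  have lim2 : Tendsto P (𝓝[>] 0) (𝓝 (2 * (A1 + V1 - a * D1 - (2 * e - (A0 + V0)) * m1))) := by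
    have : Continuous P := by rw [hP]; fun_prop
    have h0 : P 0 = 2 * (A1 + V1 - a * D1 - (2 * e - (A0 + V0)) * m1) := by simp [hP]
    rw [← h0]
    exact (this.tendsto 0).mono_left (nhdsWithin_le_nhds (s := Ioi 0))
  have : 0 ≤ 2 * (A1 + V1 - a * D1 - (2 * e - (A0 + V0)) * m1) := by
    refine ge_of_tendsto lim2 ?_
    filter_upwards [lim1.eventually_const_lt one_pos, self_mem_nhdsWithin] with t ht (ht0 : 0 < t)
    have k := HH t ht
    refine le_of_mul_le_mul_left ?_ ht0
    rw [mul_zero]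
    refine k.trans (le_of_eq ?_)
    rw [hP, hE]; ring
  linarith

end Mn


namespace Mn
open Set Topology Metric
open GS

def P (i : Fin 2) : E2 →L[ℝ] ℝ := EuclideanSpace.proj i

lemma P_apply (i : Fin 2) (x : E2) : P i x = x i := rfl

def gs (α : ℝ) (z x : E2) : ℝ := exp (-α * ((x 0 - z 0) ^ 2 + (x 1 - z 1) ^ 2))

lemma co_d (i : Fin 2) (z x : E2) : HasFDerivAt (fun x : E2 => x i - z i) (P i) x := ((P i).hasFDerivAt).sub_const (z i)

lemma gs_d (α : ℝ) (z x : E2) : HasFDerivAt (gs α z) (gs α z x • ((-2 * α * (x 0 - z 0)) • P 0 + (-2 * α * (x 1 - z 1)) • P 1)) x := by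
  have s : ∀ i, HasFDerivAt (fun x : E2 => (x i - z i) ^ 2) ((2 * (x i - z i)) • P i) x := by
    intro i
    have h : HasDerivAt (fun t : ℝ => t ^ 2) (2 * (x i - z i)) (x i - z i) := by simpa using hasDerivAt_pow 2 (x i - z i)
    exact h.comp_hasFDerivAt x (co_d i z x)
  have h1 : HasFDerivAt (fun x : E2 => -α * ((x 0 - z 0) ^ 2 + (x 1 - z 1) ^ 2)) ((-α) • ((2 * (x 0 - z 0)) • P 0 + (2 * (x 1 - z 1)) • P 1)) x :=
    ((s 0).add (s 1)).const_mul (-α)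
  have h2 := h1.exp
  have e : gs α z x • ((-2 * α * (x 0 - z 0)) • P 0 + (-2 * α * (x 1 - z 1)) • P 1) =
      exp (-α * ((x 0 - z 0) ^ 2 + (x 1 - z 1) ^ 2)) • ((-α) • ((2 * (x 0 - z 0)) • P 0 + (2 * (x 1 - z 1)) • P 1)) := by
    ext v; simp [gs, P_apply]; ring
  rw [e]; exact h2

lemma gs_c (α : ℝ) (z : E2) : Continuous (gs α z) := continuous_iff_continuousAt.2 fun x => (gs_d α z x).continuousAt

lemma gs_pd0 (α : ℝ) (z : E2) : pd e0 (gs α z) = fun x => -2 * α * (x 0 - z 0) * gs α z x := by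
  funext x; simp [pd, (gs_d α z x).fderiv, P_apply, e0_0, e0_1]; ring

lemma gs_pd1 (α : ℝ) (z : E2) : pd e1 (gs α z) = fun x => -2 * α * (x 1 - z 1) * gs α z x := by
  funext x; simp [pd, (gs_d α z x).fderiv, P_apply, e1_0, e1_1]; ring

lemma gs_dd (α : ℝ) (z x : E2) (i : Fin 2) : HasFDerivAt (fun x => -2 * α * (x i - z i) * gs α z x)
    ((-2 * α * (x i - z i)) • (gs α z x • ((-2 * α * (x 0 - z 0)) • P 0 + (-2 * α * (x 1 - z 1)) • P 1)) + gs α z x • ((-2 * α) • P i)) x :=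
  ((co_d i z x).const_mul (-2 * α)).mul (gs_d α z x)

lemma gs_pd00 (α : ℝ) (z x : E2) : pd e0 (pd e0 (gs α z)) x = (4 * α ^ 2 * (x 0 - z 0) ^ 2 - 2 * α) * gs α z x := by
  rw [gs_pd0]
  show fderiv ℝ (fun x => -2 * α * (x 0 - z 0) * gs α z x) x e0 = _
  rw [(gs_dd α z x 0).fderiv]
  simp only [ContinuousLinearMap.add_apply, ContinuousLinearMap.smul_apply, P_apply, e0_0, e0_1, smul_eq_mul]; ring

lemma gs_pd11 (α : ℝ) (z x : E2) : pd e1 (pd e1 (gs α z)) x = (4 * α ^ 2 * (x 1 - z 1) ^ 2 - 2 * α) * gs α z x := by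
  rw [gs_pd1]
  show fderiv ℝ (fun x => -2 * α * (x 1 - z 1) * gs α z x) x e1 = _
  rw [(gs_dd α z x 1).fderiv]
  simp only [ContinuousLinearMap.add_apply, ContinuousLinearMap.smul_apply, P_apply, e1_0, e1_1, smul_eq_mul]; ring

lemma gs_norm (α : ℝ) (z x : E2) : gs α z x = exp (-α * ‖x - z‖ ^ 2) := by
  rw [nsq]; rfl

lemma co_c (i : Fin 2) : Continuous (fun x : E2 => x i) := (P i).continuous

/-- integration by parts against a compactly supported differentiable function -/
lemma ibp {f φ : E2 → ℝ} {v : E2} (hf : Differentiable ℝ f) (hf' : Continuous (pd v f)) (hφ : Differentiable ℝ φ) (hc : HasCompactSupport φ)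
    (hi : Integrable (fun x => f x * pd v φ x)) : ∫ x, f x * pd v φ x = -∫ x, pd v f x * φ x := by
  refine integral_mul_fderiv_eq_neg_fderiv_mul_of_integrable (μ := (volume : Measure E2)) ?_ hi ?_ (fun x _ => hf x) (fun x _ => hφ x)
  · exact (hf'.mul hφ.continuous).integrable_of_hasCompactSupport hc.mul_left
  · exact (hf.continuous.mul hφ.continuous).integrable_of_hasCompactSupport hc.mul_left

set_option maxHeartbeats 1000000 in
/-- the barrier step -/
lemma barrier {u : E2 → ℝ} {z : E2} {R ε c α : ℝ} (hR : 0 < R) (hε : 0 < ε) (hc : 0 < c) (hα : 1 ≤ α) (hαR : 4 + c ≤ α * R ^ 2)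
    (ud : Differentiable ℝ u) (u0 : ∀ x, 0 ≤ u x) (ig : Integrable (gradSq u))
    (hin : ∀ x, ‖x - z‖ ≤ R / 2 → ε ≤ u x)
    (hsup : ∀ φ : E2 → ℝ, Differentiable ℝ φ → (∀ x, 0 ≤ φ x) → (∀ x, R ≤ ‖x - z‖ → φ x = 0) → Integrable (gradSq φ) →
      0 ≤ (∫ x, BB u φ x) + c * ∫ x, u x * φ x) :
    ∀ x, ε * (gs α z x - exp (-α * R ^ 2)) ≤ u x := by
  set κ := exp (-α * R ^ 2) with hκ
  set ζ : E2 → ℝ := fun x => ε * (gs α z x - κ) - u x with hζ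
  set w : E2 → ℝ := fun x => max (ζ x) 0 with hw
  set φ : E2 → ℝ := fun x => w x ^ 2 with hφ
  have gsd : Differentiable ℝ (gs α z) := fun x => (gs_d α z x).differentiableAt
  have uc := ud.continuous
  have gc := gs_c α z
  have ζd : Differentiable ℝ ζ := ((gsd.sub_const κ).const_mul ε).sub ud
  have wc : Continuous w := ζd.continuous.max continuous_const
  have w0 : ∀ x, 0 ≤ w x := fun x => le_max_right _ _
  have hκ0 : 0 < κ := exp_pos _
  have g1 : ∀ x, gs α z x ≤ 1 := fun x => by
    rw [gs_norm, exp_le_one_iff]; nlinarith [sq_nonneg ‖x - z‖]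
  have g0 : ∀ x, 0 < gs α z x := fun x => exp_pos _
  have wle : ∀ x, w x ≤ ε := fun x => by
    refine max_le ?_ hε.le
    have : ε * (gs α z x - κ) ≤ ε * 1 := mul_le_mul_of_nonneg_left (by linarith [g1 x]) hε.le
    simp only [hζ]; linarith [u0 x]
  have wout : ∀ x, R ≤ ‖x - z‖ → w x = 0 := by
    intro x hx
    refine max_eq_right ?_
    have : gs α z x ≤ κ := by
      rw [gs_norm, hκ, exp_le_exp]
      have : R ^ 2 ≤ ‖x - z‖ ^ 2 := pow_le_pow_left₀ hR.le hx 2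
      nlinarith
    have : ε * (gs α z x - κ) ≤ 0 := mul_nonpos_of_nonneg_of_nonpos hε.le (by linarith)
    simp only [hζ]; linarith [u0 x]
  have win : ∀ x, ‖x - z‖ ≤ R / 2 → w x = 0 := by
    intro x hx
    refine max_eq_right ?_
    have : ε * (gs α z x - κ) ≤ ε * 1 := mul_le_mul_of_nonneg_left (by linarith [g1 x]) hε.le
    simp only [hζ]; linarith [hin x hx]
  have wcs : HasCompactSupport w := by
    refine HasCompactSupport.intro (isCompact_closedBall z R) fun x hx => wout x ?_
    rw [mem_closedBall, dist_eq_norm] at hx; exact (not_le.1 hx).le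
  have φfd : ∀ x, HasFDerivAt φ ((2 * w x) • fderiv ℝ ζ x) x := fun x => (psq_deriv (ζ x)).comp_hasFDerivAt x (ζd x).hasFDerivAt
  have φd : Differentiable ℝ φ := fun x => (φfd x).differentiableAt
  have φcs : HasCompactSupport φ := Rea.hcs_pow wcs two_ne_zero
  have ζpd : ∀ v x, pd v ζ x = ε * pd v (gs α z) x - pd v u x := by
    intro v x
    have := ((((gsd x).hasFDerivAt.sub_const κ).const_mul ε).sub (ud x).hasFDerivAt).fderiv
    have e : fderiv ℝ ζ x = ε • fderiv ℝ (gs α z) x - fderiv ℝ u x := this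
    simp only [pd]; rw [e]; simp
  have φpd : ∀ v x, pd v φ x = 2 * w x * (ε * pd v (gs α z) x - pd v u x) := by
    intro v x
    rw [← ζpd]; simp only [pd]; rw [(φfd x).fderiv]; simp
  have c0 : Continuous (pd e0 (gs α z)) := by
    rw [gs_pd0]; exact (((co_c 0).sub continuous_const).const_mul _).mul gc
  have c1 : Continuous (pd e1 (gs α z)) := by
    rw [gs_pd1]; exact (((co_c 1).sub continuous_const).const_mul _).mul gc
  have cg : Continuous (gradSq (gs α z)) := by
    have : gradSq (gs α z) = fun x => pd e0 (gs α z) x ^ 2 + pd e1 (gs α z) x ^ 2 := funext fun x => gradSq_pd _ x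
    rw [this]; exact (c0.pow 2).add (c1.pow 2)
  have iw : Integrable (fun x => w x * gradSq (gs α z) x) := (wc.mul cg).integrable_of_hasCompactSupport wcs.mul_right
  have iu : Integrable (fun x => w x * gradSq u x) := by
    refine (ig.const_mul ε).mono' (wc.aestronglyMeasurable.mul ig.aestronglyMeasurable) (ae_of_all _ fun x => ?_)
    rw [Real.norm_of_nonneg (mul_nonneg (w0 x) (Rea.gradSq_nonneg u x))]
    exact mul_le_mul_of_nonneg_right (wle x) (Rea.gradSq_nonneg u x)
  have iφ : Integrable (gradSq φ) := by
    have hb : Integrable (fun x => 8 * ε ^ 3 * (w x * gradSq (gs α z) x) + 8 * ε * (w x * gradSq u x)) := (iw.const_mul _).add (iu.const_mul _)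
    refine hb.mono' (Rea.gradSq_meas φ).aestronglyMeasurable (ae_of_all _ fun x => ?_)
    rw [Real.norm_of_nonneg (Rea.gradSq_nonneg φ x), gradSq_pd, gradSq_pd, gradSq_pd, φpd, φpd]
    generalize pd e0 (gs α z) x = p0
    generalize pd e1 (gs α z) x = p1
    generalize pd e0 u x = q0
    generalize pd e1 u x = q1
    have hw1 : w x ^ 2 ≤ ε * w x := by rw [sq]; exact mul_le_mul_of_nonneg_right (wle x) (w0 x)
    have k : (ε * p0 - q0) ^ 2 + (ε * p1 - q1) ^ 2 ≤ 2 * ε ^ 2 * (p0 ^ 2 + p1 ^ 2) + 2 * (q0 ^ 2 + q1 ^ 2) := by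
      nlinarith [sq_nonneg (ε * p0 + q0), sq_nonneg (ε * p1 + q1)]
    calc _ = 4 * (w x ^ 2 * ((ε * p0 - q0) ^ 2 + (ε * p1 - q1) ^ 2)) := by ring
      _ ≤ 4 * ((ε * w x) * (2 * ε ^ 2 * (p0 ^ 2 + p1 ^ 2) + 2 * (q0 ^ 2 + q1 ^ 2))) :=
        mul_le_mul_of_nonneg_left (mul_le_mul hw1 k (by positivity) (mul_nonneg hε.le (w0 x))) (by norm_num)
      _ = _ := by ring
  have iP : ∀ v, (v = e0 ∨ v = e1) → Continuous (pd v (gs α z)) → Integrable (fun x => pd v (gs α z) x * pd v φ x) := by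
    intro v hv hcv
    have hb : Integrable (fun x => (2 * ε + 1) * (w x * gradSq (gs α z) x) + (w x * gradSq u x)) := (iw.const_mul _).add iu
    refine hb.mono' (hcv.aestronglyMeasurable.mul (pd_meas v φ).aestronglyMeasurable) (ae_of_all _ fun x => ?_)
    have h1 : pd v (gs α z) x ^ 2 ≤ gradSq (gs α z) x := by
      rw [gradSq_pd]; rcases hv with rfl | rfl <;> nlinarith [sq_nonneg (pd e0 (gs α z) x), sq_nonneg (pd e1 (gs α z) x)]
    have h2 : pd v u x ^ 2 ≤ gradSq u x := by
      rw [gradSq_pd]; rcases hv with rfl | rfl <;> nlinarith [sq_nonneg (pd e0 u x), sq_nonneg (pd e1 u x)]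
    rw [φpd]
    generalize pd v (gs α z) x = p at *
    generalize pd v u x = q at *
    have k : |p * (2 * (ε * p - q))| ≤ (2 * ε + 1) * p ^ 2 + q ^ 2 := by
      rw [abs_le]; constructor <;> nlinarith [sq_nonneg (p - q), sq_nonneg (p + q), mul_nonneg hε.le (sq_nonneg p), sq_nonneg p, sq_nonneg q]
    calc ‖p * (2 * w x * (ε * p - q))‖ = w x * |p * (2 * (ε * p - q))| := by
          rw [Real.norm_eq_abs, show p * (2 * w x * (ε * p - q)) = w x * (p * (2 * (ε * p - q))) by ring, abs_mul, abs_of_nonneg (w0 x)]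
      _ ≤ w x * ((2 * ε + 1) * p ^ 2 + q ^ 2) := mul_le_mul_of_nonneg_left k (w0 x)
      _ ≤ w x * ((2 * ε + 1) * gradSq (gs α z) x + gradSq u x) := mul_le_mul_of_nonneg_left (add_le_add (mul_le_mul_of_nonneg_left h1 (by positivity)) h2) (w0 x)
      _ = _ := by ring
  have i0 := iP e0 (Or.inl rfl) c0
  have i1 := iP e1 (Or.inr rfl) c1
  have cc0 : Continuous (pd e0 (pd e0 (gs α z))) := by
    rw [funext (gs_pd00 α z)]
    exact (((continuous_const).mul (((co_c 0).sub continuous_const).pow 2)).sub continuous_const).mul gc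
  have cc1 : Continuous (pd e1 (pd e1 (gs α z))) := by
    rw [funext (gs_pd11 α z)]
    exact (((continuous_const).mul (((co_c 1).sub continuous_const).pow 2)).sub continuous_const).mul gc
  have d0 : Differentiable ℝ (pd e0 (gs α z)) := by rw [gs_pd0]; exact fun x => (gs_dd α z x 0).differentiableAt
  have d1 : Differentiable ℝ (pd e1 (gs α z)) := by rw [gs_pd1]; exact fun x => (gs_dd α z x 1).differentiableAt
  have b0 := ibp d0 cc0 φd φcs i0
  have b1 := ibp d1 cc1 φd φcs i1
  have L0 : Integrable (fun x => pd e0 (pd e0 (gs α z)) x * φ x) := (cc0.mul φd.continuous).integrable_of_hasCompactSupport φcs.mul_left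
  have L1 : Integrable (fun x => pd e1 (pd e1 (gs α z)) x * φ x) := (cc1.mul φd.continuous).integrable_of_hasCompactSupport φcs.mul_left
  have Lu : Integrable (fun x => u x * φ x) := (uc.mul φd.continuous).integrable_of_hasCompactSupport φcs.mul_left
  have L3 : Integrable (fun x => w x ^ 3) := Rea.int_pow wc wcs three_ne_zero
  have hB : ∫ x, BB u φ x ≤ ε * ((∫ x, pd e0 (gs α z) x * pd e0 φ x) + ∫ x, pd e1 (gs α z) x * pd e1 φ x) := by
    rw [← integral_add i0 i1, ← integral_const_mul]
    refine integral_mono (BB_int ig iφ) ((i0.add i1).const_mul ε) fun x => ?_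
    simp only [BB, φpd]
    nlinarith [mul_nonneg (w0 x) (sq_nonneg (ε * pd e0 (gs α z) x - pd e0 u x)), mul_nonneg (w0 x) (sq_nonneg (ε * pd e1 (gs α z) x - pd e1 u x))]
  have main := hsup φ φd (fun x => sq_nonneg _) (fun x hx => by simp [hφ, wout x hx]) iφ
  rw [b0, b1] at hB
  have key : 0 ≤ -(c * ∫ x, w x ^ 3) := by
    have t1 : (∫ x, BB u φ x) + c * (∫ x, u x * φ x) ≤ (-ε) * ((∫ x, pd e0 (pd e0 (gs α z)) x * φ x) + ∫ x, pd e1 (pd e1 (gs α z)) x * φ x) + c * ∫ x, u x * φ x := by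
      linarith
    refine main.trans (t1.trans ?_)
    have iL : Integrable (fun x => pd e0 (pd e0 (gs α z)) x * φ x + pd e1 (pd e1 (gs α z)) x * φ x) := L0.add L1
    rw [← integral_add L0 L1, ← integral_const_mul, ← integral_const_mul, ← integral_add (iL.const_mul _) (Lu.const_mul _), ← integral_const_mul, ← integral_neg]
    refine integral_mono ((iL.const_mul _).add (Lu.const_mul _)) (L3.const_mul c).neg fun x => ?_
    simp only [gs_pd00, gs_pd11]
    by_cases hx : w x = 0
    · simp [hφ, hx]
    have hpos : 0 < w x := lt_of_le_of_ne (w0 x) (Ne.symm hx)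
    have hwζ : w x = ζ x := by
      rcases max_cases (ζ x) 0 with h | h
      · exact h.1
      · exact absurd h.1 hx
    have hu' : u x = ε * (gs α z x - κ) - w x := by rw [hwζ]; simp only [hζ]; ring
    have hann : R / 2 < ‖x - z‖ := by by_contra h; exact hx (win x (not_lt.1 h))
    have hn : R ^ 2 / 4 ≤ (x 0 - z 0) ^ 2 + (x 1 - z 1) ^ 2 := by
      have h1 : (R / 2) ^ 2 ≤ ‖x - z‖ ^ 2 := pow_le_pow_left₀ (by positivity) hann.le 2
      rw [nsq] at h1
      have h2 : (R / 2) ^ 2 ≤ (x 0 - z 0) ^ 2 + (x 1 - z 1) ^ 2 := h1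
      nlinarith
    generalize (x 0 - z 0) = s0 at *
    generalize (x 1 - z 1) = s1 at *
    have hlap : c ≤ 4 * α ^ 2 * (s0 ^ 2 + s1 ^ 2) - 4 * α := by
      have q1 : α ^ 2 * R ^ 2 ≤ 4 * α ^ 2 * (s0 ^ 2 + s1 ^ 2) := by nlinarith [sq_nonneg α]
      have q2 : α * (4 + c) ≤ α * (α * R ^ 2) := mul_le_mul_of_nonneg_left hαR (by linarith)
      nlinarith
    have hl2 : c * gs α z x ≤ (4 * α ^ 2 * (s0 ^ 2 + s1 ^ 2) - 4 * α) * gs α z x := mul_le_mul_of_nonneg_right hlap (g0 x).le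
    have hl3 : ε * (c * (gs α z x - κ)) ≤ ε * ((4 * α ^ 2 * (s0 ^ 2 + s1 ^ 2) - 4 * α) * gs α z x) :=
      mul_le_mul_of_nonneg_left (by nlinarith) hε.le
    have hfin : -ε * ((4 * α ^ 2 * (s0 ^ 2 + s1 ^ 2) - 4 * α) * gs α z x) + c * u x ≤ -(c * w x) := by
      rw [hu']; nlinarith
    have := mul_le_mul_of_nonneg_right hfin (sq_nonneg (w x))
    have eL : -ε * ((4 * α ^ 2 * s0 ^ 2 - 2 * α) * gs α z x * φ x + (4 * α ^ 2 * s1 ^ 2 - 2 * α) * gs α z x * φ x) + c * (u x * φ x) =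
        (-ε * ((4 * α ^ 2 * (s0 ^ 2 + s1 ^ 2) - 4 * α) * gs α z x) + c * u x) * w x ^ 2 := by
      simp only [hφ]; ring
    have eR : -(c * w x) * w x ^ 2 = -(c * w x ^ 3) := by ring
    rw [eR] at this
    exact eL.le.trans this
  have wz : ∀ x, w x = 0 := by
    by_contra hcon
    push Not at hcon
    obtain ⟨x, hx⟩ := hcon
    have : 0 < ∫ x, w x ^ 3 := (wc.pow 3).integral_pos_of_hasCompactSupport_nonneg_nonzero (Rea.hcs_pow wcs three_ne_zero)
      (fun x => pow_nonneg (w0 x) 3) (x := x) (pow_ne_zero 3 hx)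
    nlinarith [mul_pos hc this]
  intro x
  have := wz x
  have h2 : ζ x ≤ 0 := by rw [← this]; exact le_max_left _ _
  simp only [hζ] at h2; linarith

end Mn


namespace Mn
open Set Topology Metric
open GS

theorem pos {V u : E2 → ℝ} {a : ℝ} (ha : 0 ≤ a) (hu : IsMinimizer V a u) (u0 : ∀ x, 0 ≤ u x) (V0 : ∀ x, 0 ≤ V x)
    (Vb : ∀ (z : E2) (R : ℝ), ∃ B, ∀ x, ‖x - z‖ ≤ R → V x ≤ B) : ∀ x, 0 < u x := by
  obtain ⟨⟨⟨ud, iu2, ig, iu4⟩, iV⟩, hm, -⟩ := id hu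
  have uc := ud.continuous
  by_contra hcon
  push Not at hcon
  obtain ⟨y0, hy0⟩ := hcon
  set Z : Set E2 := {x | u x = 0} with hZ
  have Zc : IsClosed Z := isClosed_eq uc continuous_const
  have Zne : Z.Nonempty := ⟨y0, le_antisymm hy0 (u0 y0)⟩
  obtain ⟨z, hz⟩ : ∃ z, u z ≠ 0 := by
    by_contra h
    push Not at h
    simp [h] at hm
  obtain ⟨y, hy, hyd⟩ := Zc.exists_infDist_eq_dist Zne z
  have hy : u y = 0 := hy
  set R := dist z y with hR
  have hRpos : 0 < R := dist_pos.2 (by rintro rfl; exact hz hy)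
  have ball : ∀ x, ‖x - z‖ < R → 0 < u x := by
    intro x hx
    refine lt_of_le_of_ne (u0 x) fun h => ?_
    have h1 : infDist z Z ≤ dist z x := infDist_le_dist_of_mem (show u x = 0 from h.symm)
    rw [hyd, dist_comm z x, dist_eq_norm x z] at h1
    linarith
  obtain ⟨B, hB⟩ := Vb z R
  have hB0 : 0 ≤ B := (V0 z).trans (hB z (by simp [hRpos.le]))
  set μ := 2 * Ea V a u - ((∫ x, gradSq u x) + ∫ x, V x * u x ^ 2) with hμ
  set c := B + |μ| + 1 with hc
  have hcpos : 0 < c := by positivity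
  obtain ⟨m, hm1, hm2⟩ := (isCompact_closedBall z (R / 2)).exists_isMinOn ⟨z, mem_closedBall_self (by positivity)⟩ uc.continuousOn
  set ε := u m with hε
  have hεpos : 0 < ε := ball m (by rw [mem_closedBall, dist_eq_norm] at hm1; linarith)
  set α := 1 + (4 + c) / R ^ 2 with hα
  have hα1 : 1 ≤ α := by have : 0 ≤ (4 + c) / R ^ 2 := by positivity
                         linarith
  have hαR : 4 + c ≤ α * R ^ 2 := by
    have : α * R ^ 2 = R ^ 2 + (4 + c) := by rw [hα]; field_simp
    nlinarith [sq_nonneg R]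
  have bar := barrier hRpos hεpos hcpos hα1 hαR ud u0 ig (z := z)
    (fun x hx => hm2 (by rw [mem_closedBall, dist_eq_norm]; exact hx)) (fun φ φd φ0 φout iφ => by
      have φc := φd.continuous
      have φcs : HasCompactSupport φ := by
        refine HasCompactSupport.intro (isCompact_closedBall z R) fun x hx => φout x ?_
        rw [mem_closedBall, dist_eq_norm] at hx; exact (not_le.1 hx).le
      have hin : ∀ x, φ x ≠ 0 → 0 < u x ∧ V x ≤ B := by
        intro x hx
        have : ‖x - z‖ < R := by by_contra h; exact hx (φout x (not_lt.1 h))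
        exact ⟨ball x this, hB x this.le⟩
      have I1 : Integrable (fun x => u x * φ x) := (uc.mul φc).integrable_of_hasCompactSupport φcs.mul_left
      have I2 : Integrable (fun x => φ x ^ 2) := Rea.int_pow φc φcs two_ne_zero
      have I3 : Integrable (fun x => u x ^ 3 * φ x) := ((uc.pow 3).mul φc).integrable_of_hasCompactSupport φcs.mul_left
      have mq : Measurable (fun x => φ x / u x) := φc.measurable.div uc.measurable
      have hV1 : Integrable (fun x => V x * u x * φ x) := by
        have e : (fun x => V x * u x * φ x) = fun x => (V x * u x ^ 2) * (φ x / u x) := by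
          funext x
          by_cases hx : φ x = 0
          · simp [hx]
          · have := (hin x hx).1; field_simp
        refine (I1.const_mul B).mono' ?_ (ae_of_all _ fun x => ?_)
        · rw [e]; exact iV.aestronglyMeasurable.mul mq.aestronglyMeasurable
        · rw [Real.norm_of_nonneg (mul_nonneg (mul_nonneg (V0 x) (u0 x)) (φ0 x)), mul_assoc]
          by_cases hx : φ x = 0
          · simp [hx]
          · exact mul_le_mul_of_nonneg_right (hin x hx).2 (mul_nonneg (u0 x) (φ0 x))
      have hV2 : Integrable (fun x => V x * φ x ^ 2) := by
        have e : (fun x => V x * φ x ^ 2) = fun x => (V x * u x ^ 2) * (φ x / u x) ^ 2 := by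
          funext x
          by_cases hx : φ x = 0
          · simp [hx]
          · have := (hin x hx).1; field_simp
        refine (I2.const_mul B).mono' ?_ (ae_of_all _ fun x => ?_)
        · rw [e]; exact iV.aestronglyMeasurable.mul (mq.pow_const 2).aestronglyMeasurable
        · rw [Real.norm_of_nonneg (mul_nonneg (V0 x) (sq_nonneg _))]
          by_cases hx : φ x = 0
          · simp [hx]
          · exact mul_le_mul_of_nonneg_right (hin x hx).2 (sq_nonneg _)
      have sp := super hu φd φcs iφ hV1 hV2
      have J0 : 0 ≤ ∫ x, u x * φ x := integral_nonneg fun x => mul_nonneg (u0 x) (φ0 x)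
      have J1 : ∫ x, V x * u x * φ x ≤ B * ∫ x, u x * φ x := by
        rw [← integral_const_mul]
        refine integral_mono hV1 (I1.const_mul B) fun x => ?_
        show V x * u x * φ x ≤ B * (u x * φ x)
        rw [mul_assoc]
        by_cases hx : φ x = 0
        · simp [hx]
        · exact mul_le_mul_of_nonneg_right (hin x hx).2 (mul_nonneg (u0 x) (φ0 x))
      have J2 : 0 ≤ a * ∫ x, u x ^ 3 * φ x := mul_nonneg ha (integral_nonneg fun x => mul_nonneg (pow_nonneg (u0 x) 3) (φ0 x))
      have J3 : -μ * ∫ x, u x * φ x ≤ |μ| * ∫ x, u x * φ x := mul_le_mul_of_nonneg_right (neg_le_abs μ) J0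
      have J4 : c * ∫ x, u x * φ x = B * (∫ x, u x * φ x) + |μ| * (∫ x, u x * φ x) + ∫ x, u x * φ x := by rw [hc]; ring
      rw [J4]
      rw [← hμ] at sp
      linarith)
  have gsd : Differentiable ℝ (gs α z) := fun x => (gs_d α z x).differentiableAt
  set κ := exp (-α * R ^ 2) with hκ
  have hgy : gs α z y = κ := by rw [gs_norm, hκ, hR, dist_comm, dist_eq_norm]
  have D1 : fderiv ℝ u y = 0 := IsLocalMin.fderiv_eq_zero (Eventually.of_forall fun x => by rw [hy]; exact u0 x)
  have hF := (ud y).hasFDerivAt.sub (((gsd y).hasFDerivAt.sub_const κ).const_mul ε)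
  have D2 : fderiv ℝ u y - ε • fderiv ℝ (gs α z) y = 0 := by
    refine IsLocalMin.hasFDerivAt_eq_zero (f := fun x => u x - ε * (gs α z x - κ)) (Eventually.of_forall fun x => ?_) hF
    show u y - ε * (gs α z y - κ) ≤ u x - ε * (gs α z x - κ)
    rw [hy, hgy]
    have := bar x
    linarith
  rw [D1, zero_sub, neg_eq_zero, smul_eq_zero] at D2
  have D3 : fderiv ℝ (gs α z) y = 0 := D2.resolve_left hεpos.ne'
  have gp : 0 < gs α z y := exp_pos _
  have p0 : pd e0 (gs α z) y = 0 := by simp [pd, D3]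
  have p1 : pd e1 (gs α z) y = 0 := by simp [pd, D3]
  rw [gs_pd0] at p0
  rw [gs_pd1] at p1
  have q0 : y 0 - z 0 = 0 := by
    have h2 : -2 * α ≠ 0 := by linarith
    simpa [gp.ne', show α ≠ 0 by linarith] using p0
  have q1 : y 1 - z 1 = 0 := by
    simpa [gp.ne', show α ≠ 0 by linarith] using p1
  have hn := nsq (y - z)
  have : ‖y - z‖ ^ 2 = 0 := by
    rw [hn]; show (y 0 - z 0) ^ 2 + (y 1 - z 1) ^ 2 = 0
    rw [q0, q1]; norm_num
  rw [hR, dist_comm, dist_eq_norm] at hRpos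
  nlinarith

/-- existence of a minimizer forces measurability of the potential -/
theorem meas {V u : E2 → ℝ} {a : ℝ} (ha : 0 < a) (hu : IsMinimizer V a u) (V0 : ∀ x, 0 ≤ V x)
    (Vb : ∀ (z : E2) (R : ℝ), ∃ B, ∀ x, ‖x - z‖ ≤ R → V x ≤ B) : AEStronglyMeasurable V := by
  have k : ∀ w : E2 → ℝ, IsMinimizer V a w → (∀ x, 0 ≤ w x) → AEStronglyMeasurable V := by
    intro w hw w0
    have hp := pos ha.le hw w0 V0 Vb
    have e : V = fun x => (V x * w x ^ 2) * ((w x ^ 2)⁻¹) := by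
      funext x; have := hp x; field_simp
    rw [e]
    have wm : Measurable w := hw.1.1.1.continuous.measurable
    exact hw.1.2.aestronglyMeasurable.mul ((wm.pow_const 2).inv).aestronglyMeasurable
  rcases sign ha hu with h | h
  · exact k u hu h
  · exact k _ (neg_min hu) h

end Mn


namespace Fin8
open Set Topology Metric

lemma Vnn {n : ℕ} {pts : Fin n → E2} {pe : Fin n → ℝ} {h : E2 → ℝ} {C' : ℝ} (hC : 0 < C') (hh : ∀ x, C' < h x ∧ h x < 1 / C')
    {V : E2 → ℝ} (hV : ∀ x, V x = h x * ∏ i, ‖x - pts i‖ ^ pe i) (x : E2) : 0 ≤ V x := by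
  rw [hV]
  exact mul_nonneg (hC.trans (hh x).1).le (Finset.prod_nonneg fun i _ => by positivity)

lemma Vbd {n : ℕ} {pts : Fin n → E2} {pe : Fin n → ℝ} (hpe : ∀ i, 0 < pe i) {h : E2 → ℝ} {C' : ℝ} (hC : 0 < C') (hh : ∀ x, C' < h x ∧ h x < 1 / C')
    {V : E2 → ℝ} (hV : ∀ x, V x = h x * ∏ i, ‖x - pts i‖ ^ pe i) (z : E2) (R : ℝ) : ∃ B, ∀ x, ‖x - z‖ ≤ R → V x ≤ B := by
  refine ⟨1 / C' * ∏ i, (R + ‖z - pts i‖) ^ pe i, fun x hx => ?_⟩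
  rw [hV]
  refine mul_le_mul (hh x).2.le ?_ (Finset.prod_nonneg fun i _ => by positivity) (by positivity)
  refine Finset.prod_le_prod (fun i _ => by positivity) fun i _ => ?_
  refine rpow_le_rpow (norm_nonneg _) ?_ (hpe i).le
  calc ‖x - pts i‖ = ‖(x - z) + (z - pts i)‖ := by congr 1; abel
    _ ≤ ‖x - z‖ + ‖z - pts i‖ := norm_add_le _ _
    _ ≤ _ := by linarith

end Fin8

theorem stmt15 (Q : E2 → ℝ) (hQ : IsGroundState Q) (n : ℕ) (hn : 0 < n)
    (pts : Fin n → E2) (hpts : Function.Injective pts)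
    (pe : Fin n → ℝ) (hpe : ∀ i, 0 < pe i)
    (h : E2 → ℝ) (C' : ℝ) (hC : 0 < C') (hh : ∀ x, C' < h x ∧ h x < 1 / C')
    (V : E2 → ℝ) (hV : ∀ x, V x = h x * ∏ i, ‖x - pts i‖ ^ pe i)
    (p : ℝ) (hple : ∀ i, pe i ≤ p) (hpmax : ∃ i, pe i = p) :
    ∃ C : ℝ, 0 < C ∧ ∀ a : ℝ, ∀ u : E2 → ℝ,
      0 ≤ a → a < (∫ x : E2, Q x ^ 2) → IsMinimizer V a u →
      (∫ x : E2, gradSq u x) ≤ C * ((∫ x : E2, Q x ^ 2) - a) ^ (-(2 / (2 + p))) ∧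
      (∫ x : E2, V x * u x ^ 2) ≤ C * ((∫ x : E2, Q x ^ 2) - a) ^ (p / (2 + p)) := by
  obtain ⟨i, hi⟩ := hpmax
  have hp : 0 < p := hi ▸ hpe i
  have hA := GS.mass_pos hQ
  have V0 := Fin8.Vnn hC hh hV
  have Vb := Fin8.Vbd hpe hC hh hV
  have gn := fun (u : E2 → ℝ) (hu : IsH1 u) (h1 : ∫ x, u x ^ 2 = 1) => GS.gnQ hQ hu h1
  have Pn : ∀ u : E2 → ℝ, 0 ≤ ∫ x, V x * u x ^ 2 := fun u => integral_nonneg fun x => mul_nonneg (V0 x) (sq_nonneg _)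
  have Gn : ∀ u : E2 → ℝ, 0 ≤ ∫ x, gradSq u x := fun u => integral_nonneg fun x => sq_nonneg _
  by_cases hm : AEStronglyMeasurable V
  · obtain ⟨M, hM, ht⟩ := Tr.trial hQ hpe hC hh hV i hi hm
    set A := ∫ x : E2, Q x ^ 2 with hAdef
    refine ⟨A * M + M, by positivity, fun a u ha haA hu => ?_⟩
    obtain ⟨v, hv, hv1, hvE⟩ := ht a ha haA
    have hle := (hu.2.2 v hv hv1).trans hvE
    have h4 := gn u hu.1.1 hu.2.1
    set G := ∫ x, gradSq u x with hG
    set W := ∫ x, V x * u x ^ 2 with hW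
    have hG0 : 0 ≤ G := Gn u
    have hW0 : 0 ≤ W := Pn u
    have hd : 0 < A - a := by linarith
    set t := (A - a) ^ (p / (2 + p)) with htdef
    have ht0 : 0 < t := rpow_pos_of_pos hd _
    have e1 : G + W - a / A * G ≤ M * t := by
      have k1 : a / 2 * ∫ x, u x ^ 4 ≤ a / A * G := by
        calc _ ≤ a / 2 * (2 / A * G) := mul_le_mul_of_nonneg_left h4 (by positivity)
          _ = _ := by field_simp
      have k2 : G + W - a / 2 * (∫ x, u x ^ 4) ≤ M * t := hle
      linarith
    have e2 : G - a / A * G = (A - a) * G / A := by field_simp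
    have e3 : 0 ≤ (A - a) * G / A := by positivity
    have hs : t = (A - a) * (A - a) ^ (-(2 / (2 + p))) := by
      rw [htdef, ← rpow_one_add' hd.le]
      · congr 1; field_simp; ring
      · have : 1 + -(2 / (2 + p)) = p / (2 + p) := by field_simp; ring
        rw [this]; positivity
    set s := (A - a) ^ (-(2 / (2 + p))) with hsdef
    have hs0 : 0 < s := rpow_pos_of_pos hd _
    constructor
    · have e4 : (A - a) * G / A ≤ M * t := by linarith
      rw [div_le_iff₀ hA, hs] at e4
      have e5 : (A - a) * G ≤ (A - a) * (A * M * s) := by nlinarith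
      have e6 := le_of_mul_le_mul_left e5 hd
      nlinarith [mul_pos hM hs0]
    · nlinarith [mul_pos (mul_pos hA hM) ht0]
  · set A := ∫ x : E2, Q x ^ 2 with hAdef
    have az : ∀ a u, 0 ≤ a → IsMinimizer V a u → a = 0 := by
      intro a u ha hu
      by_contra hne
      exact hm (Mn.meas (lt_of_le_of_ne ha (Ne.symm hne)) hu V0 Vb)
    by_cases hex : ∃ v, IsMinimizer V 0 v
    · obtain ⟨v, hv⟩ := hex
      set e := Ea V 0 v with he
      have he0 : 0 ≤ e := by
        have h1 := Gn v
        have h2 := Pn v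
        rw [he]; simp only [Ea]; linarith
      set s := A ^ (-(2 / (2 + p))) with hs
      set t := A ^ (p / (2 + p)) with ht
      have hs0 : 0 < s := rpow_pos_of_pos hA _
      have ht0 : 0 < t := rpow_pos_of_pos hA _
      refine ⟨(e + 1) / s + (e + 1) / t, by positivity, fun a u ha haA hu => ?_⟩
      obtain rfl := az a u ha hu
      rw [sub_zero]
      have hle := hu.2.2 v hv.1 hv.2.1
      have h1 := Gn u
      have h2 := Pn u
      have h3 : (∫ x, gradSq u x) + (∫ x, V x * u x ^ 2) ≤ e := by
        have : Ea V 0 u ≤ e := hle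
        simp only [Ea] at this
        linarith
      constructor
      · have : ((e + 1) / s + (e + 1) / t) * s = (e + 1) + (e + 1) / t * s := by field_simp
        rw [← hs, this]
        have : 0 ≤ (e + 1) / t * s := by positivity
        linarith
      · have : ((e + 1) / s + (e + 1) / t) * t = (e + 1) / s * t + (e + 1) := by field_simp
        rw [← ht, this]
        have : 0 ≤ (e + 1) / s * t := by positivity
        linarith
    · refine ⟨1, one_pos, fun a u ha haA hu => ?_⟩
      obtain rfl := az a u ha hu
      exact absurd ⟨u, hu⟩ hex
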